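/- Let d ≥ 3 and let P ∈ ℂ[X_1,…,X_d] be nonzero with principal part P_m such that {ξ ∈ ℝ^d : P_m(ξ) = 0} is a one-dimensional linear subspace of ℝ^d. Let X ⊆ ℝ^d be open such that P(∂) : C^∞(X) → C^∞(X) is surjective (i.e., X is P-convex for supports). Let n ∈ ℕ, X_n := {x ∈ X : |x| < n and dist(x, ℝ^d∖X) > 1/n}, and let x ∈ X∖X_n and ε > 0 be such that the closed ball B̄(x,ε) ⊆ X∖cl(X_n). Then the restriction map C_P^∞(X) → C_P^∞(X_n ∪ B(x,ε)) has dense range: for every f ∈ C^∞(X_n ∪ B(x,ε)) with P(∂)f = 0, every l ∈ ℕ₀, every compact K ⊆ X_n ∪ B(x,ε) and every δ > 0 there exists g ∈ C^∞(X) with P(∂)g = 0 on X and ‖g − f‖_{l,K} < δ. -/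

import Mathlib

open scoped BigOperators

noncomputable section

/-- Partial derivative in the `i`-th coordinate direction. -/
def pderivE {d : ℕ} {F : Type*} [NormedAddCommGroup F] [NormedSpace ℝ F] (i : Fin d)
    (f : EuclideanSpace ℝ (Fin d) → F) : EuclideanSpace ℝ (Fin d) → F :=
  fun x => fderiv ℝ f x (EuclideanSpace.single i 1)

/-- Iterated partial derivative `∂^α f` for a multi-index `α : Fin d → ℕ`. -/
def mderivE {d : ℕ} {F : Type*} [NormedAddCommGroup F] [NormedSpace ℝ F] (α : Fin d → ℕ)
    (f : EuclideanSpace ℝ (Fin d) → F) : EuclideanSpace ℝ (Fin d) → F :=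
  (List.finRange d).foldr (fun i g => (pderivE i)^[α i] g) f

/-- The seminorm `‖f‖_{l,K} = max_{|α| ≤ l} sup_{x ∈ K} ‖∂^α f (x)‖`. -/
def cSemiNorm {d : ℕ} {F : Type*} [NormedAddCommGroup F] [NormedSpace ℝ F] (l : ℕ)
    (K : Set (EuclideanSpace ℝ (Fin d))) (f : EuclideanSpace ℝ (Fin d) → F) : ℝ :=
  ⨆ α : Fin d → ℕ, ⨆ (_ : (∑ i, α i) ≤ l), ⨆ x ∈ K, ‖mderivE α f x‖

/-- The constant coefficient linear partial differential operator `P(∂)`. -/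
def PDop {d : ℕ} (P : MvPolynomial (Fin d) ℂ) (f : EuclideanSpace ℝ (Fin d) → ℂ) :
    EuclideanSpace ℝ (Fin d) → ℂ :=
  fun x => ∑ α ∈ P.support, P.coeff α * mderivE (fun i => α i) f x

/-- The canonical exhaustion `X_n = {x ∈ X : |x| < n, dist(x, ℝ^d∖X) > 1/n}`
(with `dist(x, ∅) = ∞`). -/
def exhSet {d : ℕ} (X : Set (EuclideanSpace ℝ (Fin d))) (n : ℕ) :
    Set (EuclideanSpace ℝ (Fin d)) :=
  {x | x ∈ X ∧ ‖x‖ < (n : ℝ) ∧ ENNReal.ofReal (1 / (n : ℝ)) < EMetric.infEdist x Xᶜ}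


end

open scoped BigOperators
noncomputable section

open Set Filter Topology MeasureTheory Metric

/-- Euclidean space of dimension `d`. -/
abbrev EE (d : ℕ) := EuclideanSpace ℝ (Fin d)

/-- Smooth on a set. -/
abbrev Sm {d : ℕ} (f : EE d → ℂ) (U : Set (EE d)) : Prop := ContDiffOn ℝ (⊤ : ℕ∞) f U

/-- Derivative along a word. -/
def wd {d : ℕ} (w : List (Fin d)) (f : EE d → ℂ) : EE d → ℂ := w.foldr pderivE f

/-- The word of a multi-index. -/
def word {d : ℕ} (α : Fin d → ℕ) : List (Fin d) :=
  (List.finRange d).flatMap (fun i => List.replicate (α i) i)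

@[simp] lemma wd_nil {d : ℕ} (f : EE d → ℂ) : wd [] f = f := rfl
@[simp] lemma wd_cons {d : ℕ} (i : Fin d) (w : List (Fin d)) (f : EE d → ℂ) :
    wd (i :: w) f = pderivE i (wd w f) := rfl
lemma wd_append {d : ℕ} (w w' : List (Fin d)) (f : EE d → ℂ) :
    wd (w ++ w') f = wd w (wd w' f) := by simp [wd]

lemma wd_replicate {d : ℕ} (k : ℕ) (i : Fin d) (f : EE d → ℂ) :
    wd (List.replicate k i) f = (pderivE i)^[k] f := by
  induction k with
  | zero => rfl
  | succ k ih => rw [List.replicate_succ, wd_cons, ih, Function.iterate_succ_apply']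

lemma mderivE_eq_wd {d : ℕ} (α : Fin d → ℕ) (f : EE d → ℂ) :
    mderivE α f = wd (word α) f := by
  unfold mderivE word
  generalize List.finRange d = l
  induction l with
  | nil => rfl
  | cons i l ih => rw [List.foldr_cons, ih, List.flatMap_cons, wd_append, wd_replicate]

lemma length_word {d : ℕ} (α : Fin d → ℕ) : (word α).length = ∑ i, α i := by
  unfold word
  rw [List.length_flatMap]
  simp only [List.length_replicate]
  exact (Fin.sum_univ_def α).symm

lemma prod_word {d : ℕ} {M : Type*} [CommMonoid M] (α : Fin d → ℕ) (z : Fin d → M) :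
    ((word α).map z).prod = ∏ i, z i ^ α i := by
  unfold word
  rw [List.map_flatMap, Fin.prod_univ_def]
  generalize List.finRange d = l
  induction l with
  | nil => rfl
  | cons i l ih => simp only [List.flatMap_cons, List.prod_append, ih]; simp

lemma pderivE_smooth {d : ℕ} {U : Set (EE d)} (hU : IsOpen U) {f : EE d → ℂ} (i : Fin d)
    (hf : Sm f U) : Sm (pderivE i f) U := by
  have h1 : ContDiffOn ℝ (⊤ : ℕ∞) (fderiv ℝ f) U := by
    apply hf.fderiv_of_isOpen hU
    exact le_of_eq rfl
  exact h1.clm_apply contDiffOn_const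

lemma wd_smooth {d : ℕ} {U : Set (EE d)} (hU : IsOpen U) {f : EE d → ℂ} (w : List (Fin d))
    (hf : Sm f U) : Sm (wd w f) U := by
  induction w with
  | nil => exact hf
  | cons i w ih => exact pderivE_smooth hU i ih

lemma wd_contDiff {d : ℕ} {f : EE d → ℂ} (w : List (Fin d))
    (hf : ContDiff ℝ (⊤ : ℕ∞) f) : ContDiff ℝ (⊤ : ℕ∞) (wd w f) := by
  rw [← contDiffOn_univ] at hf ⊢
  exact wd_smooth isOpen_univ w hf

lemma Sm.diffAt {d : ℕ} {U : Set (EE d)} (hU : IsOpen U) {f : EE d → ℂ} (hf : Sm f U) {x : EE d}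
    (hx : x ∈ U) : DifferentiableAt ℝ f x :=
  (hf.differentiableOn (by simp)).differentiableAt (hU.mem_nhds hx)

lemma wd_eventuallyEq {d : ℕ} {f g : EE d → ℂ} {x : EE d} (w : List (Fin d))
    (h : f =ᶠ[𝓝 x] g) : wd w f =ᶠ[𝓝 x] wd w g := by
  induction w with
  | nil => exact h
  | cons i w ih =>
    filter_upwards [ih.fderiv (𝕜 := ℝ)] with y hy
    simp only [wd_cons, pderivE]
    rw [hy]

lemma wd_congr_open {d : ℕ} {f g : EE d → ℂ} {U : Set (EE d)} (hU : IsOpen U) (w : List (Fin d))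
    (h : ∀ x ∈ U, f x = g x) : ∀ x ∈ U, wd w f x = wd w g x := fun x hx =>
  (wd_eventuallyEq w (Filter.eventuallyEq_of_mem (hU.mem_nhds hx) h)).eq_of_nhds

lemma wd_zero {d : ℕ} (w : List (Fin d)) : wd w (fun _ : EE d => (0 : ℂ)) = fun _ => 0 := by
  induction w with
  | nil => rfl
  | cons i w ih => rw [wd_cons, ih]; funext x; simp [pderivE]

lemma wd_add {d : ℕ} {f g : EE d → ℂ} {U : Set (EE d)} (hU : IsOpen U) (w : List (Fin d))
    (hf : Sm f U) (hg : Sm g U) : ∀ x ∈ U, wd w (fun y => f y + g y) x = wd w f x + wd w g x := by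
  induction w with
  | nil => intro x _; rfl
  | cons i w ih =>
    intro x hx
    have h := wd_congr_open hU [i] ih x hx
    simp only [wd_cons, wd_nil] at h ⊢
    rw [h]
    simp only [pderivE]
    rw [fderiv_fun_add (Sm.diffAt hU (wd_smooth hU w hf) hx) (Sm.diffAt hU (wd_smooth hU w hg) hx)]
    rfl

lemma wd_const_mul {d : ℕ} {f : EE d → ℂ} {U : Set (EE d)} (hU : IsOpen U) (w : List (Fin d))
    (c : ℂ) (hf : Sm f U) : ∀ x ∈ U, wd w (fun y => c * f y) x = c * wd w f x := by
  induction w with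
  | nil => intro x _; rfl
  | cons i w ih =>
    intro x hx
    have h := wd_congr_open hU [i] ih x hx
    simp only [wd_cons, wd_nil] at h ⊢
    rw [h]
    simp only [pderivE]
    rw [fderiv_const_mul (Sm.diffAt hU (wd_smooth hU w hf) hx)]
    rfl

lemma wd_sub {d : ℕ} {f g : EE d → ℂ} {U : Set (EE d)} (hU : IsOpen U) (w : List (Fin d))
    (hf : Sm f U) (hg : Sm g U) : ∀ x ∈ U, wd w (fun y => f y - g y) x = wd w f x - wd w g x := by
  intro x hx
  have h1 := wd_const_mul hU w (-1) hg x hx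
  have h2 := wd_add hU w hf (g := fun y => (-1) * g y) (contDiffOn_const.mul hg) x hx
  rw [h1] at h2
  have : (fun y => f y - g y) = (fun y => f y + (-1) * g y) := by funext y; ring
  rw [this, h2]; ring

lemma wd_sum {d : ℕ} {ι : Type*} (s : Finset ι) {f : ι → EE d → ℂ} {U : Set (EE d)}
    (hU : IsOpen U) (w : List (Fin d)) (hf : ∀ j ∈ s, Sm (f j) U) :
    ∀ x ∈ U, wd w (fun y => ∑ j ∈ s, f j y) x = ∑ j ∈ s, wd w (f j) x := by
  classical
  induction s using Finset.induction_on with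
  | empty => intro x _; simp [wd_zero]
  | insert a s ha ih =>
    intro x hx
    simp only [Finset.sum_insert ha]
    rw [wd_add hU w (hf a (by simp)) (ContDiffOn.sum fun j hj => hf j (by simp [hj])) x hx,
      ih (fun j hj => hf j (by simp [hj])) x hx]

lemma pderivE_comm {d : ℕ} {f : EE d → ℂ} {U : Set (EE d)} (hU : IsOpen U) (i j : Fin d)
    (hf : Sm f U) : ∀ x ∈ U, pderivE i (pderivE j f) x = pderivE j (pderivE i f) x := by
  intro x hx
  have hfa : ContDiffAt ℝ (⊤ : ℕ∞) f x := hf.contDiffAt (hU.mem_nhds hx)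
  have hs : IsSymmSndFDerivAt ℝ f x := hfa.isSymmSndFDerivAt (by
    simp only [minSmoothness_of_isRCLikeNormedField]
    exact WithTop.coe_le_coe.2 le_top)
  have hd : DifferentiableAt ℝ (fderiv ℝ f) x := by
    have : ContDiffOn ℝ (⊤ : ℕ∞) (fderiv ℝ f) U := hf.fderiv_of_isOpen hU (le_of_eq rfl)
    exact (this.differentiableOn (by simp)).differentiableAt (hU.mem_nhds hx)
  have key : ∀ a b : EE d, fderiv ℝ (fun y => fderiv ℝ f y a) x b = fderiv ℝ (fderiv ℝ f) x b a := by
    intro a b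
    rw [fderiv_clm_apply hd (differentiableAt_const a)]
    simp
  show fderiv ℝ (fun y => fderiv ℝ f y _) x _ = fderiv ℝ (fun y => fderiv ℝ f y _) x _
  rw [key, key, hs.eq]

lemma wd_snoc {d : ℕ} {f : EE d → ℂ} {U : Set (EE d)} (hU : IsOpen U) (w : List (Fin d)) (i : Fin d)
    (hf : Sm f U) : ∀ x ∈ U, wd w (pderivE i f) x = pderivE i (wd w f) x := by
  induction w with
  | nil => intro x _; rfl
  | cons j w ih =>
    intro x hx
    have h := wd_congr_open hU [j] ih x hx
    simp only [wd_cons, wd_nil] at h ⊢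
    rw [h, pderivE_comm hU j i (wd_smooth hU w hf) x hx]

lemma wd_comm {d : ℕ} {f : EE d → ℂ} {U : Set (EE d)} (hU : IsOpen U) (w w' : List (Fin d))
    (hf : Sm f U) : ∀ x ∈ U, wd w (wd w' f) x = wd w' (wd w f) x := by
  induction w' with
  | nil => intro x _; rfl
  | cons j w' ih =>
    intro x hx
    rw [wd_cons, wd_snoc hU w j (wd_smooth hU w' hf) x hx]
    have h := wd_congr_open hU [j] ih x hx
    simpa using h

lemma wd_comp_sub {d : ℕ} (w : List (Fin d)) (f : EE d → ℂ) (a : EE d) :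
    wd w (fun y => f (y - a)) = fun y => wd w f (y - a) := by
  induction w with
  | nil => rfl
  | cons i w ih =>
    rw [wd_cons, ih, wd_cons]
    funext x
    simp only [pderivE]
    rw [fderiv_comp_sub]

lemma wd_comp_const_sub {d : ℕ} (w : List (Fin d)) (f : EE d → ℂ) (a : EE d)
    (hf : ContDiff ℝ (⊤ : ℕ∞) f) :
    wd w (fun y => f (a - y)) = fun y => (-1) ^ w.length * wd w f (a - y) := by
  induction w with
  | nil => simp
  | cons i w ih =>
    rw [wd_cons, ih, wd_cons]
    funext x
    simp only [pderivE]
    have hd : Differentiable ℝ (wd w f) := (wd_contDiff w hf).differentiable (by simp)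
    have h1 : HasFDerivAt (fun y => wd w f (a - y)) ((fderiv ℝ (wd w f) (a - x)).comp
        (-(ContinuousLinearMap.id ℝ (EE d)))) x :=
      (hd (a - x)).hasFDerivAt.comp x ((hasFDerivAt_id x).const_sub a)
    rw [(h1.const_mul ((-1 : ℂ) ^ w.length)).fderiv]
    simp [pow_succ]

/-- The transposed operator. -/
def Qop {d : ℕ} (P : MvPolynomial (Fin d) ℂ) (f : EE d → ℂ) : EE d → ℂ :=
  fun x => ∑ α ∈ P.support, P.coeff α * ((-1) ^ (word (fun i => α i)).length * wd (word fun i => α i) f x)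

lemma PDop_eq {d : ℕ} (P : MvPolynomial (Fin d) ℂ) (f : EE d → ℂ) :
    PDop P f = fun x => ∑ α ∈ P.support, P.coeff α * wd (word fun i => α i) f x := by
  funext x; simp only [PDop, mderivE_eq_wd]

lemma PDop_smooth {d : ℕ} (P : MvPolynomial (Fin d) ℂ) {f : EE d → ℂ} {U : Set (EE d)}
    (hU : IsOpen U) (hf : Sm f U) : Sm (PDop P f) U := by
  rw [PDop_eq]
  exact ContDiffOn.sum fun α _ => contDiffOn_const.mul (wd_smooth hU _ hf)

lemma Qop_smooth {d : ℕ} (P : MvPolynomial (Fin d) ℂ) {f : EE d → ℂ} {U : Set (EE d)}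
    (hU : IsOpen U) (hf : Sm f U) : Sm (Qop P f) U := by
  exact ContDiffOn.sum fun α _ => contDiffOn_const.mul (contDiffOn_const.mul (wd_smooth hU _ hf))

lemma Qop_contDiff {d : ℕ} (P : MvPolynomial (Fin d) ℂ) {f : EE d → ℂ}
    (hf : ContDiff ℝ (⊤ : ℕ∞) f) : ContDiff ℝ (⊤ : ℕ∞) (Qop P f) := by
  rw [← contDiffOn_univ] at hf ⊢
  exact Qop_smooth P isOpen_univ hf

lemma PDop_contDiff {d : ℕ} (P : MvPolynomial (Fin d) ℂ) {f : EE d → ℂ}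
    (hf : ContDiff ℝ (⊤ : ℕ∞) f) : ContDiff ℝ (⊤ : ℕ∞) (PDop P f) := by
  rw [← contDiffOn_univ] at hf ⊢
  exact PDop_smooth P isOpen_univ hf

lemma PDop_eventuallyEq {d : ℕ} (P : MvPolynomial (Fin d) ℂ) {f g : EE d → ℂ} {x : EE d}
    (h : f =ᶠ[𝓝 x] g) : PDop P f =ᶠ[𝓝 x] PDop P g := by
  have : ∀ᶠ y in 𝓝 x, f =ᶠ[𝓝 y] g := h.eventuallyEq_nhds
  filter_upwards [this] with y hy
  simp only [PDop_eq]
  exact Finset.sum_congr rfl fun α _ => by rw [(wd_eventuallyEq _ hy).eq_of_nhds]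

lemma Qop_eventuallyEq {d : ℕ} (P : MvPolynomial (Fin d) ℂ) {f g : EE d → ℂ} {x : EE d}
    (h : f =ᶠ[𝓝 x] g) : Qop P f =ᶠ[𝓝 x] Qop P g := by
  have : ∀ᶠ y in 𝓝 x, f =ᶠ[𝓝 y] g := h.eventuallyEq_nhds
  filter_upwards [this] with y hy
  simp only [Qop]
  exact Finset.sum_congr rfl fun α _ => by rw [(wd_eventuallyEq _ hy).eq_of_nhds]

lemma Qop_zero {d : ℕ} (P : MvPolynomial (Fin d) ℂ) : Qop P (fun _ => 0) = fun _ => 0 := by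
  funext x; simp [Qop, wd_zero]

lemma PDop_zero {d : ℕ} (P : MvPolynomial (Fin d) ℂ) : PDop P (fun _ => 0) = fun _ => 0 := by
  funext x; simp [PDop_eq, wd_zero]

lemma wd_eq_zero_of_notMem_tsupport {d : ℕ} (w : List (Fin d)) {f : EE d → ℂ} {x : EE d}
    (hx : x ∉ tsupport f) : wd w f x = 0 := by
  have h : f =ᶠ[𝓝 x] fun _ => 0 := notMem_tsupport_iff_eventuallyEq.1 hx
  rw [(wd_eventuallyEq w h).eq_of_nhds, wd_zero]

lemma tsupport_wd_subset {d : ℕ} (w : List (Fin d)) (f : EE d → ℂ) :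
    tsupport (wd w f) ⊆ tsupport f := by
  apply closure_minimal _ (isClosed_tsupport f)
  intro x hx
  by_contra h
  exact hx (wd_eq_zero_of_notMem_tsupport w h)

lemma tsupport_Qop_subset {d : ℕ} (P : MvPolynomial (Fin d) ℂ) (f : EE d → ℂ) :
    tsupport (Qop P f) ⊆ tsupport f := by
  apply closure_minimal _ (isClosed_tsupport f)
  intro x hx
  by_contra h
  refine hx ?_
  simp [Qop, wd_eq_zero_of_notMem_tsupport _ h]

lemma tsupport_PDop_subset {d : ℕ} (P : MvPolynomial (Fin d) ℂ) (f : EE d → ℂ) :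
    tsupport (PDop P f) ⊆ tsupport f := by
  apply closure_minimal _ (isClosed_tsupport f)
  intro x hx
  by_contra h
  refine hx ?_
  simp [PDop_eq, wd_eq_zero_of_notMem_tsupport _ h]

lemma hasCompactSupport_wd {d : ℕ} (w : List (Fin d)) {f : EE d → ℂ} (hf : HasCompactSupport f) :
    HasCompactSupport (wd w f) := hf.of_isClosed_subset (isClosed_tsupport _) (tsupport_wd_subset w f)

lemma ibp_one {d : ℕ} (i : Fin d) {f g : EE d → ℂ} (hf : ContDiff ℝ (⊤ : ℕ∞) f)
    (hc : HasCompactSupport f) (hg : ContDiff ℝ (⊤ : ℕ∞) g) :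
    ∫ x, f x * pderivE i g x = - ∫ x, pderivE i f x * g x := by
  have hf' := wd_contDiff [i] hf
  have hg' := wd_contDiff [i] hg
  have hc' := hasCompactSupport_wd [i] hc
  simp only [wd_cons, wd_nil] at hf' hg' hc'
  apply integral_mul_fderiv_eq_neg_fderiv_mul_of_integrable
  · exact (hf'.continuous.mul hg.continuous).integrable_of_hasCompactSupport hc'.mul_right
  · exact (hf.continuous.mul hg'.continuous).integrable_of_hasCompactSupport hc.mul_right
  · exact (hf.continuous.mul hg.continuous).integrable_of_hasCompactSupport hc.mul_right
  · exact fun x _ => (hf.differentiable (by simp)) x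
  · exact fun x _ => (hg.differentiable (by simp)) x

lemma ibp_wd {d : ℕ} (w : List (Fin d)) {f g : EE d → ℂ} (hf : ContDiff ℝ (⊤ : ℕ∞) f)
    (hc : HasCompactSupport f) (hg : ContDiff ℝ (⊤ : ℕ∞) g) :
    ∫ x, f x * wd w g x = (-1) ^ w.length * ∫ x, wd w f x * g x := by
  induction w generalizing f with
  | nil => simp
  | cons i w ih =>
    rw [wd_cons, ibp_one i hf hc (wd_contDiff w hg)]
    have := ih (f := pderivE i f) (wd_contDiff [i] hf) (hasCompactSupport_wd [i] hc)
    rw [this]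
    have h2 : wd w (pderivE i f) = pderivE i (wd w f) := by
      funext x
      exact wd_snoc isOpen_univ w i (contDiffOn_univ.2 hf) x trivial
    rw [h2, wd_cons, List.length_cons, pow_succ]; ring

lemma ibp_P {d : ℕ} (P : MvPolynomial (Fin d) ℂ) {f g : EE d → ℂ} (hf : ContDiff ℝ (⊤ : ℕ∞) f)
    (hc : HasCompactSupport f) (hg : ContDiff ℝ (⊤ : ℕ∞) g) :
    ∫ x, f x * PDop P g x = ∫ x, Qop P f x * g x := by
  simp only [PDop_eq, Qop, Finset.mul_sum, Finset.sum_mul]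
  rw [integral_finsetSum, integral_finsetSum]
  · apply Finset.sum_congr rfl
    intro α _
    have h1 : ∀ x, f x * (P.coeff α * wd (word fun i => α i) g x) =
      P.coeff α * (f x * wd (word fun i => α i) g x) := fun x => by ring
    have h2 : ∀ x, P.coeff α * ((-1) ^ (word (fun i => α i)).length * wd (word fun i => α i) f x) * g x
      = P.coeff α * (-1) ^ (word (fun i => α i)).length * (wd (word fun i => α i) f x * g x) :=
      fun x => by ring
    simp only [h1, h2]
    rw [integral_const_mul, integral_const_mul, ibp_wd _ hf hc hg]; ring
  · intro α _
    exact (Continuous.mul (continuous_const.mul (continuous_const.mul (wd_contDiff _ hf).continuous))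
      hg.continuous).integrable_of_hasCompactSupport
      ((hasCompactSupport_wd _ hc).mul_left.mul_left.mul_right)
  · intro α _
    exact (hf.continuous.mul (continuous_const.mul (wd_contDiff _ hg).continuous)).integrable_of_hasCompactSupport
      hc.mul_right

/-- cut-off functions -/
lemma exists_cutoff {d : ℕ} {K U : Set (EE d)} (hK : IsCompact K) (hU : IsOpen U) (hKU : K ⊆ U) :
    ∃ χ : EE d → ℂ, ContDiff ℝ (⊤ : ℕ∞) χ ∧ HasCompactSupport χ ∧ tsupport χ ⊆ U ∧
      ∃ V, IsOpen V ∧ K ⊆ V ∧ V ⊆ U ∧ ∀ x ∈ V, χ x = 1 := by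
  obtain ⟨L, hL, hKL, hLU⟩ := exists_compact_between hK hU hKU
  obtain ⟨L', hL', hLL', hLU'⟩ := exists_compact_between hL hU hLU
  obtain ⟨f, hf, _, hf0, hf1⟩ := exists_contMDiff_support_eq_eq_one_iff (modelWithCornersSelf ℝ (EE d))
    (n := ⊤) isOpen_interior hL.isClosed hLL'
  refine ⟨fun x => (f x : ℂ), ?_, ?_, ?_, interior L, isOpen_interior, hKL, interior_subset.trans hLU, ?_⟩
  · exact Complex.ofRealCLM.contDiff.comp hf.contDiff
  · apply HasCompactSupport.of_support_subset_isCompact hL'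
    intro x hx
    have : x ∈ Function.support f := by simpa using hx
    rw [hf0] at this
    exact interior_subset this
  · refine (closure_minimal ?_ hL'.isClosed).trans hLU'
    intro x hx
    have : x ∈ Function.support f := by simpa using hx
    rw [hf0] at this
    exact interior_subset this
  · intro x hx
    have := (hf1 x).1 (interior_subset hx)
    simp [this]

lemma mul_cutoff_contDiff {d : ℕ} {χ f : EE d → ℂ} {U : Set (EE d)} (hU : IsOpen U)
    (hχ : ContDiff ℝ (⊤ : ℕ∞) χ) (hs : tsupport χ ⊆ U) (hf : Sm f U) :
    ContDiff ℝ (⊤ : ℕ∞) (fun x => χ x * f x) := by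
  rw [contDiff_iff_contDiffAt]
  intro x
  by_cases hx : x ∈ U
  · exact hχ.contDiffAt.mul (hf.contDiffAt (hU.mem_nhds hx))
  · have h0 : χ =ᶠ[𝓝 x] fun _ => 0 := notMem_tsupport_iff_eventuallyEq.1 fun h => hx (hs h)
    have : (fun x => χ x * f x) =ᶠ[𝓝 x] fun _ => 0 := by
      filter_upwards [h0] with y hy
      simp [hy]
    exact contDiffAt_const.congr_of_eventuallyEq this

end

open scoped BigOperators
noncomputable section

open Set Filter Topology

/-- sequential completeness for a sequence of seminorms -/
def SeqComplete {E : Type*} [AddCommGroup E] [Module ℝ E] (p : ℕ → Seminorm ℝ E) : Prop :=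
  ∀ u : ℕ → E, (∀ n m, n ≤ m → p n (u m - u n) ≤ (1 / 2 : ℝ) ^ n) →
    ∃ x, ∀ k, Tendsto (fun n => p k (u n - x)) atTop (𝓝 0)

section OpenMapping
variable {E F : Type*} [AddCommGroup E] [Module ℝ E] [AddCommGroup F] [Module ℝ F]

lemma frechet_baire (p : ℕ → Seminorm ℝ E) (q : ℕ → Seminorm ℝ F) (hq : Monotone q)
    (cq : SeqComplete q) (A : E →ₗ[ℝ] F)
    (hA : ∀ y, ∃ x, ∀ k, q k (A x - y) = 0) (k : ℕ) :
    ∃ (n : ℕ) (y0 : F) (j : ℕ) (r : ℝ), 0 < r ∧ ∀ y, q j (y - y0) ≤ r →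
      ∀ i (ε : ℝ), 0 < ε → ∃ x, p k x ≤ n ∧ q i (A x - y) ≤ ε := by
  by_contra hcon
  push Not at hcon
  have step : ∀ (n : ℕ) (s : F × ℕ × {r : ℝ // 0 < r}), ∃ s' : F × ℕ × {r : ℝ // 0 < r},
      (∀ z, q s'.2.1 (z - s'.1) ≤ s'.2.2 → q s.2.1 (z - s.1) ≤ s.2.2) ∧ n ≤ s'.2.1 ∧
      (s'.2.2 : ℝ) ≤ (1 / 2) ^ (n + 1) ∧ ∀ x, p k x ≤ n → ¬ q s'.2.1 (A x - s'.1) ≤ s'.2.2 := by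
    rintro n ⟨y, j, r, hr⟩
    obtain ⟨y', hy', i, ε, hε, h⟩ := hcon n y j (r / 2) (half_pos hr)
    refine ⟨⟨y', max (max j i) n, ⟨min (min (r / 2) ε) ((1 / 2) ^ (n + 1)), ?_⟩⟩, ?_, ?_, ?_, ?_⟩
    · positivity
    · intro z hz
      simp only at hz ⊢
      have h1 : q j (z - y') ≤ r / 2 := by
        refine ((hq (by simp : j ≤ max (max j i) n)) _).trans (hz.trans ?_)
        simp
      have h2 : z - y = (z - y') + (y' - y) := by abel
      rw [h2]
      linarith [map_add_le_add (q j) (z - y') (y' - y)]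
    · simp
    · simp
    · intro x hx hx'
      simp only at hx'
      have h1 : q i (A x - y') ≤ ε := by
        refine ((hq (by simp : i ≤ max (max j i) n)) _).trans (hx'.trans ?_)
        simp
      exact absurd h1 (not_le.2 (h x hx))
  choose nxt hn1 hn2 hn3 hn4 using step
  let s : ℕ → F × ℕ × {r : ℝ // 0 < r} := fun n =>
    Nat.rec (⟨0, 0, ⟨1, one_pos⟩⟩) (fun n s => nxt n s) n
  have hs : ∀ n, s (n + 1) = nxt n (s n) := fun n => rfl
  have hnest : ∀ n m, n ≤ m → ∀ z, q (s m).2.1 (z - (s m).1) ≤ (s m).2.2 →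
      q (s n).2.1 (z - (s n).1) ≤ (s n).2.2 := by
    intro n m hnm
    induction m, hnm using Nat.le_induction with
    | base => intro z hz; exact hz
    | succ m _ ih =>
      intro z hz
      rw [hs m] at hz
      exact ih z (hn1 m (s m) z hz)
  have hin : ∀ n m, n ≤ m → q (s n).2.1 ((s m).1 - (s n).1) ≤ (s n).2.2 := by
    intro n m hnm
    refine hnest n m hnm _ ?_
    simp [(s m).2.2.2.le]
  obtain ⟨y, hy⟩ := cq (fun n => (s (n + 1)).1) (by
    intro n m hnm
    have h1 := hin (n + 1) (m + 1) (by omega)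
    have h2 : n ≤ (s (n + 1)).2.1 := by rw [hs]; exact hn2 _ _
    have h3 : ((s (n + 1)).2.2 : ℝ) ≤ (1 / 2) ^ (n + 1) := by rw [hs]; exact hn3 _ _
    have h4 : (1 / 2 : ℝ) ^ (n + 1) ≤ (1 / 2) ^ n :=
      pow_le_pow_of_le_one (by norm_num) (by norm_num) (by omega)
    exact ((hq h2) _).trans (h1.trans (h3.trans h4)))
  have hyin : ∀ n, q (s n).2.1 (y - (s n).1) ≤ (s n).2.2 := by
    intro n
    have h1 := (hy (s n).2.1).const_add ((s n).2.2 : ℝ)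
    rw [add_zero] at h1
    refine ge_of_tendsto h1 ?_
    filter_upwards [eventually_ge_atTop n] with m hm
    have h2 := hin n (m + 1) (by omega)
    have h3 : y - (s n).1 = ((s (m + 1)).1 - (s n).1) - ((s (m + 1)).1 - y) := by abel
    rw [h3]
    exact (map_sub_le_add _ _ _).trans (by linarith)
  obtain ⟨x, hx⟩ := hA y
  obtain ⟨n, hn⟩ := exists_nat_ge (p k x)
  have h1 := hyin (n + 1)
  rw [hs] at h1
  refine hn4 n (s n) x hn ?_
  have h2 : A x - (nxt n (s n)).1 = (A x - y) + (y - (nxt n (s n)).1) := by abel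
  rw [h2]
  exact (map_add_le_add _ _ _).trans (by rw [hx]; linarith)

lemma frechet_almost (p : ℕ → Seminorm ℝ E) (q : ℕ → Seminorm ℝ F) (hq : Monotone q)
    (cq : SeqComplete q) (A : E →ₗ[ℝ] F)
    (hA : ∀ y, ∃ x, ∀ k, q k (A x - y) = 0) (k : ℕ) :
    ∃ (j : ℕ) (C : ℝ), 0 ≤ C ∧ ∀ y i (ε η : ℝ), 0 < ε → 0 < η →
      ∃ x, p k x ≤ C * q j y + η ∧ q i (A x - y) ≤ ε := by
  obtain ⟨n, y0, j, r, hr, h⟩ := frechet_baire p q hq cq A hA k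
  refine ⟨j, 2 * n / r, by positivity, ?_⟩
  intro y i ε η hε hη
  have hnn : 0 ≤ q j y := apply_nonneg _ _
  set s : ℝ := q j y / r + η / (2 * n + 1) with hs
  have hs0 : 0 < s := by positivity
  have h1 : q j (y0 + s⁻¹ • y - y0) ≤ r := by
    rw [add_sub_cancel_left, map_smul_eq_mul, Real.norm_eq_abs, abs_of_pos (inv_pos.2 hs0),
      inv_mul_le_iff₀ hs0]
    have : q j y / r * r = q j y := by field_simp
    have h2 : 0 ≤ η / (2 * n + 1) * r := by positivity
    rw [hs, add_mul]; linarith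
  obtain ⟨x1, hx1, hx1'⟩ := h _ h1 i (ε / s / 2) (by positivity)
  obtain ⟨x0, hx0, hx0'⟩ := h y0 (by simp [hr.le]) i (ε / s / 2) (by positivity)
  refine ⟨s • (x1 - x0), ?_, ?_⟩
  · rw [map_smul_eq_mul, Real.norm_eq_abs, abs_of_pos hs0]
    have h3 : p k (x1 - x0) ≤ 2 * n := (map_sub_le_add _ _ _).trans (by linarith)
    have h4 : s * p k (x1 - x0) ≤ s * (2 * n) := by gcongr
    refine h4.trans ?_
    rw [hs, add_mul]
    have h5 : q j y / r * (2 * n) = 2 * n / r * q j y := by ring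
    have h6 : η / (2 * n + 1) * (2 * n) ≤ η := by
      rw [div_mul_eq_mul_div, div_le_iff₀ (by positivity)]
      nlinarith
    linarith
  · have h7 : A (s • (x1 - x0)) - y = s • ((A x1 - (y0 + s⁻¹ • y)) - (A x0 - y0)) := by
      rw [map_smul, map_sub]
      simp only [smul_sub, smul_add, smul_smul, mul_inv_cancel₀ hs0.ne', one_smul]
      abel
    rw [h7, map_smul_eq_mul, Real.norm_eq_abs, abs_of_pos hs0]
    have h8 := map_sub_le_add (q i) (A x1 - (y0 + s⁻¹ • y)) (A x0 - y0)
    calc s * q i _ ≤ s * (ε / s / 2 + ε / s / 2) := by gcongr; linarith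
      _ = ε := by field_simp; norm_num

lemma frechet_open (p : ℕ → Seminorm ℝ E) (q : ℕ → Seminorm ℝ F) (hp : Monotone p) (hq : Monotone q)
    (cp : SeqComplete p) (cq : SeqComplete q) (A : E →ₗ[ℝ] F)
    (hAc : ∀ i, ∃ k, ∃ C : ℝ, ∀ x, q i (A x) ≤ C * p k x)
    (hA : ∀ y, ∃ x, ∀ k, q k (A x - y) = 0) (k : ℕ) :
    ∃ (j : ℕ) (C : ℝ), 0 ≤ C ∧ ∀ y (ε : ℝ), 0 < ε →
      ∃ x, (∀ i, q i (A x - y) = 0) ∧ p k x ≤ C * q j y + ε := by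
  choose j C hC0 hC using fun k => frechet_almost p q hq cq A hA k
  refine ⟨j k, C k, hC0 k, ?_⟩
  intro y ε hε
  let e : ℕ → ℝ := fun n => min ε 1 / 4 * (1 / 2) ^ n
  have he0 : ∀ n, 0 < e n := fun n => by positivity
  let dl : ℕ → ℝ := fun n => min ((1 / 2) ^ n) (e (n + 1) / (C (k + (n + 1)) + 1))
  have hdl : ∀ n, 0 < dl n := fun n => by
    have := hC0 (k + (n + 1)); have := he0 (n + 1); positivity
  choose g hg1 hg2 using fun (n : ℕ) (y : F) =>
    hC (k + n) y (max n (j (k + (n + 1)))) (dl n) (e n) (hdl n) (he0 n)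
  let Y : ℕ → F := fun n => Nat.rec y (fun n y => y - A (g n y)) n
  have hY : ∀ n, Y (n + 1) = Y n - A (g n (Y n)) := fun n => rfl
  have hY0 : Y 0 = y := rfl
  have hYs : ∀ n, q (max n (j (k + (n + 1)))) (Y (n + 1)) ≤ dl n := by
    intro n
    rw [hY, ← neg_sub, map_neg_eq_map]
    exact hg2 n (Y n)
  have hpx : ∀ n, p (k + (n + 1)) (g (n + 1) (Y (n + 1))) ≤ 2 * e (n + 1) := by
    intro n
    refine (hg1 (n + 1) _).trans ?_
    have h1 : q (j (k + (n + 1))) (Y (n + 1)) ≤ e (n + 1) / (C (k + (n + 1)) + 1) :=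
      ((hq (le_max_right n _)) _).trans ((hYs n).trans (min_le_right _ _))
    have h2 : C (k + (n + 1)) * q (j (k + (n + 1))) (Y (n + 1)) ≤ e (n + 1) := by
      have := hC0 (k + (n + 1))
      calc _ ≤ C (k + (n + 1)) * (e (n + 1) / (C (k + (n + 1)) + 1)) := by gcongr
        _ = e (n + 1) * (C (k + (n + 1)) / (C (k + (n + 1)) + 1)) := by ring
        _ ≤ e (n + 1) * 1 := by
            have := (he0 (n + 1)).le
            gcongr
            rw [div_le_one (by positivity)]; linarith
        _ = _ := mul_one _
    linarith
  let S : ℕ → E := fun n => ∑ i ∈ Finset.range (n + 1), g i (Y i)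
  have hS : ∀ n, S (n + 1) = S n + g (n + 1) (Y (n + 1)) := fun n => Finset.sum_range_succ _ _
  have hAS : ∀ n, A (S n) - y = - Y (n + 1) := by
    intro n
    induction n with
    | zero => simp only [S, Finset.sum_range_one, zero_add]; rw [show Y 1 = Y 0 - A (g 0 (Y 0)) from hY 0, hY0]; abel
    | succ n ih => rw [hS, map_add, hY (n + 1), add_sub_right_comm, ih]; abel
  have hSd : ∀ n m, n ≤ m → p (k + n) (S m - S n) ≤ 2 * (e n - e m) := by
    intro n m hnm
    induction m, hnm using Nat.le_induction with
    | base => simp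
    | succ m hm ih =>
      rw [hS, add_sub_right_comm]
      have h1 : p (k + n) (g (m + 1) (Y (m + 1))) ≤ 2 * e (m + 1) :=
        ((hp (by omega : k + n ≤ k + (m + 1))) _).trans (hpx m)
      have h2 : e m = 2 * e (m + 1) := by simp only [e, pow_succ]; ring
      have := map_add_le_add (p (k + n)) (S m - S n) (g (m + 1) (Y (m + 1)))
      linarith
  have hmin : min ε 1 ≤ 1 := min_le_right _ _
  have hmin' : min ε 1 ≤ ε := min_le_left _ _
  obtain ⟨x, hx⟩ := cp S (by
    intro n m hnm
    refine ((hp (by omega : n ≤ k + n)) _).trans ((hSd n m hnm).trans ?_)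
    have := he0 m
    have h2 : 2 * e n ≤ (1 / 2) ^ n := by
      simp only [e]
      have : (0 : ℝ) < (1 / 2) ^ n := by positivity
      nlinarith
    linarith)
  refine ⟨x, ?_, ?_⟩
  · intro i
    obtain ⟨k', C', hk'⟩ := hAc i
    have h1 : Tendsto (fun n => C' * p k' (S n - x) + (1 / 2 : ℝ) ^ n) atTop (𝓝 0) := by
      have h2 := (hx k').const_mul C'
      have h3 : Tendsto (fun n : ℕ => (1 / 2 : ℝ) ^ n) atTop (𝓝 0) :=
        tendsto_pow_atTop_nhds_zero_of_lt_one (by norm_num) (by norm_num)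
      simpa using h2.add h3
    refine le_antisymm (ge_of_tendsto h1 ?_) (apply_nonneg _ _)
    filter_upwards [eventually_ge_atTop i] with n hn
    have h4 : A x - y = -(A (S n - x)) + (A (S n) - y) := by rw [map_sub]; abel
    rw [h4, hAS]
    refine (map_add_le_add _ _ _).trans ?_
    rw [map_neg_eq_map, map_neg_eq_map]
    have h5 : q i (Y (n + 1)) ≤ (1 / 2) ^ n :=
      ((hq (hn.trans (le_max_left n _))) _).trans ((hYs n).trans (min_le_left _ _))
    linarith [hk' (S n - x)]
  · have h1 : Tendsto (fun n => p k (S n - x) + (C k * q (j k) y + ε)) atTop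
        (𝓝 (C k * q (j k) y + ε)) := by
      simpa using (hx k).add_const (C k * q (j k) y + ε)
    refine ge_of_tendsto h1 (Eventually.of_forall fun n => ?_)
    have h2 : x = -(S n - x) + ((S n - S 0) + S 0) := by abel
    have h3 := hSd 0 n (by omega)
    have h4 := hg1 0 y
    have h5 : S 0 = g 0 y := by simp [S, hY0]
    have h6 : e 0 = min ε 1 / 4 := by simp [e]
    have h7 := he0 n
    have h8 := map_add_le_add (p k) (-(S n - x)) ((S n - S 0) + S 0)
    have h9 := map_add_le_add (p k) (S n - S 0) (S 0)
    rw [← h2, map_neg_eq_map] at h8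
    simp only [add_zero] at h3 h4
    rw [h5] at h8 h9 h3
    linarith

end OpenMapping
end

open scoped BigOperators
noncomputable section

open Set Filter Topology MeasureTheory Metric TopologicalSpace

/-- Words of length at most `l`. -/
abbrev Wd (d l : ℕ) := {w : List (Fin d) // w.length ≤ l}

instance instFintypeWd (d l : ℕ) : Fintype (Wd d l) :=
  (List.finite_length_le (Fin d) l).fintype

/-- values of jets -/
abbrev VV (d l : ℕ) := Wd d l → ℂ

open Classical in
/-- The `l`-jet of `f` on `K`. -/
def jet {d : ℕ} (l : ℕ) (K : Compacts (EE d)) (f : EE d → ℂ) : C(K, VV d l) :=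
  if h : Continuous (fun (x : K) (w : Wd d l) => wd w.1 f (x : EE d)) then ⟨_, h⟩ else 0

lemma jet_apply {d l : ℕ} {K : Compacts (EE d)} {U : Set (EE d)} (hU : IsOpen U)
    (hK : (K : Set (EE d)) ⊆ U) {f : EE d → ℂ} (hf : Sm f U) (x : K) (w : Wd d l) :
    jet l K f x w = wd w.1 f (x : EE d) := by
  have h : Continuous (fun (x : K) (w : Wd d l) => wd w.1 f (x : EE d)) := by
    apply continuous_pi
    intro w
    exact (wd_smooth hU w.1 hf).continuousOn.comp_continuous continuous_subtype_val
      (fun x => hK x.2)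
  simp [jet, h]

lemma jet_congr {d l : ℕ} {K : Compacts (EE d)} {U : Set (EE d)} (hU : IsOpen U)
    (hK : (K : Set (EE d)) ⊆ U) {f g : EE d → ℂ} (hfg : ∀ x ∈ U, f x = g x) :
    jet l K f = jet l K g := by
  have : (fun (x : K) (w : Wd d l) => wd w.1 f (x : EE d)) =
      (fun (x : K) (w : Wd d l) => wd w.1 g (x : EE d)) := by
    funext x w
    exact wd_congr_open hU w.1 hfg x (hK x.2)
  unfold jet
  revert this
  generalize (fun (x : K) (w : Wd d l) => wd w.1 f (x : EE d)) = a
  generalize (fun (x : K) (w : Wd d l) => wd w.1 g (x : EE d)) = b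
  rintro rfl
  rfl

lemma norm_jet_le {d l : ℕ} {K : Compacts (EE d)} {U : Set (EE d)} (hU : IsOpen U)
    (hK : (K : Set (EE d)) ⊆ U) {f : EE d → ℂ} (hf : Sm f U) {c : ℝ} (hc : 0 ≤ c) :
    ‖jet l K f‖ ≤ c ↔ ∀ w : List (Fin d), w.length ≤ l → ∀ x ∈ K, ‖wd w f x‖ ≤ c := by
  rw [ContinuousMap.norm_le _ hc]
  constructor
  · intro h w hw x hx
    have := (pi_norm_le_iff_of_nonneg hc).1 (h ⟨x, hx⟩) ⟨w, hw⟩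
    rwa [jet_apply hU hK hf] at this
  · intro h x
    rw [pi_norm_le_iff_of_nonneg hc]
    intro w
    rw [jet_apply hU hK hf]
    exact h w.1 w.2 x x.2

lemma le_norm_jet {d l : ℕ} {K : Compacts (EE d)} {U : Set (EE d)} (hU : IsOpen U)
    (hK : (K : Set (EE d)) ⊆ U) {f : EE d → ℂ} (hf : Sm f U) (w : List (Fin d))
    (hw : w.length ≤ l) {x : EE d} (hx : x ∈ K) : ‖wd w f x‖ ≤ ‖jet l K f‖ :=
  (norm_jet_le hU hK hf (norm_nonneg _)).1 le_rfl w hw x hx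

lemma jet_add {d l : ℕ} {K : Compacts (EE d)} {U : Set (EE d)} (hU : IsOpen U)
    (hK : (K : Set (EE d)) ⊆ U) {f g : EE d → ℂ} (hf : Sm f U) (hg : Sm g U) :
    jet l K (f + g) = jet l K f + jet l K g := by
  ext x w
  rw [ContinuousMap.add_apply, Pi.add_apply, jet_apply hU hK hf, jet_apply hU hK hg,
    jet_apply hU hK (f := f + g) (hf.add hg)]
  exact wd_add hU w.1 hf hg x (hK x.2)

lemma jet_smul {d l : ℕ} {K : Compacts (EE d)} {U : Set (EE d)} (hU : IsOpen U)
    (hK : (K : Set (EE d)) ⊆ U) {f : EE d → ℂ} (c : ℂ) (hf : Sm f U) :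
    jet l K (c • f) = c • jet l K f := by
  ext x w
  rw [ContinuousMap.smul_apply, Pi.smul_apply, jet_apply hU hK hf,
    jet_apply hU hK (f := c • f) (contDiffOn_const.mul hf)]
  exact wd_const_mul hU w.1 c hf x (hK x.2)

/-- Smooth functions on `X` -/
def SS {d : ℕ} (X : Set (EE d)) : Submodule ℂ (EE d → ℂ) where
  carrier := {f | Sm f X}
  add_mem' := fun ha hb => ContDiffOn.add ha hb
  zero_mem' := contDiffOn_const
  smul_mem' := fun c _ hf => contDiffOn_const.mul hf

/-- the jet as a linear map -/
def jetL {d : ℕ} {X : Set (EE d)} (hX : IsOpen X) (l : ℕ) (K : Compacts (EE d))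
    (hK : (K : Set (EE d)) ⊆ X) : SS X →ₗ[ℂ] C(K, VV d l) where
  toFun f := jet l K f
  map_add' f g := jet_add hX hK f.2 g.2
  map_smul' c f := jet_smul hX hK c f.2

lemma exists_exhaustion {d : ℕ} {X : Set (EE d)} (hX : IsOpen X) :
    ∃ L : ℕ → Compacts (EE d), (∀ i j, i ≤ j → (L i : Set (EE d)) ⊆ L j) ∧
      (∀ k, (L k : Set (EE d)) ⊆ X) ∧
      ∀ K : Set (EE d), IsCompact K → K ⊆ X → ∃ k, K ⊆ L k := by
  have : LocallyCompactSpace X := hX.locallyCompactSpace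
  let c : CompactExhaustion X := CompactExhaustion.choice X
  refine ⟨fun k => ⟨Subtype.val '' c k, (c.isCompact k).image continuous_subtype_val⟩, ?_, ?_, ?_⟩
  · intro i j hij
    exact image_mono (c.subset hij)
  · rintro k _ ⟨x, _, rfl⟩
    exact x.2
  · intro K hK hKX
    have h1 : IsCompact (Subtype.val ⁻¹' K : Set X) :=
      (Topology.IsInducing.subtypeVal).isCompact_preimage' hK (by simpa using hKX)
    obtain ⟨k, hk⟩ := c.exists_superset_of_isCompact h1
    refine ⟨k, fun x hx => ⟨⟨x, hKX hx⟩, hk hx, rfl⟩⟩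

/-- assembling a derivative from the partial derivatives -/
def Lam (d : ℕ) : (Fin d → ℂ) →L[ℝ] (EE d →L[ℝ] ℂ) :=
  ∑ i, (ContinuousLinearMap.smulRightL ℝ (EE d) ℂ (EuclideanSpace.proj i)).comp
    (ContinuousLinearMap.proj i)

lemma Lam_apply {d : ℕ} (c : Fin d → ℂ) (v : EE d) : Lam d c v = ∑ i, (v i : ℂ) * c i := by
  simp [Lam]

lemma fderiv_eq_Lam {d : ℕ} (f : EE d → ℂ) (x : EE d) :
    fderiv ℝ f x = Lam d (fun i => pderivE i f x) := by
  ext v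
  rw [Lam_apply]
  have hv : v = ∑ i, v i • EuclideanSpace.single i (1 : ℝ) := by
    ext j
    simp [Finset.sum_apply, Pi.single_apply]
  conv_lhs => rw [hv]
  rw [map_sum]
  simp [pderivE]

lemma Lam_pderiv {d : ℕ} (c : Fin d → ℂ) (i : Fin d) : Lam d c (EuclideanSpace.single i 1) = c i := by
  rw [Lam_apply]
  rw [Finset.sum_eq_single i]
  · simp
  · intro j _ hj; simp [hj]
  · simp

lemma contDiffOn_of_words {d : ℕ} {X : Set (EE d)} (hX : IsOpen X) (G : List (Fin d) → EE d → ℂ)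
    (h : ∀ w, ∀ x ∈ X, HasFDerivAt (G w) (Lam d fun i => G (i :: w) x) x) :
    ∀ w, Sm (G w) X := by
  have key : ∀ n : ℕ, ∀ w, ContDiffOn ℝ n (G w) X := by
    intro n
    induction n with
    | zero =>
      intro w
      simp only [Nat.cast_zero, contDiffOn_zero]
      exact fun x hx => (h w x hx).continuousAt.continuousWithinAt
    | succ n ih =>
      intro w
      have : ((n + 1 : ℕ) : WithTop ℕ∞) = (n : WithTop ℕ∞) + 1 := by push_cast; rfl
      rw [this, contDiffOn_succ_iff_fderiv_of_isOpen hX]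
      refine ⟨fun x hx => (h w x hx).differentiableAt.differentiableWithinAt, by simp, ?_⟩
      have h2 : ContDiffOn ℝ n (fun x => Lam d fun i => G (i :: w) x) X :=
        (Lam d).contDiff.comp_contDiffOn (contDiffOn_pi.2 fun i => ih (i :: w))
      exact h2.congr fun x hx => (h w x hx).fderiv
  intro w
  exact contDiffOn_infty.2 fun n => key n w

lemma wd_of_words {d : ℕ} {X : Set (EE d)} (hX : IsOpen X) (G : List (Fin d) → EE d → ℂ)
    (h : ∀ w, ∀ x ∈ X, HasFDerivAt (G w) (Lam d fun i => G (i :: w) x) x) (w : List (Fin d)) :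
    ∀ x ∈ X, wd w (G []) x = G w x := by
  induction w with
  | nil => intro x _; rfl
  | cons i w ih =>
    intro x hx
    have h1 := wd_congr_open hX [i] ih x hx
    simp only [wd_cons, wd_nil] at h1 ⊢
    rw [h1]
    simp only [pderivE]
    rw [(h w x hx).fderiv, Lam_pderiv]

/-- The seminorms -/
def semiN {d : ℕ} {X : Set (EE d)} (hX : IsOpen X) (L : ℕ → Compacts (EE d))
    (hLX : ∀ k, (L k : Set (EE d)) ⊆ X) (k : ℕ) : Seminorm ℝ (SS X) :=
  (normSeminorm ℝ (C(L k, VV d k))).comp ((jetL hX k (L k) (hLX k)).restrictScalars ℝ)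

lemma semiN_apply {d : ℕ} {X : Set (EE d)} (hX : IsOpen X) (L : ℕ → Compacts (EE d))
    (hLX : ∀ k, (L k : Set (EE d)) ⊆ X) (k : ℕ) (f : SS X) :
    semiN hX L hLX k f = ‖jet k (L k) f‖ := rfl

lemma semiN_mono {d : ℕ} {X : Set (EE d)} (hX : IsOpen X) (L : ℕ → Compacts (EE d))
    (hLm : ∀ i j, i ≤ j → (L i : Set (EE d)) ⊆ L j)
    (hLX : ∀ k, (L k : Set (EE d)) ⊆ X) : Monotone (semiN hX L hLX) := by
  intro i j hij f
  rw [semiN_apply, semiN_apply, norm_jet_le hX (hLX i) f.2 (norm_nonneg _)]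
  intro w hw x hx
  exact le_norm_jet hX (hLX j) f.2 w (hw.trans hij) (hLm i j hij hx)

lemma semiN_complete {d : ℕ} {X : Set (EE d)} (hX : IsOpen X) (L : ℕ → Compacts (EE d))
    (hLm : ∀ i j, i ≤ j → (L i : Set (EE d)) ⊆ L j)
    (hLX : ∀ k, (L k : Set (EE d)) ⊆ X)
    (hLK : ∀ K : Set (EE d), IsCompact K → K ⊆ X → ∃ k, K ⊆ L k) :
    SeqComplete (semiN hX L hLX) := by
  intro u hu
  have hb : ∀ k (w : List (Fin d)), ∀ x ∈ L k, ∀ n m, k ≤ n → w.length ≤ n → n ≤ m →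
      ‖wd w (u m) x - wd w (u n) x‖ ≤ (1 / 2) ^ n := by
    intro k w x hx n m hkn hwn hnm
    have h1 := hu n m hnm
    rw [semiN_apply] at h1
    have hxn : x ∈ L n := hLm k n hkn hx
    have h2 := (le_norm_jet hX (hLX n) (u m - u n).2 w hwn hxn).trans h1
    rwa [show ((u m - u n : SS X) : EE d → ℂ) = fun y => (u m : EE d → ℂ) y - (u n : EE d → ℂ) y from rfl,
      wd_sub hX w (u m).2 (u n).2 x (hLX n hxn)] at h2
  have hlim : ∀ (w : List (Fin d)) (x : EE d), ∃ y, x ∈ X →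
      Tendsto (fun n => wd w (u n) x) atTop (𝓝 y) := by
    intro w x
    by_cases hx : x ∈ X
    · obtain ⟨k, hk⟩ := hLK {x} isCompact_singleton (by simpa using hx)
      have hk' : x ∈ L k := by simpa using hk
      have hc : CauchySeq (fun n => wd w (u n) x) := by
        rw [Metric.cauchySeq_iff']
        intro ε hε
        have h3 : Tendsto (fun n : ℕ => (1 / 2 : ℝ) ^ n) atTop (𝓝 0) :=
          tendsto_pow_atTop_nhds_zero_of_lt_one (by norm_num) (by norm_num)
        obtain ⟨N, hN⟩ := ((h3.eventually_lt_const hε).and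
          (eventually_ge_atTop (max k w.length))).exists
        refine ⟨N, fun m hm => ?_⟩
        rw [dist_eq_norm]
        exact (hb k w x hk' N m ((le_max_left _ _).trans hN.2)
          ((le_max_right _ _).trans hN.2) hm).trans_lt hN.1
      obtain ⟨y, hy⟩ := cauchySeq_tendsto_of_complete hc
      exact ⟨y, fun _ => hy⟩
    · exact ⟨0, fun h => absurd h hx⟩
  choose G hG using hlim
  have hbG : ∀ k (w : List (Fin d)), ∀ x ∈ L k, ∀ n, k ≤ n → w.length ≤ n →
      ‖G w x - wd w (u n) x‖ ≤ (1 / 2) ^ n := by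
    intro k w x hx n hkn hwn
    have h1 := ((hG w x (hLX k hx)).sub_const (wd w (u n) x)).norm
    refine le_of_tendsto h1 ?_
    filter_upwards [eventually_ge_atTop n] with m hm
    exact hb k w x hx n m hkn hwn hm
  have h0 : Tendsto (fun n : ℕ => (1 / 2 : ℝ) ^ n) atTop (𝓝 0) :=
    tendsto_pow_atTop_nhds_zero_of_lt_one (by norm_num) (by norm_num)
  have hder : ∀ w, ∀ x ∈ X, HasFDerivAt (G w) (Lam d fun i => G (i :: w) x) x := by
    intro w x hx
    refine hasFDerivAt_of_tendstoLocallyUniformlyOn (l := atTop) (f := fun n => wd w (u n))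
      (f' := fun n => fderiv ℝ (wd w (u n))) (g := G w)
      (g' := fun x => Lam d fun i => G (i :: w) x) hX ?_ ?_ ?_ hx
    · rw [Metric.tendstoLocallyUniformlyOn_iff]
      intro ε hε y hy
      obtain ⟨K, hK, hyK, hKX⟩ := exists_compact_subset hX hy
      obtain ⟨k, hk⟩ := hLK K hK hKX
      refine ⟨K, mem_nhdsWithin_of_mem_nhds (mem_of_superset (isOpen_interior.mem_nhds hyK) interior_subset), ?_⟩
      have h1 : ∀ᶠ n in atTop, ‖Lam d‖ * (1 / 2 : ℝ) ^ n < ε :=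
        (h0.const_mul ‖Lam d‖).eventually_lt_const (by simpa using hε)
      filter_upwards [h1, eventually_ge_atTop k, eventually_ge_atTop (w.length + 1)] with n hn hkn hwn z hz
      rw [dist_eq_norm, fderiv_eq_Lam, ← map_sub]
      refine lt_of_le_of_lt ((Lam d).le_opNorm _) (lt_of_le_of_lt ?_ hn)
      gcongr
      rw [pi_norm_le_iff_of_nonneg (by positivity)]
      intro i
      exact hbG k (i :: w) z (hk hz) n hkn (by simpa using hwn)
    · intro n y hy
      exact (Sm.diffAt hX (wd_smooth hX w (u n).2) hy).hasFDerivAt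
    · intro y hy
      exact hG w y hy
  have hsm := contDiffOn_of_words hX G hder
  have hwG := wd_of_words hX G hder
  refine ⟨⟨G [], hsm []⟩, fun k => ?_⟩
  refine squeeze_zero' (Eventually.of_forall fun n => apply_nonneg _ _) ?_ h0
  filter_upwards [eventually_ge_atTop k] with n hn
  rw [semiN_apply, norm_jet_le hX (hLX k) (u n - ⟨G [], hsm []⟩ : SS X).2 (by positivity)]
  intro w hw x hx
  rw [show ((u n - ⟨G [], hsm []⟩ : SS X) : EE d → ℂ) = fun y => (u n : EE d → ℂ) y - G [] y from rfl,
      wd_sub hX w (u n).2 (hsm []) x (hLX k hx), hwG w x (hLX k hx), norm_sub_rev]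
  exact hbG k w x hx n hn (hw.trans hn)

end

open scoped BigOperators
noncomputable section

open Set Filter Topology MeasureTheory Metric TopologicalSpace

lemma SS_sm {d : ℕ} {X : Set (EE d)} (f : SS X) : Sm (f : EE d → ℂ) X := f.2

lemma PDop_add {d : ℕ} (P : MvPolynomial (Fin d) ℂ) {U : Set (EE d)} (hU : IsOpen U)
    {f g : EE d → ℂ} (hf : Sm f U) (hg : Sm g U) :
    ∀ x ∈ U, PDop P (f + g) x = PDop P f x + PDop P g x := by
  intro x hx
  simp only [PDop_eq]
  rw [← Finset.sum_add_distrib]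
  refine Finset.sum_congr rfl fun α _ => ?_
  rw [show f + g = fun y => f y + g y from rfl, wd_add hU _ hf hg x hx]; ring

lemma PDop_smul {d : ℕ} (P : MvPolynomial (Fin d) ℂ) {U : Set (EE d)} (hU : IsOpen U)
    {f : EE d → ℂ} (c : ℂ) (hf : Sm f U) :
    ∀ x ∈ U, PDop P (c • f) x = c * PDop P f x := by
  intro x hx
  simp only [PDop_eq]
  rw [Finset.mul_sum]
  refine Finset.sum_congr rfl fun α _ => ?_
  rw [show c • f = fun y => c * f y from rfl, wd_const_mul hU _ c hf x hx]; ring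

lemma PDop_sub {d : ℕ} (P : MvPolynomial (Fin d) ℂ) {U : Set (EE d)} (hU : IsOpen U)
    {f g : EE d → ℂ} (hf : Sm f U) (hg : Sm g U) :
    ∀ x ∈ U, PDop P (f - g) x = PDop P f x - PDop P g x := by
  intro x hx
  simp only [PDop_eq]
  rw [← Finset.sum_sub_distrib]
  refine Finset.sum_congr rfl fun α _ => ?_
  rw [show f - g = fun y => f y - g y from rfl, wd_sub hU _ hf hg x hx]; ring

lemma wd_PDop {d : ℕ} (P : MvPolynomial (Fin d) ℂ) {U : Set (EE d)} (hU : IsOpen U)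
    {f : EE d → ℂ} (hf : Sm f U) (w : List (Fin d)) :
    ∀ x ∈ U, wd w (PDop P f) x = ∑ α ∈ P.support, P.coeff α * wd (w ++ word fun i => α i) f x := by
  intro x hx
  rw [PDop_eq, wd_sum _ hU w (fun α _ => contDiffOn_const.mul (wd_smooth hU _ hf)) x hx]
  refine Finset.sum_congr rfl fun α _ => ?_
  rw [wd_const_mul hU w _ (wd_smooth hU _ hf) x hx, wd_append]

open Classical in
/-- the operator on the space of smooth functions -/
def opA {d : ℕ} (P : MvPolynomial (Fin d) ℂ) {X : Set (EE d)} (hX : IsOpen X) : SS X →ₗ[ℂ] SS X where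
  toFun f := ⟨X.indicator (PDop P f), (PDop_smooth P hX f.2).congr fun x hx => by simp [hx]⟩
  map_add' f g := by
    ext x
    by_cases hx : x ∈ X
    · simp [hx, PDop_add P hX f.2 g.2 x hx]
    · simp [hx]
  map_smul' c f := by
    ext x
    by_cases hx : x ∈ X
    · simp [hx, PDop_smul P hX c f.2 x hx]
    · simp [hx]

lemma opA_apply {d : ℕ} (P : MvPolynomial (Fin d) ℂ) {X : Set (EE d)} (hX : IsOpen X) (f : SS X)
    {x : EE d} (hx : x ∈ X) : (opA P hX f : EE d → ℂ) x = PDop P f x := by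
  simp [opA, hx]

lemma length_word_le {d : ℕ} (P : MvPolynomial (Fin d) ℂ) {α : Fin d →₀ ℕ} (h : α ∈ P.support) :
    (word fun i => α i).length ≤ P.totalDegree := by
  rw [length_word]
  have := MvPolynomial.le_totalDegree h
  rwa [Finsupp.sum_fintype _ _ (fun _ => rfl)] at this

/-- Surjectivity on `C^∞(X)` -/
def PSurj {d : ℕ} (P : MvPolynomial (Fin d) ℂ) (X : Set (EE d)) : Prop :=
  ∀ g : EE d → ℂ, Sm g X → ∃ f : EE d → ℂ, Sm f X ∧ ∀ x ∈ X, PDop P f x = g x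

lemma open_mapping {d : ℕ} (P : MvPolynomial (Fin d) ℂ) {X : Set (EE d)} (hX : IsOpen X)
    (hs : PSurj P X) (l : ℕ) (K : Compacts (EE d)) (hK : (K : Set (EE d)) ⊆ X) :
    ∃ (j : ℕ) (L : Compacts (EE d)) (C : ℝ), (L : Set (EE d)) ⊆ X ∧ 0 ≤ C ∧
      ∀ h, Sm h X → ∀ ε : ℝ, 0 < ε → ∃ g, Sm g X ∧ (∀ x ∈ X, PDop P g x = h x) ∧
        ‖jet l K g‖ ≤ C * ‖jet j L h‖ + ε := by
  obtain ⟨L, hLm, hLX, hLK⟩ := exists_exhaustion hX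
  have hp := semiN_mono hX L hLm hLX
  have cp := semiN_complete hX L hLm hLX hLK
  obtain ⟨k0, hk0⟩ := hLK K K.isCompact hK
  obtain ⟨j, C, hC, h⟩ := frechet_open (semiN hX L hLX) (semiN hX L hLX) hp hp cp cp
    ((opA P hX).restrictScalars ℝ) (by
      intro i
      refine ⟨i + P.totalDegree, ∑ α ∈ P.support, ‖P.coeff α‖, fun f => ?_⟩
      rw [semiN_apply, semiN_apply]
      have hle : 0 ≤ (∑ α ∈ P.support, ‖P.coeff α‖) * ‖jet (i + P.totalDegree) (L (i + P.totalDegree)) (f : EE d → ℂ)‖ := by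
        positivity
      rw [norm_jet_le hX (hLX i) (SS_sm _) hle]
      intro w hw x hx
      have hxX := hLX i hx
      have e1 : wd w (((opA P hX).restrictScalars ℝ f : SS X) : EE d → ℂ) x = wd w (PDop P f) x :=
        wd_congr_open hX w (fun y hy => opA_apply P hX f hy) x hxX
      rw [e1, wd_PDop P hX f.2 w x hxX, Finset.sum_mul]
      refine norm_sum_le_of_le _ fun α hα => ?_
      rw [norm_mul]
      gcongr
      refine le_norm_jet hX (hLX _) f.2 _ ?_ (hLm i _ (by omega) hx)
      rw [List.length_append]
      have := length_word_le P hα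
      omega) (by
      intro g
      obtain ⟨f, hf, hfg⟩ := hs g g.2
      refine ⟨⟨f, hf⟩, fun k => ?_⟩
      rw [semiN_apply]
      apply le_antisymm _ (norm_nonneg _)
      rw [norm_jet_le hX (hLX k) (SS_sm _) le_rfl]
      intro w hw x hx
      have e1 : wd w (((opA P hX).restrictScalars ℝ ⟨f, hf⟩ - g : SS X) : EE d → ℂ) x = wd w (fun _ => 0) x := by
        refine wd_congr_open hX w (fun y hy => ?_) x (hLX k hx)
        have e2 := opA_apply P hX ⟨f, hf⟩ hy
        have e3 := hfg y hy
        simp only at e2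
        simp [e2, e3]
      rw [e1, wd_zero]; simp) (max l k0)
  refine ⟨j, L j, C, hLX j, hC, fun g hg ε hε => ?_⟩
  obtain ⟨f, hf1, hf2⟩ := h ⟨g, hg⟩ ε hε
  refine ⟨f, f.2, ?_, ?_⟩
  · intro x hx
    obtain ⟨k, hk⟩ := hLK {x} isCompact_singleton (by simpa using hx)
    have hk' : x ∈ L k := by simpa using hk
    have h1 := hf1 k
    rw [semiN_apply] at h1
    have h2 := le_norm_jet (l := k) hX (hLX k) (SS_sm ((opA P hX).restrictScalars ℝ f - ⟨g, hg⟩ : SS X))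
      [] (by simp) hk'
    rw [h1] at h2
    have h3 := norm_le_zero_iff.1 h2
    have e2 := opA_apply P hX f hx
    simp only [wd_nil, AddSubgroupClass.coe_sub, Pi.sub_apply, sub_eq_zero] at h3
    rw [← e2]; exact h3
  · rw [semiN_apply, semiN_apply] at hf2
    refine le_trans ?_ hf2
    rw [norm_jet_le hX hK f.2 (norm_nonneg _)]
    intro w hw x hx
    exact le_norm_jet hX (hLX _) f.2 w (hw.trans (le_max_left _ _)) (hLm _ _ (le_max_right _ _) (hk0 hx))

lemma factor_functional {M N : Type*} [AddCommGroup M] [Module ℂ M] [NormedAddCommGroup N]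
    [NormedSpace ℂ N] (a : M →ₗ[ℂ] ℂ) (b : M →ₗ[ℂ] N) (C : ℝ) (h : ∀ g, ‖a g‖ ≤ C * ‖b g‖) :
    ∃ S : N →L[ℂ] ℂ, ∀ g, S (b g) = a g := by
  obtain ⟨r, hr⟩ := b.rangeRestrict.exists_rightInverse_of_surjective (LinearMap.range_rangeRestrict b)
  have hr' : ∀ y : LinearMap.range b, b (r y) = y := by
    intro y
    have := LinearMap.congr_fun hr y
    exact congrArg Subtype.val this
  let s : LinearMap.range b →L[ℂ] ℂ := (a.comp r).mkContinuous C (by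
    intro y
    have := h (r y)
    rw [hr'] at this
    exact this)
  obtain ⟨S, hS, _⟩ := exists_extension_norm_eq (LinearMap.range b) s
  refine ⟨S, fun g => ?_⟩
  have h1 := hS ⟨b g, ⟨g, rfl⟩⟩
  simp only at h1
  rw [h1]
  have h2 : a (r ⟨b g, ⟨g, rfl⟩⟩ - g) = 0 := by
    have := h (r ⟨b g, ⟨g, rfl⟩⟩ - g)
    rw [map_sub b, hr'] at this
    simpa using this
  rw [map_sub, sub_eq_zero] at h2
  exact h2

lemma dual_factor {d : ℕ} (P : MvPolynomial (Fin d) ℂ) {X : Set (EE d)} (hX : IsOpen X)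
    (hs : PSurj P X) (l : ℕ) (K : Compacts (EE d)) (hK : (K : Set (EE d)) ⊆ X)
    (T : C(K, VV d l) →L[ℂ] ℂ)
    (hT : ∀ g, Sm g X → (∀ x ∈ X, PDop P g x = 0) → T (jet l K g) = 0) :
    ∃ (j : ℕ) (L : Compacts (EE d)) (S : C(L, VV d j) →L[ℂ] ℂ), (L : Set (EE d)) ⊆ X ∧
      ∀ g, Sm g X → S (jet j L (PDop P g)) = T (jet l K g) := by
  obtain ⟨j, L, C, hL, hC, h⟩ := open_mapping P hX hs l K hK
  have e0 : ∀ g : SS X, jetL hX j L hL (opA P hX g) = jet j L (PDop P g) := fun g =>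
    jet_congr hX hL fun x hx => opA_apply P hX g hx
  obtain ⟨S, hS⟩ := factor_functional (T.toLinearMap.comp (jetL hX l K hK))
    ((jetL hX j L hL).comp (opA P hX)) (‖T‖ * C) (by
      intro g
      simp only [LinearMap.comp_apply, e0]
      have key : ∀ ε : ℝ, 0 < ε → ‖T (jet l K g)‖ ≤ ‖T‖ * (C * ‖jet j L (PDop P g)‖ + ε) := by
        intro ε hε
        obtain ⟨f, hf, hf1, hf2⟩ := h (PDop P g) (PDop_smooth P hX g.2) ε hε
        have h1 : T (jetL hX l K hK (g - ⟨f, hf⟩)) = 0 := by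
          refine hT _ (SS_sm _) fun x hx => ?_
          have := PDop_sub P hX g.2 hf x hx
          rw [hf1 x hx, sub_self] at this
          exact this
        rw [map_sub, map_sub, sub_eq_zero] at h1
        have h2 : T (jet l K g) = T (jet l K f) := h1
        rw [h2]
        exact (T.le_opNorm _).trans (by gcongr)
      have h3 : Tendsto (fun ε : ℝ => ‖T‖ * (C * ‖jet j L (PDop P g)‖ + ε)) (𝓝[>] 0)
          (𝓝 (‖T‖ * (C * ‖jet j L (PDop P g)‖ + 0))) :=
        ((tendsto_const_nhds.add tendsto_id).const_mul _).mono_left nhdsWithin_le_nhds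
      have h4 := ge_of_tendsto h3 (by
        filter_upwards [self_mem_nhdsWithin] with ε hε
        exact key ε hε)
      rw [add_zero, ← mul_assoc] at h4
      exact h4)
  refine ⟨j, L, S, hL, fun g hg => ?_⟩
  have := hS ⟨g, hg⟩
  simp only [LinearMap.comp_apply, e0] at this
  exact this

lemma zero_of_integral {d : ℕ} {f : EE d → ℂ} (hf : Continuous f) {U : Set (EE d)} (hU : IsOpen U)
    (h : ∀ g : EE d → ℂ, ContDiff ℝ (⊤ : ℕ∞) g → HasCompactSupport g → tsupport g ⊆ U →
      ∫ x, f x * g x = 0) : ∀ x ∈ U, f x = 0 := by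
  have h1 : ∀ᵐ x, x ∈ U → f x = 0 := by
    apply hU.ae_eq_zero_of_integral_contDiff_smul_eq_zero (hf.locallyIntegrable.locallyIntegrableOn U)
    intro g hg hc hs
    have h2 := h (fun x => (g x : ℂ)) (Complex.ofRealCLM.contDiff.comp hg)
      (hc.comp_left (g := fun r : ℝ => (r : ℂ)) (by simp)) (by
        refine subset_trans (closure_mono ?_) hs
        intro x hx; simpa using hx)
    rw [← h2]
    congr 1
    funext x
    simp [mul_comm]
  have h2 : f =ᵐ[volume.restrict U] fun _ => 0 := by
    rw [Filter.EventuallyEq, ae_restrict_iff' hU.measurableSet]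
    exact h1
  exact Measure.eqOn_open_of_ae_eq h2 hU hf.continuousOn continuousOn_const

/-- test function -/
structure TF {d : ℕ} (φ : EE d → ℂ) : Prop where
  smooth : ContDiff ℝ (⊤ : ℕ∞) φ
  cpt : HasCompactSupport φ

lemma ibp_local {d : ℕ} (P : MvPolynomial (Fin d) ℂ) {X : Set (EE d)} (hX : IsOpen X)
    {φ g : EE d → ℂ} (hφ : TF φ) (hφX : tsupport φ ⊆ X) (hg : Sm g X) :
    ∫ x, φ x * PDop P g x = ∫ x, Qop P φ x * g x := by
  obtain ⟨χ, hχ, _, hχX, V, hV, hφV, hVX, hχ1⟩ := exists_cutoff hφ.cpt.isCompact hX hφX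
  have h1 : ∀ x, φ x * PDop P g x = φ x * PDop P (fun y => χ y * g y) x := by
    intro x
    by_cases hx : x ∈ tsupport φ
    · have : g =ᶠ[𝓝 x] fun y => χ y * g y := by
        filter_upwards [hV.mem_nhds (hφV hx)] with y hy
        rw [hχ1 y hy, one_mul]
      rw [(PDop_eventuallyEq P this).eq_of_nhds]
    · simp [image_eq_zero_of_notMem_tsupport hx]
  have h2 : ∀ x, Qop P φ x * g x = Qop P φ x * (χ x * g x) := by
    intro x
    by_cases hx : x ∈ tsupport φ
    · rw [hχ1 x (hφV hx), one_mul]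
    · have : x ∉ tsupport (Qop P φ) := fun h => hx (tsupport_Qop_subset P φ h)
      simp [image_eq_zero_of_notMem_tsupport this]
  simp only [h1, h2]
  exact ibp_P P hφ.smooth hφ.cpt (mul_cutoff_contDiff hX hχ hχX hg)

lemma P_convex {d : ℕ} (P : MvPolynomial (Fin d) ℂ) {X : Set (EE d)} (hX : IsOpen X)
    (hs : PSurj P X) {K : Set (EE d)} (hKc : IsCompact K) (hK : K ⊆ X) :
    ∃ L : Set (EE d), IsCompact L ∧ L ⊆ X ∧ ∀ φ : EE d → ℂ, TF φ → tsupport φ ⊆ X →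
      (∀ x, x ∉ K → Qop P φ x = 0) → ∀ x, x ∉ L → φ x = 0 := by
  obtain ⟨j, L, C, hL, hC, h⟩ := open_mapping P hX hs 0 ⟨K, hKc⟩ hK
  refine ⟨L, L.isCompact, hL, fun φ hφ hφX hQ => ?_⟩
  refine zero_of_integral hφ.smooth.continuous L.isCompact.isClosed.isOpen_compl ?_
  intro g hg hgc hgs
  have hj : jet j L g = 0 := by
    ext x w
    rw [jet_apply isOpen_univ (subset_univ _) (contDiffOn_univ.2 hg)]
    rw [wd_eq_zero_of_notMem_tsupport]
    · rfl
    · exact fun hx => hgs hx x.2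
  have hQi : Integrable (fun x => ‖Qop P φ x‖) :=
    ((Qop_contDiff P hφ.smooth).continuous.integrable_of_hasCompactSupport
      (hφ.cpt.of_isClosed_subset (isClosed_tsupport _) (tsupport_Qop_subset P φ))).norm
  have key : ∀ ε : ℝ, 0 < ε → ‖∫ x, φ x * g x‖ ≤ (∫ x, ‖Qop P φ x‖) * ε := by
    intro ε hε
    obtain ⟨f, hf, hf1, hf2⟩ := h g hg.contDiffOn ε hε
    rw [hj, norm_zero, mul_zero, zero_add] at hf2
    have h1 : ∀ x, φ x * g x = φ x * PDop P f x := by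
      intro x
      by_cases hx : x ∈ tsupport φ
      · rw [hf1 x (hφX hx)]
      · simp [image_eq_zero_of_notMem_tsupport hx]
    simp only [h1]
    rw [ibp_local P hX hφ hφX hf, ← integral_mul_const]
    refine norm_integral_le_of_norm_le (hQi.mul_const ε) (Eventually.of_forall fun x => ?_)
    rw [norm_mul]
    by_cases hx : x ∈ K
    · gcongr
      have := le_norm_jet hX (K := ⟨K, hKc⟩) hK hf [] (l := 0) (by simp) (x := x) hx
      exact this.trans hf2
    · simp [hQ x hx]
  have h3 : Tendsto (fun ε : ℝ => (∫ x, ‖Qop P φ x‖) * ε) (𝓝[>] 0)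
      (𝓝 ((∫ x, ‖Qop P φ x‖) * 0)) :=
    (tendsto_id.const_mul _).mono_left nhdsWithin_le_nhds
  have h4 := ge_of_tendsto h3 (by
    filter_upwards [self_mem_nhdsWithin] with ε hε
    exact key ε hε)
  rw [mul_zero] at h4
  exact norm_le_zero_iff.1 h4

end

open scoped BigOperators
noncomputable section

open Set Filter Topology MeasureTheory Metric TopologicalSpace

/-- `(D+1)(D+2)...(D+n)` as a real number. -/
def asc (D n : ℕ) : ℝ := ((D + 1).ascFactorial n : ℕ)

lemma asc_pos (D n : ℕ) : 0 < asc D n := by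
  unfold asc; exact_mod_cast Nat.ascFactorial_pos _ _

lemma asc_zero_left (n : ℕ) : asc 0 n = n.factorial := by
  unfold asc; rw [Nat.zero_add, Nat.one_ascFactorial]

lemma asc_zero_right (n : ℕ) : asc n 0 = 1 := by simp [asc]

lemma asc_succ' (D n : ℕ) : asc D (n + 1) = (D + 1) * asc (D + 1) n := by
  unfold asc
  have := Nat.succ_ascFactorial (D+1) n
  rw [Nat.ascFactorial_succ, ← this]
  push_cast; rfl

lemma asc_mono {D D' : ℕ} (h : D ≤ D') (n : ℕ) : asc D n ≤ asc D' n := by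
  unfold asc; exact_mod_cast Nat.ascFactorial_le n (by omega)

lemma asc_choose (D i j : ℕ) : ((i + j).choose i : ℝ) * j.factorial * asc D i ≤ asc D (i + j) := by
  unfold asc
  rw [← Nat.ascFactorial_mul_ascFactorial]
  have h1 : (i+j).choose i * j.factorial = (i+1).ascFactorial j := by
    rw [← Nat.add_descFactorial_eq_ascFactorial, Nat.descFactorial_eq_factorial_mul_choose,
      Nat.choose_symm_add, mul_comm]
  have h2 := Nat.ascFactorial_le j (show i + 1 ≤ D + 1 + i by omega)
  rw [← h1] at h2
  have := Nat.mul_le_mul_right ((D+1).ascFactorial i) h2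
  rw [mul_comm ((D+1+i).ascFactorial j)] at this
  exact_mod_cast this

variable {d : ℕ}

/-- truncated product estimate. -/
lemma prod_bound {F : Type*} [NormedAddCommGroup F] [NormedSpace ℝ F] [NormedSpace ℂ F]
    {f : EE d → ℂ} {g : EE d → F} (hf : ContDiff ℝ (⊤ : ℕ∞) f) (hg : ContDiff ℝ (⊤ : ℕ∞) g)
    {x : EE d} {n D : ℕ} {A G R : ℝ} (hA : 0 ≤ A) (hG : 0 ≤ G) (hR : 0 ≤ R)
    (h1 : ∀ i ≤ n, ‖iteratedFDeriv ℝ i f x‖ ≤ A * R ^ i * asc D i)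
    (h2 : ∀ i ≤ n, ‖iteratedFDeriv ℝ i g x‖ ≤ G * (R / 2) ^ i * i.factorial) :
    ‖iteratedFDeriv ℝ n (fun y => f y • g y) x‖ ≤ 2 * A * G * R ^ n * asc D n := by
  have h3 := norm_iteratedFDeriv_smul_le (𝕜 := ℝ) (n := n) hf hg x (by exact_mod_cast le_top)
  refine h3.trans ?_
  have h4 : ∀ i ∈ Finset.range (n + 1), (n.choose i : ℝ) * ‖iteratedFDeriv ℝ i f x‖ *
      ‖iteratedFDeriv ℝ (n - i) g x‖ ≤ (A * G * R ^ n * asc D n) * (1/2) ^ (n - i) := by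
    intro i hi
    have hi' : i ≤ n := by simpa [Nat.lt_succ_iff] using hi
    obtain ⟨j, rfl⟩ := Nat.exists_eq_add_of_le hi'
    rw [Nat.add_sub_cancel_left]
    have a1 := h1 i hi'
    have a2 := h2 j (by omega)
    calc ((i+j).choose i : ℝ) * ‖iteratedFDeriv ℝ i f x‖ * ‖iteratedFDeriv ℝ j g x‖
        ≤ ((i+j).choose i : ℝ) * (A * R ^ i * asc D i) * (G * (R / 2) ^ j * j.factorial) := by
          have := asc_pos D i
          gcongr
      _ = (A * G * R ^ (i+j)) * (((i + j).choose i : ℝ) * j.factorial * asc D i) * (1/2)^j := by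
          rw [div_pow, pow_add, one_div, inv_pow]; ring
      _ ≤ (A * G * R ^ (i+j)) * asc D (i+j) * (1/2)^j := by
          have := asc_choose D i j
          gcongr
  refine (Finset.sum_le_sum h4).trans ?_
  rw [← Finset.mul_sum]
  have h5 : ∑ i ∈ Finset.range (n + 1), ((1:ℝ)/2) ^ (n - i) ≤ 2 := by
    have := Finset.sum_range_reflect (fun k => ((1:ℝ)/2)^k) (n+1)
    simp only [Nat.add_sub_cancel] at this
    rw [this]
    exact sum_geometric_two_le _
  have := asc_pos D n
  calc _ ≤ (A * G * R ^ n * asc D n) * 2 := by gcongr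
    _ = _ := by ring

/-- Analytic bounds on a set `K`. -/
def Bd (K : Set (EE d)) (R : ℝ) (D : ℕ) (A : ℝ) (q : EE d → ℂ) : Prop :=
  ContDiff ℝ (⊤ : ℕ∞) q ∧ ∀ n, ∀ x ∈ K, ‖iteratedFDeriv ℝ n q x‖ ≤ A * R ^ n * asc D n

lemma Bd.mono {K : Set (EE d)} {R A A' : ℝ} {D D' : ℕ} {q : EE d → ℂ} (h : Bd K R D A q)
    (hR : 0 ≤ R) (hA : 0 ≤ A) (hA' : A ≤ A') (hD : D ≤ D') : Bd K R D' A' q := by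
  refine ⟨h.1, fun n x hx => (h.2 n x hx).trans ?_⟩
  have := asc_pos D n
  have := asc_mono hD n
  have : 0 ≤ A' := hA.trans hA'
  gcongr

lemma Bd.mulR {K : Set (EE d)} {R A G : ℝ} {D : ℕ} {q g : EE d → ℂ} (h : Bd K R D A q)
    (hg : Bd K (R / 2) 0 G g) (hA : 0 ≤ A) (hG : 0 ≤ G) (hR : 0 ≤ R) :
    Bd K R D (2 * G * A) (fun x => g x * q x) := by
  refine ⟨hg.1.mul h.1, fun n x hx => ?_⟩
  have := prod_bound (f := q) (g := g) h.1 hg.1 (x := x) (n := n) hA hG hR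
    (fun i _ => h.2 i x hx) (fun i _ => by rw [← asc_zero_left]; exact hg.2 i x hx)
  have e : (fun y => q y • g y) = fun y => g y * q y := by ext y; rw [smul_eq_mul, mul_comm]
  rw [e] at this
  refine this.trans (le_of_eq (by ring))

lemma Bd.add {K : Set (EE d)} {R A A' : ℝ} {D : ℕ} {q g : EE d → ℂ} (h : Bd K R D A q)
    (hg : Bd K R D A' g) : Bd K R D (A + A') (fun x => q x + g x) := by
  refine ⟨h.1.add hg.1, fun n x hx => ?_⟩
  have e : iteratedFDeriv ℝ n (fun y => q y + g y) x =
      iteratedFDeriv ℝ n q x + iteratedFDeriv ℝ n g x := by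
    apply iteratedFDeriv_add_apply
    · exact (h.1.of_le (by exact_mod_cast le_top)).contDiffAt
    · exact (hg.1.of_le (by exact_mod_cast le_top)).contDiffAt
  rw [e]
  refine (norm_add_le _ _).trans ?_
  have a := h.2 n x hx
  have b := hg.2 n x hx
  calc _ ≤ _ := add_le_add a b
    _ = _ := by ring

lemma norm_iteratedFDeriv_pderivE {f : EE d → ℂ} (hf : ContDiff ℝ (⊤ : ℕ∞) f) (i : Fin d) (n : ℕ)
    (x : EE d) : ‖iteratedFDeriv ℝ n (pderivE i f) x‖ ≤ ‖iteratedFDeriv ℝ (n+1) f x‖ := by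
  have h1 : ContDiff ℝ (⊤ : ℕ∞) (fderiv ℝ f) := hf.fderiv_right (by exact le_of_eq rfl)
  have := norm_iteratedFDeriv_clm_apply_const (𝕜 := ℝ) (f := fderiv ℝ f)
    (c := EuclideanSpace.single i (1:ℝ)) (x := x) (n := n) h1.contDiffAt (by exact_mod_cast le_top)
  rw [norm_iteratedFDeriv_fderiv, EuclideanSpace.norm_single, norm_one, one_mul] at this
  exact this

lemma Bd.pderiv {K : Set (EE d)} {R A : ℝ} {D : ℕ} {q : EE d → ℂ} (h : Bd K R D A q) (i : Fin d) :
    Bd K R (D + 1) (A * R * (D + 1)) (pderivE i q) := by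
  refine ⟨contDiffOn_univ.1 (pderivE_smooth isOpen_univ i h.1.contDiffOn), fun n x hx => ?_⟩
  refine (norm_iteratedFDeriv_pderivE h.1 i n x).trans ((h.2 _ x hx).trans (le_of_eq ?_))
  rw [asc_succ', pow_succ]; ring

/-- analytic bounds with some constants -/
def AnB (K : Set (EE d)) (g : EE d → ℂ) : Prop :=
  ∃ r G : ℝ, 0 < r ∧ 0 < G ∧ Bd K r 0 G g

lemma Bd.monoR {K : Set (EE d)} {R R' A : ℝ} {D : ℕ} {q : EE d → ℂ} (h : Bd K R D A q)
    (hR : 0 ≤ R) (hA : 0 ≤ A) (hR' : R ≤ R') : Bd K R' D A q := by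
  refine ⟨h.1, fun n x hx => (h.2 n x hx).trans ?_⟩
  have := asc_pos D n
  gcongr

lemma AnB.add {K : Set (EE d)} {f g : EE d → ℂ} (hf : AnB K f) (hg : AnB K g) :
    AnB K (fun x => f x + g x) := by
  obtain ⟨r, G, hr, hG, h⟩ := hf
  obtain ⟨r', G', hr', hG', h'⟩ := hg
  exact ⟨r + r', G + G', by positivity, by positivity,
    (h.monoR hr.le hG.le (by linarith)).add (h'.monoR hr'.le hG'.le (by linarith))⟩

lemma AnB.mul {K : Set (EE d)} {f g : EE d → ℂ} (hf : AnB K f) (hg : AnB K g) :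
    AnB K (fun x => f x * g x) := by
  obtain ⟨r, G, hr, hG, h⟩ := hf
  obtain ⟨r', G', hr', hG', h'⟩ := hg
  refine ⟨2 * (r + r'), 2 * G * G', by positivity, by positivity, ?_⟩
  refine (h'.monoR hr'.le hG'.le (by linarith)).mulR (g := f) (A := G') ?_ hG'.le hG.le (by positivity)
  refine h.monoR hr.le hG.le (by linarith)

lemma AnB.const (K : Set (EE d)) (c : ℂ) : AnB K (fun _ => c) := by
  refine ⟨1, ‖c‖ + 1, one_pos, by positivity, contDiff_const, fun n x _ => ?_⟩
  rcases Nat.eq_zero_or_pos n with rfl | hn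
  · simp [asc_zero_right]
  · rw [iteratedFDeriv_const_of_ne (by omega)]
    have := asc_pos 0 n
    simp; positivity

lemma AnB.sum {ι : Type*} (s : Finset ι) {K : Set (EE d)} {f : ι → EE d → ℂ}
    (hf : ∀ i ∈ s, AnB K (f i)) : AnB K (fun x => ∑ i ∈ s, f i x) := by
  classical
  induction s using Finset.induction_on with
  | empty => simpa using AnB.const K 0
  | insert a s ha ih =>
    simp only [Finset.sum_insert ha]
    exact (hf a (by simp)).add (ih fun i hi => hf i (by simp [hi]))

lemma AnB.prod {ι : Type*} (s : Finset ι) {K : Set (EE d)} {f : ι → EE d → ℂ}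
    (hf : ∀ i ∈ s, AnB K (f i)) : AnB K (fun x => ∏ i ∈ s, f i x) := by
  classical
  induction s using Finset.induction_on with
  | empty => simpa using AnB.const K 1
  | insert a s ha ih =>
    simp only [Finset.prod_insert ha]
    exact (hf a (by simp)).mul (ih fun i hi => hf i (by simp [hi]))

lemma AnB.pow {K : Set (EE d)} {f : EE d → ℂ} (hf : AnB K f) (n : ℕ) : AnB K (fun x => f x ^ n) := by
  simpa using AnB.prod (Finset.range n) (f := fun _ => f) (fun _ _ => hf)

/-- Inverse of a nonvanishing function with analytic bounds. -/
lemma AnB.inv {K : Set (EE d)} (hK : IsCompact K) {b : EE d → ℂ} (hb : AnB K b) (h0 : ∀ x, b x ≠ 0) :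
    AnB K (fun x => (b x)⁻¹) := by
  obtain ⟨r, G, hr, hG, h⟩ := hb
  have hsm : ContDiff ℝ (⊤ : ℕ∞) (fun x => (b x)⁻¹) := h.1.inv h0
  obtain ⟨F0, hF0⟩ := hK.exists_bound_of_continuousOn hsm.continuous.continuousOn
  set F := |F0| + 1 with hF
  have hFpos : 0 < F := by positivity
  have hFb : ∀ x ∈ K, ‖(b x)⁻¹‖ ≤ F := fun x hx => (hF0 x hx).trans ((le_abs_self _).trans (by linarith))
  set R := 4 * r + 4 * F * G * r with hR
  have hRpos : 0 < R := by positivity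
  refine ⟨R, F, hRpos, hFpos, hsm, ?_⟩
  intro n x hx
  induction n using Nat.strong_induction_on with
  | _ n ih =>
    rcases n with _ | n
    · simpa [asc_zero_right] using hFb x hx
    have hfd : fderiv ℝ (fun x => (b x)⁻¹) = fun y => (-((b y)⁻¹ * (b y)⁻¹)) • fderiv ℝ b y := by
      ext y v
      have h1 : HasFDerivAt b (fderiv ℝ b y) y := ((h.1.differentiable (by simp)) y).hasFDerivAt
      have h2 := (hasDerivAt_inv (h0 y)).comp_hasFDerivAt (𝕜 := ℝ) y h1
      have h3 : fderiv ℝ (fun x => (b x)⁻¹) y = _ := h2.fderiv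
      rw [h3]
      simp [pow_two]
    rw [← norm_iteratedFDeriv_fderiv, hfd]
    have hff : ∀ i ≤ n, ‖iteratedFDeriv ℝ i (fun y => -((b y)⁻¹ * (b y)⁻¹)) x‖ ≤ (F * F) * R ^ i * asc 1 i := by
      intro i hi
      have e : (fun y => -((b y)⁻¹ * (b y)⁻¹)) = -(fun y => ((b y)⁻¹ * (b y)⁻¹)) := rfl
      rw [e, iteratedFDeriv_neg_apply, norm_neg]
      refine (norm_iteratedFDeriv_mul_le (N := ((⊤ : ℕ∞) : WithTop ℕ∞)) hsm hsm x (by exact_mod_cast le_top)).trans ?_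
      have h4 : ∀ j ∈ Finset.range (i + 1), (i.choose j : ℝ) *
          ‖iteratedFDeriv ℝ j (fun y => (b y)⁻¹) x‖ *
          ‖iteratedFDeriv ℝ (i - j) (fun y => (b y)⁻¹) x‖ ≤ F * F * R ^ i * i.factorial := by
        intro j hj
        have hj' : j ≤ i := by simpa [Nat.lt_succ_iff] using hj
        have a1 := ih j (by omega)
        have a2 := ih (i - j) (by omega)
        rw [asc_zero_left] at a1 a2
        calc _ ≤ (i.choose j : ℝ) * (F * R ^ j * j.factorial) * (F * R ^ (i-j) * (i-j).factorial) := by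
              gcongr
          _ = F * F * (R ^ j * R ^ (i-j)) * ((i.choose j * j.factorial * (i-j).factorial : ℕ) : ℝ) := by
              push_cast; ring
          _ = _ := by
              rw [← pow_add, Nat.add_sub_cancel' hj', Nat.choose_mul_factorial_mul_factorial hj']
      refine (Finset.sum_le_sum h4).trans (le_of_eq ?_)
      have : asc 0 (i+1) = asc 1 i := by rw [asc_succ']; simp
      rw [← this, asc_zero_left, Nat.factorial_succ]
      simp; ring
    have hfb : ∀ i ≤ n, ‖iteratedFDeriv ℝ i (fderiv ℝ b) x‖ ≤ (G * r) * (R / 2) ^ i * i.factorial := by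
      intro i _
      rw [norm_iteratedFDeriv_fderiv]
      refine (h.2 (i+1) x hx).trans ?_
      rw [asc_zero_left, Nat.factorial_succ]
      have h5 : ((i+1 : ℕ) : ℝ) ≤ 2 ^ i := by exact_mod_cast Nat.lt_two_pow_self
      have h6 : 2 * r ≤ R / 2 := by rw [hR]; nlinarith [mul_pos (mul_pos hFpos hG) hr]
      calc G * r ^ (i+1) * (((i + 1) * i.factorial : ℕ) : ℝ)
          = G * r * r ^ i * ((i+1 : ℕ) : ℝ) * i.factorial := by push_cast; ring
        _ ≤ G * r * r ^ i * 2 ^ i * i.factorial := by gcongr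
        _ = G * r * (2 * r) ^ i * i.factorial := by rw [mul_pow]; ring
        _ ≤ _ := by gcongr
    have hfin := prod_bound (f := fun y => -((b y)⁻¹ * (b y)⁻¹)) (g := fderiv ℝ b) (hsm.mul hsm).neg
      (h.1.fderiv_right (by exact le_of_eq rfl)) (x := x) (n := n) (by positivity : 0 ≤ F * F)
      (by positivity : 0 ≤ G * r) hRpos.le hff hfb
    refine hfin.trans ?_
    have : asc 0 (n+1) = asc 1 n := by rw [asc_succ']; simp
    rw [this]
    have h7 : 2 * (F * F) * (G * r) ≤ F * R := by
      rw [hR]; nlinarith [mul_pos hFpos hr, mul_pos (mul_pos hFpos hFpos) (mul_pos hG hr)]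
    have := asc_pos 1 n
    calc _ ≤ F * R * R ^ n * asc 1 n := by gcongr
      _ = _ := by ring

end

open scoped BigOperators
noncomputable section

open Set Filter Topology MeasureTheory Metric TopologicalSpace

variable {d : ℕ}

/-- Leibniz coefficients of the derivative of `θ(t) q`. -/
def LL (τ : Fin d → EE d → ℂ) : List (Fin d) → ℕ → (EE d → ℂ) → EE d → ℂ
  | [], 0, q => q
  | [], _ + 1, _ => fun _ => 0
  | i :: w, 0, q => pderivE i (LL τ w 0 q)
  | i :: w, k + 1, q => fun x => pderivE i (LL τ w (k + 1) q) x + τ i x * LL τ w k q x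

lemma pderivE_contDiff {f : EE d → ℂ} (i : Fin d) (hf : ContDiff ℝ (⊤ : ℕ∞) f) :
    ContDiff ℝ (⊤ : ℕ∞) (pderivE i f) :=
  contDiffOn_univ.1 (pderivE_smooth isOpen_univ i hf.contDiffOn)

lemma LL_contDiff {τ : Fin d → EE d → ℂ} (hτ : ∀ i, ContDiff ℝ (⊤ : ℕ∞) (τ i)) {q : EE d → ℂ}
    (hq : ContDiff ℝ (⊤ : ℕ∞) q) (w : List (Fin d)) (k : ℕ) : ContDiff ℝ (⊤ : ℕ∞) (LL τ w k q) := by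
  induction w generalizing k with
  | nil => cases k with
    | zero => exact hq
    | succ k => exact contDiff_const
  | cons i w ih => cases k with
    | zero => exact pderivE_contDiff i (ih 0)
    | succ k => exact (pderivE_contDiff i (ih _)).add ((hτ i).mul (ih k))

lemma LL_zero_of_lt (τ : Fin d → EE d → ℂ) (q : EE d → ℂ) (w : List (Fin d)) (k : ℕ)
    (h : w.length < k) : LL τ w k q = fun _ => 0 := by
  induction w generalizing k with
  | nil => cases k with
    | zero => simp at h
    | succ k => rfl
  | cons i w ih => cases k with
    | zero => simp at h
    | succ k =>
      simp only [List.length_cons] at h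
      simp only [LL, ih (k+1) (by omega), ih k (by omega)]
      ext x; simp [pderivE]

lemma LL_top (τ : Fin d → EE d → ℂ) (q : EE d → ℂ) (w : List (Fin d)) (x : EE d) :
    LL τ w w.length q x = (w.map fun i => τ i x).prod * q x := by
  induction w with
  | nil => simp [LL]
  | cons i w ih =>
    simp only [List.length_cons, LL, LL_zero_of_lt τ q w (w.length + 1) (by omega), ih]
    simp [pderivE, mul_assoc]

lemma LL_bound {K : Set (EE d)} {τ : Fin d → EE d → ℂ} {R G : ℝ} (hR : 0 ≤ R) (hG : 0 ≤ G)
    (hτ : ∀ i, Bd K (R / 2) 0 G (τ i)) {q : EE d → ℂ} {D N : ℕ} {A : ℝ} (hA : 0 ≤ A)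
    (hq : Bd K R D A q) (w : List (Fin d)) (k : ℕ) (hk : k ≤ w.length) (hN : D + w.length ≤ N) :
    Bd K R (D + (w.length - k)) (A * (R + 2 * G) ^ w.length * (N : ℝ) ^ (w.length - k)) (LL τ w k q) := by
  induction w generalizing k with
  | nil =>
    simp only [List.length_nil, Nat.le_zero] at hk
    subst hk
    simpa [LL] using hq
  | cons i w ih =>
    simp only [List.length_cons] at hk hN ⊢
    have hder : ∀ k ≤ w.length, Bd K R (D + (w.length + 1 - k))
        (A * (R + 2 * G) ^ w.length * (N : ℝ) ^ (w.length + 1 - k) * R) (pderivE i (LL τ w k q)) := by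
      intro k hk
      have h1 := (ih k hk (by omega)).pderiv i
      have e : w.length + 1 - k = w.length - k + 1 := by omega
      rw [e]
      refine h1.mono hR (by positivity) ?_ (by omega)
      have h2 : ((D + (w.length - k) : ℕ) : ℝ) + 1 ≤ N := by exact_mod_cast (by omega)
      rw [pow_succ]
      calc _ ≤ A * (R + 2 * G) ^ w.length * (N : ℝ) ^ (w.length - k) * R * N := by gcongr
        _ = _ := by ring
    have hGR : 0 ≤ R + 2 * G := by positivity
    cases k with
    | zero =>
      simp only [LL]
      refine (hder 0 (by omega)).mono hR (by positivity) ?_ le_rfl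
      rw [pow_succ]
      have : 0 ≤ A * (R + 2 * G) ^ w.length * (N : ℝ) ^ (w.length + 1 - 0) * (2 * G) := by positivity
      nlinarith
    | succ k =>
      have h3 := (ih k (by omega) (by omega)).mulR (hτ i) (by positivity) hG hR
      have e : w.length + 1 - (k + 1) = w.length - k := by omega
      rw [e]
      by_cases hk' : k + 1 ≤ w.length
      · have h4 := (hder (k+1) hk')
        rw [e] at h4
        have h5 := h4.add h3
        simp only [LL]
        refine h5.mono hR (by positivity) (le_of_eq ?_) le_rfl
        rw [pow_succ]; ring
      · simp only [LL, LL_zero_of_lt τ q w (k + 1) (by omega)]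
        have : (fun x => pderivE i (fun _ : EE d => (0:ℂ)) x + τ i x * LL τ w k q x) =
          fun x => τ i x * LL τ w k q x := by ext x; simp [pderivE]
        rw [this]
        refine h3.mono hR (by positivity) ?_ le_rfl
        rw [pow_succ]
        have : 0 ≤ A * (R + 2 * G) ^ w.length * (N : ℝ) ^ (w.length - k) * R := by positivity
        nlinarith

/-- Iterated antiderivatives vanishing at `T`. -/
def JJ (T : ℝ) (ψ : ℝ → ℂ) : ℕ → ℝ → ℂ
  | 0 => ψ
  | k + 1 => fun s => ∫ u in T..s, JJ T ψ k u

lemma JJ_cont {T : ℝ} {ψ : ℝ → ℂ} (hψ : Continuous ψ) (k : ℕ) : Continuous (JJ T ψ k) := by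
  induction k with
  | zero => exact hψ
  | succ k ih => exact intervalIntegral.continuous_primitive (fun a b => ih.intervalIntegrable a b) T

lemma JJ_deriv {T : ℝ} {ψ : ℝ → ℂ} (hψ : Continuous ψ) (k : ℕ) (s : ℝ) :
    HasDerivAt (JJ T ψ (k+1)) (JJ T ψ k s) s :=
  intervalIntegral.integral_hasDerivAt_right ((JJ_cont hψ k).intervalIntegrable _ _)
    (JJ_cont hψ k).stronglyMeasurable.stronglyMeasurableAtFilter (JJ_cont hψ k).continuousAt

lemma JJ_contDiff {T : ℝ} {ψ : ℝ → ℂ} (hψ : ContDiff ℝ (⊤ : ℕ∞) ψ) (k : ℕ) :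
    ContDiff ℝ (⊤ : ℕ∞) (JJ T ψ k) := by
  induction k with
  | zero => exact hψ
  | succ k ih =>
    rw [contDiff_infty_iff_deriv]
    refine ⟨fun s => (JJ_deriv hψ.continuous k s).differentiableAt, ?_⟩
    have : deriv (JJ T ψ (k+1)) = JJ T ψ k := by
      ext s; exact (JJ_deriv hψ.continuous k s).deriv
    rw [this]; exact ih

lemma JJ_zero {T : ℝ} {ψ : ℝ → ℂ} (h0 : ∀ s, T ≤ s → ψ s = 0) (k : ℕ) (s : ℝ) (hs : T ≤ s) :
    JJ T ψ k s = 0 := by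
  induction k generalizing s with
  | zero => exact h0 s hs
  | succ k ih =>
    simp only [JJ]
    rw [intervalIntegral.integral_congr (g := fun _ => 0)]
    · simp
    · intro u hu
      rw [uIcc_of_le hs] at hu
      exact ih u hu.1

lemma JJ_bound {T μ B : ℝ} (hμ : 0 < μ) (hB : 0 ≤ B) {ψ : ℝ → ℂ} (hψ : Continuous ψ)
    (h0 : ∀ s, T ≤ s → ψ s = 0)
    (hb : ∀ s, 0 ≤ s → ‖ψ s‖ ≤ B * Real.exp (-μ * s)) (k : ℕ) (s : ℝ) (hs : 0 ≤ s) :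
    ‖JJ T ψ k s‖ ≤ B / μ ^ k * Real.exp (-μ * s) := by
  induction k generalizing s with
  | zero => simpa [JJ] using hb s hs
  | succ k ih =>
    rcases le_or_gt T s with h | h
    · rw [JJ_zero h0 _ s h, norm_zero]; positivity
    simp only [JJ]
    rw [intervalIntegral.integral_symm, norm_neg]
    have hder : ∀ u ∈ uIcc s T, HasDerivAt (fun u => -(B / μ ^ (k+1)) * Real.exp (-μ * u))
        (B / μ ^ k * Real.exp (-μ * u)) u := by
      intro u _
      have h1 : HasDerivAt (fun u : ℝ => -μ * u) (-μ) u := by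
        simpa using (hasDerivAt_id u).const_mul (-μ)
      have h2 := (h1.exp).const_mul (-(B / μ ^ (k+1)))
      refine h2.congr_deriv ?_
      field_simp
      ring
    have hi := intervalIntegral.integral_eq_sub_of_hasDerivAt hder
      (Continuous.intervalIntegrable (by fun_prop) _ _)
    have h3 : ‖∫ u in s..T, JJ T ψ k u‖ ≤ ∫ u in s..T, B / μ ^ k * Real.exp (-μ * u) := by
      apply intervalIntegral.norm_integral_le_of_norm_le h.le
      · filter_upwards with u hu
        exact ih u (hs.trans hu.1.le)
      · exact Continuous.intervalIntegrable (by fun_prop) _ _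
    refine h3.trans ?_
    rw [hi]
    have : 0 ≤ B / μ ^ (k+1) * Real.exp (-μ * T) := by positivity
    linarith

lemma wd_JJ {T : ℝ} {ψ : ℝ → ℂ} (hψ : ContDiff ℝ (⊤ : ℕ∞) ψ) {t : EE d → ℝ} {τ : Fin d → EE d → ℂ}
    (ht : ContDiff ℝ (⊤ : ℕ∞) t) (htτ : ∀ i x, ((fderiv ℝ t x (EuclideanSpace.single i 1) : ℝ) : ℂ) = τ i x)
    (hτ : ∀ i, ContDiff ℝ (⊤ : ℕ∞) (τ i)) {q : EE d → ℂ} (hq : ContDiff ℝ (⊤ : ℕ∞) q) (m : ℕ)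
    (w : List (Fin d)) (hw : w.length ≤ m) :
    wd w (fun x => JJ T ψ m (t x) * q x) =
      fun x => ∑ k ∈ Finset.range (w.length + 1), JJ T ψ (m - k) (t x) * LL τ w k q x := by
  induction w with
  | nil => ext x; simp [LL]
  | cons i w ih =>
    simp only [List.length_cons] at hw ⊢
    rw [wd_cons, ih (by omega)]
    ext x
    have hd : ∀ k ∈ Finset.range (w.length + 1), HasFDerivAt
        (fun x => JJ T ψ (m - k) (t x) * LL τ w k q x)
        (JJ T ψ (m-k) (t x) • fderiv ℝ (LL τ w k q) x +
          LL τ w k q x • (fderiv ℝ t x).smulRight (JJ T ψ (m - (k+1)) (t x))) x := by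
      intro k hk
      have hk' : k ≤ w.length := by simpa [Nat.lt_succ_iff] using hk
      have h1 : HasFDerivAt t (fderiv ℝ t x) x := (ht.differentiable (by simp) x).hasFDerivAt
      have h2 := JJ_deriv (T := T) hψ.continuous (m - (k+1)) (t x)
      rw [show m - (k+1) + 1 = m - k by omega] at h2
      have h3 := h2.hasFDerivAt.comp x h1
      have h4 : HasFDerivAt (LL τ w k q) (fderiv ℝ (LL τ w k q) x) x :=
        ((LL_contDiff hτ hq w k).differentiable (by simp) x).hasFDerivAt
      refine (h3.mul h4).congr_fderiv ?_
      ext v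
      simp
    have hs := HasFDerivAt.fun_sum hd
    unfold pderivE
    rw [hs.fderiv]
    simp only [_root_.sum_apply, _root_.add_apply, _root_.smul_apply,
      ContinuousLinearMap.smulRight_apply, smul_eq_mul, Finset.sum_add_distrib, Complex.real_smul, htτ]
    rw [Finset.sum_range_succ' _ (w.length + 1)]
    simp only [LL, mul_add, Finset.sum_add_distrib]
    have e1 : ∑ k ∈ Finset.range (w.length + 1), JJ T ψ (m - (k+1)) (t x) * pderivE i (LL τ w (k+1) q) x
        + JJ T ψ (m - 0) (t x) * pderivE i (LL τ w 0 q) x =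
        ∑ k ∈ Finset.range (w.length + 1), JJ T ψ (m-k) (t x) * pderivE i (LL τ w k q) x := by
      rw [← Finset.sum_range_succ' (fun k => JJ T ψ (m-k) (t x) * pderivE i (LL τ w k q) x)]
      rw [Finset.sum_range_succ _ (w.length + 1), LL_zero_of_lt τ q w (w.length + 1) (by omega)]
      simp [pderivE]
    rw [add_right_comm, e1]
    congr 1
    exact Finset.sum_congr rfl fun k _ => by ring

end

open scoped BigOperators
noncomputable section

open Set Filter Topology MeasureTheory Metric TopologicalSpace

variable {d : ℕ}

/-- value of the principal symbol at the gradient field `τ` -/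
def bsym (P : MvPolynomial (Fin d) ℂ) (τ : Fin d → EE d → ℂ) (x : EE d) : ℂ :=
  MvPolynomial.eval (fun i => τ i x) (MvPolynomial.homogeneousComponent P.totalDegree P)

lemma bsym_eq (P : MvPolynomial (Fin d) ℂ) (τ : Fin d → EE d → ℂ) (x : EE d) :
    bsym P τ x = ∑ α ∈ P.support, if (word fun i => α i).length = P.totalDegree then
      P.coeff α * ∏ i, τ i x ^ α i else 0 := by
  unfold bsym
  rw [MvPolynomial.homogeneousComponent_apply, map_sum, Finset.sum_filter]
  refine Finset.sum_congr rfl fun α _ => ?_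
  rw [length_word, Finsupp.degree_eq_sum, MvPolynomial.eval_monomial]
  congr 1
  rw [Finsupp.prod_fintype _ _ (by simp)]

lemma bsym_AnB (P : MvPolynomial (Fin d) ℂ) {K : Set (EE d)} {τ : Fin d → EE d → ℂ}
    (h : ∀ i, AnB K (τ i)) : AnB K (bsym P τ) := by
  have : bsym P τ = fun x => ∑ α ∈ P.support, if (word fun i => α i).length = P.totalDegree then
      P.coeff α * ∏ i, τ i x ^ α i else 0 := by ext x; exact bsym_eq P τ x
  rw [this]
  refine AnB.sum _ fun α _ => ?_
  split_ifs
  · exact (AnB.const K _).mul (AnB.prod _ fun i _ => (h i).pow _)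
  · exact AnB.const K 0

lemma PDop_JJ (P : MvPolynomial (Fin d) ℂ) {T : ℝ} {ψ : ℝ → ℂ} (hψ : ContDiff ℝ (⊤ : ℕ∞) ψ)
    {t : EE d → ℝ} {τ : Fin d → EE d → ℂ}
    (ht : ContDiff ℝ (⊤ : ℕ∞) t) (htτ : ∀ i x, ((fderiv ℝ t x (EuclideanSpace.single i 1) : ℝ) : ℂ) = τ i x)
    (hτ : ∀ i, ContDiff ℝ (⊤ : ℕ∞) (τ i)) {q : EE d → ℂ} (hq : ContDiff ℝ (⊤ : ℕ∞) q) (x : EE d) :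
    PDop P (fun x => JJ T ψ P.totalDegree (t x) * q x) x =
      (∑ α ∈ P.support, ∑ k ∈ Finset.range P.totalDegree,
        P.coeff α * (JJ T ψ (P.totalDegree - k) (t x) * LL τ (word fun i => α i) k q x)) +
      ψ (t x) * bsym P τ x * q x := by
  rw [PDop_eq, bsym_eq, Finset.mul_sum, Finset.sum_mul, ← Finset.sum_add_distrib]
  refine Finset.sum_congr rfl fun α hα => ?_
  have hl := length_word_le P hα
  rw [wd_JJ hψ ht htτ hτ hq _ _ hl]
  have e1 : ∑ k ∈ Finset.range ((word fun i => α i).length + 1),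
      JJ T ψ (P.totalDegree - k) (t x) * LL τ (word fun i => α i) k q x =
      ∑ k ∈ Finset.range (P.totalDegree + 1),
      JJ T ψ (P.totalDegree - k) (t x) * LL τ (word fun i => α i) k q x := by
    apply Finset.sum_subset
    · intro k; simp only [Finset.mem_range]; omega
    · intro k _ hk
      simp only [Finset.mem_range] at hk
      rw [LL_zero_of_lt _ _ _ _ (by omega)]; simp
  simp only []
  rw [e1, Finset.sum_range_succ, mul_add, Finset.mul_sum]
  congr 1
  rw [Nat.sub_self]
  split_ifs with h
  · have := LL_top τ q (word fun i => α i) x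
    rw [h, prod_word] at this
    rw [this]; simp only [JJ]; ring
  · rw [LL_zero_of_lt _ _ _ _ (by omega)]; simp

lemma integrable_TF_mul {w g : EE d → ℂ} (hw : TF w) (hg : Continuous g) :
    Integrable (fun x => w x * g x) :=
  (hw.smooth.continuous.mul hg).integrable_of_hasCompactSupport hw.cpt.mul_right

lemma sweep_identity (P : MvPolynomial (Fin d) ℂ) {T : ℝ} {ψ : ℝ → ℂ} (hψ : ContDiff ℝ (⊤ : ℕ∞) ψ)
    (h0 : ∀ s, T ≤ s → ψ s = 0) {t : EE d → ℝ} {τ : Fin d → EE d → ℂ}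
    (ht : ContDiff ℝ (⊤ : ℕ∞) t) (htτ : ∀ i x, ((fderiv ℝ t x (EuclideanSpace.single i 1) : ℝ) : ℂ) = τ i x)
    (hτ : ∀ i, ContDiff ℝ (⊤ : ℕ∞) (τ i)) {q : EE d → ℂ} (hq : ContDiff ℝ (⊤ : ℕ∞) q)
    {w : EE d → ℂ} (hw : TF w) (hQ : ∀ x, t x < T → Qop P w x = 0) :
    ∫ x, w x * (ψ (t x) * (bsym P τ x * q x)) = - ∑ α ∈ P.support, ∑ k ∈ Finset.range P.totalDegree,
        P.coeff α * ∫ x, w x * (JJ T ψ (P.totalDegree - k) (t x) * LL τ (word fun i => α i) k q x) := by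
  have hJ : ∀ k, ContDiff ℝ (⊤ : ℕ∞) (fun x => JJ T ψ k (t x)) := fun k => (JJ_contDiff hψ k).comp ht
  have h1 := ibp_P P hw.smooth hw.cpt ((hJ P.totalDegree).mul hq)
  have h2 : ∀ x, Qop P w x * (JJ T ψ P.totalDegree (t x) * q x) = 0 := by
    intro x
    rcases lt_or_ge (t x) T with h | h
    · rw [hQ x h, zero_mul]
    · rw [JJ_zero h0 _ _ h]; ring
  simp only [h2, integral_zero] at h1
  simp only [PDop_JJ P hψ ht htτ hτ hq, mul_add, Finset.mul_sum] at h1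
  have hcont : ∀ (α : Fin d →₀ ℕ) (k : ℕ), Continuous (fun x =>
      P.coeff α * (JJ T ψ (P.totalDegree - k) (t x) * LL τ (word fun i => α i) k q x)) := by
    intro α k
    exact continuous_const.mul ((hJ _).continuous.mul (LL_contDiff hτ hq _ _).continuous)
  have hb : Continuous (bsym P τ) := by
    have : bsym P τ = fun x => ∑ α ∈ P.support, if (word fun i => α i).length = P.totalDegree then
      P.coeff α * ∏ i, τ i x ^ α i else 0 := by ext x; exact bsym_eq P τ x
    rw [this]
    refine continuous_finsetSum _ fun α _ => ?_
    split_ifs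
    · exact continuous_const.mul (continuous_finsetProd _ fun i _ => (hτ i).continuous.pow _)
    · exact continuous_const
  rw [integral_add] at h1
  · rw [integral_finsetSum] at h1
    · have e : ∀ α ∈ P.support, ∫ x, ∑ k ∈ Finset.range P.totalDegree, w x *
          (P.coeff α * (JJ T ψ (P.totalDegree - k) (t x) * LL τ (word fun i => α i) k q x)) =
          ∑ k ∈ Finset.range P.totalDegree,
        P.coeff α * ∫ x, w x * (JJ T ψ (P.totalDegree - k) (t x) * LL τ (word fun i => α i) k q x) := by
        intro α _
        rw [integral_finsetSum]
        · refine Finset.sum_congr rfl fun k _ => ?_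
          rw [← integral_const_mul]
          congr 1; ext x; ring
        · intro k _
          exact integrable_TF_mul hw (hcont α k)
      rw [Finset.sum_congr rfl e] at h1
      rw [eq_neg_iff_add_eq_zero, add_comm, ← h1]
      simp only [mul_assoc]
    · intro α _
      exact integrable_finsetSum _ fun k _ => integrable_TF_mul hw (hcont α k)
  · exact integrable_finsetSum _ fun α _ => integrable_finsetSum _ fun k _ => integrable_TF_mul hw (hcont α k)
  · exact integrable_TF_mul hw (((hJ 0).continuous.mul hb).mul hq.continuous)

/-- The basic iteration. -/
lemma sweep_claim (P : MvPolynomial (Fin d) ℂ) (hm : 1 ≤ P.totalDegree) {w : EE d → ℂ} (hw : TF w)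
    {τ : Fin d → EE d → ℂ} {R G : ℝ} (hR : 1 ≤ R) (hG : 0 ≤ G)
    (hτ : ∀ i, Bd (tsupport w) (R / 2) 0 G (τ i)) (hb0 : ∀ x, bsym P τ x ≠ 0)
    (hib : Bd (tsupport w) (R / 2) 0 G (fun x => (bsym P τ x)⁻¹))
    {T : ℝ} {t : EE d → ℝ} (ht : ContDiff ℝ (⊤ : ℕ∞) t)
    (htτ : ∀ i x, ((fderiv ℝ t x (EuclideanSpace.single i 1) : ℝ) : ℂ) = τ i x)
    (hQ : ∀ x, t x < T → Qop P w x = 0) (hw0 : ∀ x, t x < 0 → w x = 0) {lam : ℝ} (hlam : 1 ≤ lam)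
    (J : ℕ) : ∀ (D : ℕ) (μ A B : ℝ) (ψ : ℝ → ℂ) (q : EE d → ℂ), 0 ≤ A → 0 ≤ B → 0 < μ →
      lam * (D + P.totalDegree * J : ℕ) ≤ μ → ContDiff ℝ (⊤ : ℕ∞) ψ → (∀ s, T ≤ s → ψ s = 0) →
      (∀ s, 0 ≤ s → ‖ψ s‖ ≤ B * Real.exp (-μ * s)) → Bd (tsupport w) R D A q →
      ‖∫ x, w x * (ψ (t x) * q x)‖ ≤ (∫ x, ‖w x‖) * A * B *
        ((∑ α ∈ P.support, ‖P.coeff α‖) * P.totalDegree * (2 * G) * (R + 2 * G) ^ P.totalDegree / lam) ^ J := by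
  set m := P.totalDegree with hmdef
  set S := ∑ α ∈ P.support, ‖P.coeff α‖ with hS
  have hS0 : 0 ≤ S := Finset.sum_nonneg fun _ _ => norm_nonneg _
  set C := S * m * (2 * G) * (R + 2 * G) ^ m / lam with hC
  have hlam0 : 0 < lam := by linarith
  have hR0 : 0 ≤ R := by linarith
  have hC0 : 0 ≤ C := by positivity
  have hW0 : 0 ≤ ∫ x, ‖w x‖ := integral_nonneg fun _ => norm_nonneg _
  induction J with
  | zero =>
    intro D μ A B ψ q hA hB hμ _ hψ h0 hb hq
    rw [pow_zero, mul_one, mul_assoc, ← integral_mul_const]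
    refine (norm_integral_le_integral_norm _).trans (integral_mono_of_nonneg ?_ ?_ ?_)
    · exact ae_of_all _ fun _ => norm_nonneg _
    · exact (hw.smooth.continuous.integrable_of_hasCompactSupport hw.cpt).norm.mul_const _
    · refine ae_of_all _ fun x => ?_
      simp only [norm_mul]
      by_cases hx : w x = 0
      · simp [hx]
      have hx1 : x ∈ tsupport w := subset_tsupport _ hx
      have hx2 : 0 ≤ t x := by by_contra h; exact hx (hw0 x (not_le.1 h))
      have h1 := hb _ hx2
      have h2 := hq.2 0 x hx1
      rw [norm_iteratedFDeriv_zero, asc_zero_right] at h2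
      have h3 : Real.exp (-μ * t x) ≤ 1 := Real.exp_le_one_iff.2 (by nlinarith)
      gcongr ‖w x‖ * ?_
      calc ‖ψ (t x)‖ * ‖q x‖ ≤ (B * 1) * A := by
            gcongr
            · exact h1.trans (by gcongr)
            · simpa using h2
        _ = A * B := by ring
  | succ J ih =>
    intro D μ A B ψ q hA hB hμ hlm hψ h0 hb hq
    set Q : EE d → ℂ := fun x => (bsym P τ x)⁻¹ * q x with hQd
    have hQb : Bd (tsupport w) R D (2 * G * A) Q := hq.mulR hib hA hG hR0
    have hid := sweep_identity P hψ h0 ht htτ (fun i => (hτ i).1) hQb.1 hw hQ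
    have e1 : ∀ x, bsym P τ x * Q x = q x := fun x => by
      rw [hQd]; simp only []; rw [← mul_assoc, mul_inv_cancel₀ (hb0 x), one_mul]
    simp only [e1] at hid
    rw [hid, norm_neg]
    have hterm : ∀ α ∈ P.support, ∀ k ∈ Finset.range m,
        ‖P.coeff α * ∫ x, w x * (JJ T ψ (m - k) (t x) * LL τ (word fun i => α i) k Q x)‖ ≤
        ‖P.coeff α‖ * ((∫ x, ‖w x‖) * (2 * G * A * (R + 2 * G) ^ m) * B / lam * C ^ J) := by
      intro α hα k hk
      have hk' : k < m := by simpa using hk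
      rw [norm_mul]
      gcongr
      by_cases hkl : (word fun i => α i).length < k
      · rw [LL_zero_of_lt _ _ _ _ hkl]
        simp only [mul_zero, integral_zero, norm_zero]
        positivity
      push Not at hkl
      have hl := length_word_le P hα
      have hL := LL_bound hR0 hG hτ (N := D + m) (by positivity) hQb (word fun i => α i) k hkl (by omega)
      have hN1 : (1:ℝ) ≤ ((D + m : ℕ) : ℝ) := by exact_mod_cast (by omega)
      have hL' := hL.mono hR0 (by positivity) (A' := 2 * G * A * (R + 2 * G) ^ m * ((D + m : ℕ) : ℝ) ^ (m - k))
        (by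
          have : (1:ℝ) ≤ R + 2 * G := by linarith
          gcongr) (D' := D + m) (by omega)
      have := ih (D + m) μ _ (B / μ ^ (m-k)) (JJ T ψ (m - k)) _ (by positivity) (by positivity) hμ
        (by
          refine le_trans ?_ hlm
          rw [show D + m + m * J = D + m * (J + 1) by ring]) (JJ_contDiff hψ _) (fun s hs => JJ_zero h0 _ _ hs)
        (fun s hs => JJ_bound hμ hB hψ.continuous h0 hb _ s hs) hL'
      refine this.trans ?_
      have hNμ : ((D + m : ℕ) : ℝ) ^ (m-k) / μ ^ (m-k) ≤ 1 / lam := by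
        rw [← div_pow]
        have h5 : ((D + m : ℕ) : ℝ) / μ ≤ 1 / lam := by
          rw [div_le_div_iff₀ hμ hlam0]
          have : ((D + m : ℕ) : ℝ) ≤ (D + m * (J+1) : ℕ) := by
            exact_mod_cast (by rw [Nat.mul_succ]; omega)
          nlinarith
        calc _ ≤ (1/lam)^(m-k) := by gcongr
          _ ≤ (1/lam)^1 := by
              apply pow_le_pow_of_le_one (by positivity)
              · rw [div_le_one hlam0]; exact hlam
              · omega
          _ = _ := pow_one _
      calc _ = (∫ x, ‖w x‖) * (2 * G * A * (R + 2 * G) ^ m) * B * (((D + m : ℕ) : ℝ) ^ (m-k) / μ ^ (m-k)) * C ^ J := by ring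
        _ ≤ (∫ x, ‖w x‖) * (2 * G * A * (R + 2 * G) ^ m) * B * (1 / lam) * C ^ J := by gcongr
        _ = _ := by ring
    refine (norm_sum_le _ _).trans ?_
    refine (Finset.sum_le_sum fun α hα => (norm_sum_le _ _).trans (Finset.sum_le_sum (hterm α hα))).trans (le_of_eq ?_)
    simp only [Finset.sum_const, Finset.card_range, nsmul_eq_mul]
    rw [← Finset.mul_sum, ← Finset.sum_mul, ← hS, pow_succ, hC]
    ring

end

open scoped BigOperators
noncomputable section

open Set Filter Topology MeasureTheory Metric TopologicalSpace

variable {d : ℕ}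

lemma exp_deriv_bound (ℓ : EE d →L[ℝ] ℂ) (hℓ : ∀ x, (ℓ x).re = 0) (n : ℕ) (x : EE d) :
    ‖iteratedFDeriv ℝ n (fun y => Complex.exp (ℓ y)) x‖ ≤ ‖ℓ‖ ^ n := by
  have hsm : ContDiff ℝ (⊤ : ℕ∞) (fun y => Complex.exp (ℓ y)) := ℓ.contDiff.cexp
  induction n with
  | zero => simp [Complex.norm_exp, hℓ]
  | succ n ih =>
    rw [← norm_iteratedFDeriv_fderiv]
    have e : fderiv ℝ (fun y => Complex.exp (ℓ y)) =
        ((ContinuousLinearMap.toSpanSingleton ℂ ℓ).restrictScalars ℝ) ∘ (fun y => Complex.exp (ℓ y)) := by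
      ext y v
      have := (ℓ.hasFDerivAt (x := y)).cexp
      rw [this.fderiv]; simp
    rw [e]
    have h := ContinuousLinearMap.norm_iteratedFDeriv_comp_left (N := ((⊤ : ℕ∞) : WithTop ℕ∞))
      ((ContinuousLinearMap.toSpanSingleton ℂ ℓ).restrictScalars ℝ) (x := x) hsm.contDiffAt
      (n := n) (by exact_mod_cast le_top)
    refine h.trans ?_
    rw [pow_succ, mul_comm, ContinuousLinearMap.norm_restrictScalars, ContinuousLinearMap.norm_toSpanSingleton]
    gcongr

lemma exp_Bd (K : Set (EE d)) {R : ℝ} (hR : 0 < R) (ℓ : EE d →L[ℝ] ℂ) (hℓ : ∀ x, (ℓ x).re = 0) :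
    Bd K R 0 (Real.exp (‖ℓ‖ / R)) (fun y => Complex.exp (ℓ y)) := by
  refine ⟨ℓ.contDiff.cexp, fun n x _ => (exp_deriv_bound ℓ hℓ n x).trans ?_⟩
  have h := Real.pow_div_factorial_le_exp (‖ℓ‖ / R) (by positivity) n
  rw [asc_zero_left]
  rw [div_le_iff₀ (by positivity), div_pow, div_le_iff₀ (by positivity)] at h
  linarith

lemma zero_of_exp {f : EE d → ℂ} (hf : Continuous f) (hc : HasCompactSupport f)
    (h : ∀ ℓ : EE d →L[ℝ] ℂ, (∀ x, (ℓ x).re = 0) → ∫ x, f x * Complex.exp (ℓ x) = 0) : f = 0 := by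
  have hi : Integrable f := hf.integrable_of_hasCompactSupport hc
  have hF : FourierTransform.fourier f = 0 := by
    ext ξ
    rw [Real.fourier_eq']
    set ℓ : EE d →L[ℝ] ℂ := ((-2 * Real.pi : ℝ) * Complex.I : ℂ) • (Complex.ofRealCLM ∘L (innerSL ℝ ξ)) with hℓ
    have e := h ℓ (by intro x; simp [hℓ])
    rw [Pi.zero_apply, ← e]
    congr 1
    ext v
    rw [smul_eq_mul, mul_comm]
    congr 2
    simp [hℓ, real_inner_comm]
    ring
  have := Continuous.fourierInv_fourier_eq hf hi (by rw [hF]; exact integrable_zero _ _ _)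
  rw [← this, hF]
  ext ξ
  simp [Real.fourierInv_eq']

lemma step_sweep (P : MvPolynomial (Fin d) ℂ) (hm : 1 ≤ P.totalDegree) {w : EE d → ℂ} (hw : TF w)
    {τ : Fin d → EE d → ℂ} (hτ : ∀ i, AnB (tsupport w) (τ i)) (hb0 : ∀ x, bsym P τ x ≠ 0) :
    ∃ T0 : ℝ, 0 < T0 ∧ ∀ (T : ℝ) (t : EE d → ℝ), ContDiff ℝ (⊤ : ℕ∞) t →
    (∀ i x, ((fderiv ℝ t x (EuclideanSpace.single i 1) : ℝ) : ℂ) = τ i x) →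
    (∀ x, t x < T → Qop P w x = 0) → (∀ x, t x < 0 → w x = 0) →
    ∀ x, t x < T → t x < T0 → w x = 0 := by
  obtain ⟨r1, G1, hr1, hG1, hib⟩ := (bsym_AnB P hτ).inv hw.cpt hb0
  choose r2 G2 hr2 hG2 hτ2 using hτ
  have hsum : ∀ i, r2 i ≤ ∑ j, r2 j := fun i =>
    Finset.single_le_sum (f := r2) (fun j _ => (hr2 j).le) (Finset.mem_univ i)
  have hsumG : ∀ i, G2 i ≤ ∑ j, G2 j := fun i =>
    Finset.single_le_sum (f := G2) (fun j _ => (hG2 j).le) (Finset.mem_univ i)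
  have hr20 : 0 ≤ ∑ j, r2 j := Finset.sum_nonneg fun j _ => (hr2 j).le
  have hG20 : 0 ≤ ∑ j, G2 j := Finset.sum_nonneg fun j _ => (hG2 j).le
  set G := G1 + ∑ j, G2 j with hG
  set R := 2 * (r1 + ∑ j, r2 j) + 1 with hR
  have hGp : 0 ≤ G := by positivity
  have hR1 : 1 ≤ R := by rw [hR]; linarith
  have hib' : Bd (tsupport w) (R / 2) 0 G (fun x => (bsym P τ x)⁻¹) :=
    (hib.monoR hr1.le hG1.le (by rw [hR]; linarith)).mono (by positivity) hG1.le (by rw [hG]; linarith) le_rfl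
  have hτ' : ∀ i, Bd (tsupport w) (R / 2) 0 G (τ i) := fun i =>
    ((hτ2 i).monoR (hr2 i).le (hG2 i).le (by rw [hR]; linarith [hsum i])).mono (by positivity) (hG2 i).le
      (by rw [hG]; linarith [hsumG i]) le_rfl
  set M := (∑ α ∈ P.support, ‖P.coeff α‖) * P.totalDegree * (2 * G) * (R + 2 * G) ^ P.totalDegree with hM
  have hM0 : 0 ≤ M := by
    have : 0 ≤ ∑ α ∈ P.support, ‖P.coeff α‖ := Finset.sum_nonneg fun _ _ => norm_nonneg _
    positivity
  set lam := M * Real.exp 2 + 1 with hlam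
  have hlam1 : 1 ≤ lam := by rw [hlam]; have := Real.exp_pos 2; nlinarith
  have hlam0 : 0 < lam := by linarith
  have hm0 : (0:ℝ) < P.totalDegree := by exact_mod_cast hm
  refine ⟨1 / (lam * P.totalDegree), by positivity, ?_⟩
  intro T t ht htτ hQ hw0 x0 hx0 hx0'
  set T1 := min T (1 / (lam * P.totalDegree)) with hT1
  have hxT1 : t x0 < T1 := lt_min hx0 hx0'
  rcases lt_or_ge (t x0) 0 with hneg | hpos
  · exact hw0 _ hneg
  have hT1pos : 0 < T1 := hpos.trans_lt hxT1
  set ψ : ℝ → ℂ := fun s => ((expNegInvGlue (T1 - s) : ℝ) : ℂ) with hψd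
  have hψ : ContDiff ℝ (⊤ : ℕ∞) ψ :=
    Complex.ofRealCLM.contDiff.comp (expNegInvGlue.contDiff.comp (contDiff_const.sub contDiff_id))
  have hψ0 : ∀ s, T1 ≤ s → ψ s = 0 := fun s hs => by
    simp [hψd, expNegInvGlue.zero_of_nonpos (sub_nonpos.2 hs)]
  have hψ1 : ∀ s, ‖ψ s‖ ≤ 1 := by
    intro s
    simp only [hψd, Complex.norm_real, Real.norm_eq_abs, abs_of_nonneg (expNegInvGlue.nonneg _)]
    unfold expNegInvGlue
    split_ifs with h
    · exact zero_le_one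
    · apply Real.exp_le_one_iff.2
      push Not at h
      have := inv_pos.2 h
      linarith
  have hfz : (fun x => w x * ψ (t x)) = 0 := by
    apply zero_of_exp
    · exact hw.smooth.continuous.mul (hψ.continuous.comp ht.continuous)
    · exact hw.cpt.mul_right
    intro ℓ hℓ
    have hb : ∀ J : ℕ, ‖∫ x, w x * (ψ (t x) * Complex.exp (ℓ x))‖ ≤
        (∫ x, ‖w x‖) * Real.exp (‖ℓ‖ / R) * Real.exp (-1) ^ (J + 1) := by
      intro J
      have h1 := sweep_claim P hm hw hR1 hGp hτ' hb0 hib' ht htτ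
        (T := T1) (fun x hx => hQ x (hx.trans_le (min_le_left _ _))) hw0 hlam1 (J+1) 0
        (lam * (P.totalDegree * (J+1))) (Real.exp (‖ℓ‖ / R)) (Real.exp ((J + 1 : ℕ) : ℝ)) ψ _
        (Real.exp_pos _).le (Real.exp_pos _).le (by positivity) (by push_cast; simp) hψ hψ0 ?_
        (exp_Bd _ (by linarith) ℓ hℓ)
      · refine h1.trans ?_
        rw [mul_assoc _ (Real.exp ((J + 1 : ℕ) : ℝ))]
        have hW0 : 0 ≤ ∫ x, ‖w x‖ := integral_nonneg fun _ => norm_nonneg _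
        gcongr
        have h2 : M / lam ≤ Real.exp (-2) := by
          rw [div_le_iff₀ hlam0, hlam, Real.exp_neg]
          have := Real.exp_pos 2
          field_simp
          linarith
        have h3 : Real.exp ((J + 1 : ℕ) : ℝ) = Real.exp 1 ^ (J+1) := by
          rw [← Real.exp_nat_mul, mul_one]
        rw [h3, ← mul_pow]
        have : Real.exp 1 * Real.exp (-2) = Real.exp (-1) := by rw [← Real.exp_add]; norm_num
        rw [← this]
        gcongr
      · intro s hs
        rcases le_or_gt T1 s with h | h
        · rw [hψ0 s h, norm_zero]; positivity
        · refine (hψ1 s).trans ?_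
          rw [← Real.exp_add]
          apply Real.one_le_exp
          have h4 : s ≤ 1 / (lam * P.totalDegree) := h.le.trans (min_le_right _ _)
          rw [le_div_iff₀ (by positivity)] at h4
          push_cast
          have : (0:ℝ) ≤ J := Nat.cast_nonneg J
          nlinarith
    have hlim : Tendsto (fun J : ℕ => (∫ x, ‖w x‖) * Real.exp (‖ℓ‖ / R) * Real.exp (-1) ^ (J + 1)) atTop (𝓝 0) := by
      have h1 := tendsto_pow_atTop_nhds_zero_of_lt_one (Real.exp_pos (-1)).le (Real.exp_lt_one_iff.2 (by norm_num : (-1:ℝ) < 0))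
      have h2 := (h1.comp (tendsto_add_atTop_nat 1)).const_mul ((∫ x, ‖w x‖) * Real.exp (‖ℓ‖ / R))
      simpa using h2
    have := ge_of_tendsto' hlim hb
    have h0 := norm_eq_zero.1 (le_antisymm this (norm_nonneg _))
    simpa only [mul_assoc] using h0
  have := congrFun hfz x0
  simp only [Pi.zero_apply, mul_eq_zero] at this
  rcases this with h | h
  · exact h
  · exfalso
    have h2 : expNegInvGlue (T1 - t x0) = 0 := Complex.ofReal_eq_zero.1 h
    exact (expNegInvGlue.pos_of_pos (sub_pos.2 hxT1)).ne' h2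

/-- Holmgren sweep. -/
theorem holmgren_sweep (P : MvPolynomial (Fin d) ℂ) (hm : 1 ≤ P.totalDegree) {w : EE d → ℂ} (hw : TF w)
    {τ : Fin d → EE d → ℂ} (hτ : ∀ i, AnB (tsupport w) (τ i)) (hb0 : ∀ x, bsym P τ x ≠ 0)
    {T : ℝ} {t : EE d → ℝ} (ht : ContDiff ℝ (⊤ : ℕ∞) t)
    (htτ : ∀ i x, ((fderiv ℝ t x (EuclideanSpace.single i 1) : ℝ) : ℂ) = τ i x)
    (hQ : ∀ x, t x < T → Qop P w x = 0) (hw0 : ∀ x, t x < 0 → w x = 0) :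
    ∀ x, t x < T → w x = 0 := by
  obtain ⟨T0, hT0, h⟩ := step_sweep P hm hw hτ hb0
  have key : ∀ n : ℕ, ∀ x, t x < T → t x < n * T0 → w x = 0 := by
    intro n
    induction n with
    | zero => intro x _ h2; exact hw0 x (by simpa using h2)
    | succ n ih =>
      intro x hx1 hx2
      rcases lt_or_ge T (n * T0) with hT | hT
      · exact ih x hx1 (hx1.trans hT)
      refine h (T - n * T0) (fun y => t y - n * T0) (ht.sub contDiff_const) ?_ ?_ ?_ x ?_ ?_
      · intro i y
        rw [fderiv_sub_const]; exact htτ i y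
      · intro y hy; exact hQ y (by linarith)
      · intro y hy
        exact ih y (by linarith) (by linarith)
      · simpa using hx1
      · push_cast at hx2; linarith
  intro x hx
  obtain ⟨n, hn⟩ := exists_nat_gt (t x / T0)
  exact key n x hx ((div_lt_iff₀ hT0).1 hn)

end

open scoped BigOperators
noncomputable section

open Set Filter Topology MeasureTheory Metric TopologicalSpace

variable {d : ℕ}

/-- The hypotheses on the operator. -/
structure Hyp (P : MvPolynomial (Fin d) ℂ) (v : EE d) : Prop where
  nv : ‖v‖ = 1
  zero : ∀ ξ : EE d, MvPolynomial.eval (fun i => (ξ i : ℂ))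
    (MvPolynomial.homogeneousComponent P.totalDegree P) = 0 ↔ ∃ s : ℝ, ξ = s • v
  deg : 1 ≤ P.totalDegree

lemma AnB.clm {K : Set (EE d)} (hK : IsCompact K) (ℓ : EE d →L[ℝ] ℂ) : AnB K (fun x => ℓ x) := by
  obtain ⟨C, hC⟩ := hK.exists_bound_of_continuousOn ℓ.continuous.continuousOn
  refine ⟨1, |C| + ‖ℓ‖ + 1, one_pos, by positivity, ℓ.contDiff, fun n x hx => ?_⟩
  have := asc_pos 0 n
  rcases n with _ | n
  · rw [norm_iteratedFDeriv_zero, asc_zero_right]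
    have := hC x hx
    have := le_abs_self C
    have := norm_nonneg ℓ
    simp only [pow_zero, mul_one]; linarith
  · rw [← norm_iteratedFDeriv_fderiv]
    have e : fderiv ℝ (fun x => ℓ x) = fun _ => ℓ := by ext1 y; exact ℓ.fderiv
    rw [e]
    rcases n with _ | n
    · rw [norm_iteratedFDeriv_zero, asc_zero_left]
      simp
      have := abs_nonneg C
      linarith
    · rw [iteratedFDeriv_const_of_ne (by omega)]
      simp; positivity

lemma local_uc {P : MvPolynomial (Fin d) ℂ} {v : EE d} (hyp : Hyp P v) {u : EE d → ℂ}
    (hu : ContDiff ℝ (⊤ : ℕ∞) u) {y a : EE d} {R : ℝ} (hQ : ∀ x ∈ ball y R, Qop P u x = 0)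
    (ha : dist a y < R / 2) (hav : inner ℝ (a - y) v = 0) (hua : u =ᶠ[𝓝 a] fun _ => 0) :
    u =ᶠ[𝓝 y] fun _ => 0 := by
  by_cases hay : a = y
  · rwa [← hay]
  obtain ⟨r, hr, hur⟩ := Metric.eventually_nhds_iff.1 hua
  set ℓ := ‖y - a‖ with hℓ
  have hℓ0 : 0 < ℓ := norm_pos_iff.2 (sub_ne_zero.2 (Ne.symm hay))
  have hℓR : ℓ < R / 2 := by rwa [hℓ, ← dist_eq_norm, dist_comm]
  set N : EE d := ℓ⁻¹ • (y - a) with hN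
  have hNn : ‖N‖ = 1 := by rw [hN, norm_smul, norm_inv, norm_norm, inv_mul_cancel₀ hℓ0.ne']
  have hNv : inner ℝ N v = 0 := by
    rw [hN, inner_smul_left, ← neg_sub, inner_neg_left, hav]; simp
  have hyN : y - a = ℓ • N := by rw [hN, smul_smul, mul_inv_cancel₀ hℓ0.ne', one_smul]
  set ρ := min (r / 2) (R / 4) / 2 with hρ
  have hR0 : 0 < R := by linarith
  have hρ0 : 0 < ρ := by rw [hρ]; positivity
  have hρr : 2 * ρ < r := by have := min_le_left (r/2) (R/4); rw [hρ]; linarith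
  have hρR : ρ < R / 4 := by have := min_le_right (r/2) (R/4); rw [hρ]; linarith
  set M := 4 * ℓ / ρ ^ 2 with hM
  have hM0 : 0 < M := by positivity
  set xn : EE d → ℝ := fun x => inner ℝ N (x - a) with hxn
  set sq : EE d → ℝ := fun x => ‖x - a‖ ^ 2 - xn x ^ 2 with hsq
  have hxnc : Continuous xn := by rw [hxn]; fun_prop
  have hsqc : Continuous sq := by rw [hsq]; fun_prop
  have hsq0 : ∀ x, 0 ≤ sq x := by
    intro x
    have := abs_real_inner_le_norm N (x - a)
    rw [hNn, one_mul] at this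
    simp only [hsq, hxn]
    rw [sub_nonneg, ← sq_abs (inner ℝ N (x - a))]
    gcongr
  set t : EE d → ℝ := fun x => xn x + M * sq x with htd
  have ht : ContDiff ℝ (⊤ : ℕ∞) t := by
    rw [htd, hsq, hxn]
    have h1 : ContDiff ℝ (⊤ : ℕ∞) (fun x : EE d => inner ℝ N (x - a)) :=
      contDiff_const.inner ℝ (contDiff_id.sub contDiff_const)
    have h2 : ContDiff ℝ (⊤ : ℕ∞) (fun x : EE d => ‖x - a‖ ^ 2) :=
      (contDiff_id.sub contDiff_const).norm_sq ℝ
    exact h1.add (contDiff_const.mul (h2.sub (h1.pow 2)))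
  set grad : EE d → EE d := fun x => N + (2 * M) • ((x - a) - xn x • N) with hgrad
  have hfd : ∀ x h, fderiv ℝ t x h = inner ℝ (grad x) h := by
    intro x h
    have h1 : HasFDerivAt xn (innerSL ℝ N) x := by
      have : xn = fun x => innerSL ℝ N (x - a) := by ext; simp [hxn]
      rw [this]
      exact (innerSL ℝ N).hasFDerivAt.comp x ((hasFDerivAt_id x).sub_const a)
    have h2 : HasFDerivAt (fun x : EE d => ‖x - a‖ ^ 2) (2 • (innerSL ℝ (x - a))) x := by
      have := ((hasFDerivAt_id (𝕜 := ℝ) x).sub_const a).norm_sq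
      simpa using this
    have h3 := h1.add ((h2.sub (h1.pow 2)).const_mul M)
    have h4 : HasFDerivAt t _ x := h3
    rw [h4.fderiv]
    simp only [hgrad, inner_add_left, inner_smul_left, inner_sub_left]
    simp
    ring
  set τ : Fin d → EE d → ℂ := fun i x => ((grad x i : ℝ) : ℂ) with hτd
  have htτ : ∀ i x, ((fderiv ℝ t x (EuclideanSpace.single i 1) : ℝ) : ℂ) = τ i x := by
    intro i x
    rw [hfd, EuclideanSpace.inner_single_right]
    simp [hτd]
  have hb0 : ∀ x, bsym P τ x ≠ 0 := by
    intro x h0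
    obtain ⟨s, hs⟩ := (hyp.zero (grad x)).1 h0
    have h1 : inner ℝ (grad x) N = 1 := by
      simp only [hgrad, inner_add_left, inner_smul_left, inner_sub_left, real_inner_self_eq_norm_sq, hNn]
      simp [hxn, real_inner_comm, inner_sub_right]
    rw [hs, inner_smul_left, real_inner_comm, hNv] at h1
    simp at h1
  have hτ : ∀ (w : EE d → ℂ), TF w → ∀ i, AnB (tsupport w) (τ i) := by
    intro w hw i
    have e : τ i = fun x => (((N i + (2 * M) * (- a i + inner ℝ N a * N i) : ℝ) : ℂ)) +
        (Complex.ofRealCLM ∘L ((2 * M) • (EuclideanSpace.proj (𝕜 := ℝ) i - (N i) • innerSL ℝ N))) x := by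
      ext x
      simp [hτd, hgrad, hxn, inner_sub_right]
      ring
    rw [e]
    exact (AnB.const _ _).add (AnB.clm hw.cpt _)
  -- tube
  set Tu : Set (EE d) := {x | sq x < ρ ^ 2 ∧ -ρ < xn x ∧ xn x < ℓ + ρ} with hTu
  set K2 : Set (EE d) := {x | sq x ≤ ρ ^ 2 / 4 ∧ -(ρ / 2) ≤ xn x ∧ xn x ≤ ℓ + ρ / 2} with hK2
  have hTuo : IsOpen Tu := (isOpen_lt hsqc continuous_const).inter
    ((isOpen_lt continuous_const hxnc).inter (isOpen_lt hxnc continuous_const))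
  have hnsq : ∀ x, ‖x - a‖ ^ 2 = sq x + xn x ^ 2 := fun x => by simp [hsq]
  have hK2c : IsCompact K2 := by
    apply Metric.isCompact_of_isClosed_isBounded
    · exact (isClosed_le hsqc continuous_const).inter
        ((isClosed_le continuous_const hxnc).inter (isClosed_le hxnc continuous_const))
    · refine (Metric.isBounded_closedBall (x := a) (r := ρ + (ℓ + ρ))).subset ?_
      rintro x ⟨h1, h2, h3⟩
      rw [mem_closedBall, dist_eq_norm]
      apply le_of_sq_le_sq _ (by positivity)
      rw [hnsq]
      nlinarith
  have hK2Tu : K2 ⊆ Tu := by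
    rintro x ⟨h1, h2, h3⟩
    refine ⟨?_, by linarith, by linarith⟩
    nlinarith
  have hTuR : Tu ⊆ ball y R := by
    rintro x ⟨h1, h2, h3⟩
    rw [mem_ball, dist_eq_norm]
    apply lt_of_pow_lt_pow_left₀ 2 hR0.le
    have e : ‖x - y‖ ^ 2 = sq x + (xn x - ℓ) ^ 2 := by
      have : x - y = (x - a) - ℓ • N := by rw [← hyN]; abel
      rw [this, norm_sub_sq_real, hnsq, inner_smul_right, norm_smul, hNn, real_inner_comm]
      simp only [hxn, Real.norm_eq_abs, mul_one, sq_abs]; ring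
    rw [e]
    nlinarith
  obtain ⟨χ, hχ, hχc, hχTu, V, hV, hKV, hVT, hχ1⟩ := exists_cutoff hK2c hTuo hK2Tu
  set w : EE d → ℂ := fun x => χ x * u x with hw
  have hwTF : TF w := ⟨hχ.mul hu, hχc.mul_right⟩
  have hnear : ∀ x ∈ Tu, xn x < ρ → dist x a < r := by
    rintro x ⟨h1, h2, h3⟩ h4
    refine lt_trans ?_ hρr
    rw [dist_eq_norm]
    apply lt_of_pow_lt_pow_left₀ 2 (by positivity)
    rw [hnsq]; nlinarith
  have hwz : ∀ x, dist x a < r → w =ᶠ[𝓝 x] fun _ => 0 := by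
    intro x hx
    filter_upwards [isOpen_ball.mem_nhds (mem_ball.2 hx)] with z hz
    simp [hw, hur (mem_ball.1 hz)]
  have hQw0 : ∀ x, w =ᶠ[𝓝 x] (fun _ => 0) → Qop P w x = 0 := by
    intro x hx
    have := (Qop_eventuallyEq P hx).eq_of_nhds
    rw [this, Qop_zero]
  have hfin := holmgren_sweep P hyp.deg hwTF (hτ w hwTF) hb0 (T := ℓ + ρ / 4) ht htτ ?_ ?_
  · have hyxn : xn y = ℓ := by
      simp only [hxn]; rw [hyN, inner_smul_right, real_inner_self_eq_norm_sq, hNn]; simp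
    have hysq : sq y = 0 := by simp only [hsq]; rw [hyxn, ← hℓ]; ring
    have h1 : y ∈ V := hKV ⟨by rw [hysq]; positivity, by rw [hyxn]; linarith, by rw [hyxn]; linarith⟩
    have h2 : {x | t x < ℓ + ρ / 4} ∈ 𝓝 y := by
      apply (isOpen_lt ht.continuous continuous_const).mem_nhds
      simp only [mem_setOf_eq, htd, hyxn, hysq]; linarith
    filter_upwards [hV.mem_nhds h1, h2] with x hx1 hx2
    have := hfin x hx2
    simpa [hw, hχ1 x hx1] using this
  · intro x hx
    by_cases hxs : x ∈ tsupport χ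
    · by_cases hxr : dist x a < r
      · exact hQw0 x (hwz x hxr)
      · have hxT := hχTu hxs
        have h1 : ρ ≤ xn x := by
          by_contra h; exact hxr (hnear x hxT (not_le.1 h))
        simp only [htd] at hx
        have h2 : x ∈ V := by
          apply hKV
          refine ⟨?_, by linarith, by nlinarith [hsq0 x]⟩
          have h3 : M * sq x ≤ ℓ := by linarith
          have h4 : M * sq x ≤ M * (ρ ^ 2 / 4) := by
            refine h3.trans (le_of_eq ?_)
            rw [hM]; field_simp
          exact le_of_mul_le_mul_left h4 hM0
        have h5 : w =ᶠ[𝓝 x] u := by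
          filter_upwards [hV.mem_nhds h2] with z hz
          simp [hw, hχ1 z hz]
        rw [(Qop_eventuallyEq P h5).eq_of_nhds]
        exact hQ x (hTuR hxT)
    · apply hQw0
      filter_upwards [notMem_tsupport_iff_eventuallyEq.1 hxs] with z hz
      simp [hw, hz]
  · intro x hx
    by_cases hxs : x ∈ tsupport χ
    · have hxT := hχTu hxs
      simp only [htd] at hx
      exact (hwz x (hnear x hxT (by nlinarith [hsq0 x]))).eq_of_nhds
    · simp [hw, image_eq_zero_of_notMem_tsupport hxs]

/-- Unique continuation along leaves. -/
theorem leaf_uc {P : MvPolynomial (Fin d) ℂ} {v : EE d} (hyp : Hyp P v) {u : EE d → ℂ}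
    (hu : ContDiff ℝ (⊤ : ℕ∞) u) {A : Set (EE d)} (hA : IsPreconnected A) {c : ℝ}
    (hAc : ∀ x ∈ A, inner ℝ x v = c) (hQ : ∀ x ∈ A, Qop P u =ᶠ[𝓝 x] fun _ => 0) {a : EE d}
    (ha : a ∈ A) (hua : u =ᶠ[𝓝 a] fun _ => 0) : ∀ y ∈ A, u =ᶠ[𝓝 y] fun _ => 0 := by
  set O : Set (EE d) := {x | u =ᶠ[𝓝 x] fun _ => 0} with hO
  have hOo : IsOpen O := isOpen_setOf_eventually_nhds
  have hR : ∀ y : EE d, ∃ R > 0, y ∈ A → ∀ x ∈ ball y R, Qop P u x = 0 := by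
    intro y
    by_cases hy : y ∈ A
    · obtain ⟨R, hR, h⟩ := Metric.eventually_nhds_iff.1 (hQ y hy)
      exact ⟨R, hR, fun _ x hx => h hx⟩
    · exact ⟨1, one_pos, fun h => absurd h hy⟩
  choose R hR0 hR using hR
  by_contra hcon
  push Not at hcon
  obtain ⟨y0, hy0, hy0n⟩ := hcon
  set V : Set (EE d) := ⋃ y ∈ A \ O, ball y (R y / 2) with hV
  have hVo : IsOpen V := isOpen_biUnion fun _ _ => isOpen_ball
  obtain ⟨z, hzA, hzO, hzV⟩ := hA O V hOo hVo (fun x hx => by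
    by_cases hxO : x ∈ O
    · exact Or.inl hxO
    · exact Or.inr (mem_biUnion (show x ∈ A \ O from ⟨hx, hxO⟩)
        (mem_ball_self (half_pos (hR0 x))))) ⟨a, ha, hua⟩ ⟨y0, hy0, mem_biUnion
          (show y0 ∈ A \ O from ⟨hy0, hy0n⟩) (mem_ball_self (half_pos (hR0 y0)))⟩
  obtain ⟨y, hy, hzy⟩ := mem_iUnion₂.1 hzV
  apply hy.2
  refine local_uc hyp hu (hR y hy.1) (mem_ball.1 hzy) ?_ hzO
  rw [inner_sub_left, hAc z hzA, hAc y hy.1, sub_self]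

end

open scoped BigOperators
noncomputable section

open Set Filter Topology MeasureTheory Metric TopologicalSpace

variable {d : ℕ}

lemma hom_eval {Q : MvPolynomial (Fin d) ℂ} {j : ℕ} (hQ : Q.IsHomogeneous j) (c : ℂ)
    (y : Fin d → ℂ) : MvPolynomial.eval (fun i => c * y i) Q = c ^ j * MvPolynomial.eval y Q := by
  rw [MvPolynomial.eval_eq', MvPolynomial.eval_eq', Finset.mul_sum]
  refine Finset.sum_congr rfl fun α hα => ?_
  have h := hQ (MvPolynomial.mem_support_iff.1 hα)
  have h2 : ∑ i, α i = j := by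
    rw [← h, Finsupp.weight_apply, Finsupp.sum_fintype] <;> simp
  rw [show (∏ i, (c * y i) ^ α i) = c ^ j * ∏ i, y i ^ α i by
    rw [← h2, ← Finset.prod_pow_eq_pow_sum, ← Finset.prod_mul_distrib]
    exact Finset.prod_congr rfl fun i _ => mul_pow _ _ _]
  ring

/-- restriction of a polynomial to the line `N + θ ξ` -/
def linP (N ξ : EE d) (Q : MvPolynomial (Fin d) ℂ) : Polynomial ℂ :=
  MvPolynomial.aeval (fun i => Polynomial.C (N i : ℂ) + Polynomial.X * Polynomial.C (ξ i : ℂ)) Q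

lemma linP_eval (N ξ : EE d) (Q : MvPolynomial (Fin d) ℂ) (θ : ℂ) :
    (linP N ξ Q).eval θ = MvPolynomial.eval (fun i => (N i : ℂ) + θ * (ξ i : ℂ)) Q := by
  unfold linP
  induction Q using MvPolynomial.induction_on with
  | C a => simp
  | add p q hp hq => rw [map_add, map_add, Polynomial.eval_add, hp, hq]
  | mul_X p i hp => rw [map_mul, map_mul, Polynomial.eval_mul, hp]; simp; left; ring

/-- the complex covector -/
def zz (N ξ : EE d) (μ : ℕ) (p ω : ℂ) (i : Fin d) : ℂ :=
  p ^ (2 * μ + 2) * (N i : ℂ) + p ^ (2 * μ) * ω * (ξ i : ℂ)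

lemma sym_asymp {P : MvPolynomial (Fin d) ℂ} {v N ξ : EE d} (hyp : Hyp P v)
    (hN : ∃ s : ℝ, N = s • v) (hξ : ¬ ∃ s : ℝ, N + ξ = s • v) :
    ∃ (μ e : ℕ) (a : ℂ) (M : ℝ), 1 ≤ μ ∧ a ≠ 0 ∧ 1 ≤ M ∧ ∀ p ω : ℂ, M ≤ ‖p‖ → ‖ω‖ = 1 →
      ‖MvPolynomial.eval (zz N ξ μ p ω) P - a * p ^ e * ω ^ μ‖ ≤ 1 / 2 * (‖a‖ * ‖p‖ ^ e) := by
  classical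
  set m := P.totalDegree with hm
  set q : ℕ → Polynomial ℂ := fun j => linP N ξ (MvPolynomial.homogeneousComponent j P) with hq
  have h0 : (q m).eval 0 = 0 := by
    rw [hq]; simp only [linP_eval]
    simpa using (hyp.zero N).2 hN
  have h1 : (q m).eval 1 ≠ 0 := by
    rw [hq]; simp only [linP_eval]
    have := (not_congr (hyp.zero (N + ξ))).2 hξ
    simpa using this
  have hne : q m ≠ 0 := by
    intro h; rw [h] at h1; simp at h1
  obtain ⟨g, hg, hgd⟩ := Polynomial.exists_eq_pow_rootMultiplicity_mul_and_not_dvd (q m) hne 0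
  set μ := Polynomial.rootMultiplicity 0 (q m) with hμ
  have hμ1 : 1 ≤ μ := (Polynomial.rootMultiplicity_pos hne).2 h0
  have hg0 : g.eval 0 ≠ 0 := fun h => hgd (Polynomial.dvd_iff_isRoot.2 h)
  set T : ℂ × ℂ → ℂ := fun y => y.2 ^ (μ + 1) * (g.divX).eval (y.2 * y.1 ^ 2) +
    ∑ j ∈ Finset.range m, y.1 ^ ((2 * μ + 2) * (m - 1 - j)) * (q j).eval (y.2 * y.1 ^ 2) with hT
  have hTc : Continuous T := by
    have : ∀ r : Polynomial ℂ, Continuous fun y : ℂ × ℂ => r.eval (y.2 * y.1 ^ 2) := fun r =>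
      r.continuous.comp (by fun_prop)
    refine Continuous.add (Continuous.mul (by fun_prop) (this _)) (continuous_finsetSum _ fun j _ =>
      Continuous.mul (by fun_prop) (this _))
  obtain ⟨C, hC⟩ := ((isCompact_closedBall (0:ℂ) 1).prod
    (isCompact_closedBall (0:ℂ) 1)).exists_bound_of_continuousOn hTc.continuousOn
  have ha : 0 < ‖g.eval 0‖ := norm_pos_iff.2 hg0
  refine ⟨μ, (2 * μ + 2) * m - 2 * μ, g.eval 0, 1 + 2 * |C| / ‖g.eval 0‖, hμ1, hg0,
    by simp; positivity, fun p ω hp hω => ?_⟩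
  have hp1 : 1 ≤ ‖p‖ := le_trans (by simp; positivity) hp
  have hp0 : p ≠ 0 := fun h => by rw [h] at hp1; norm_num at hp1
  have hm1 := hyp.deg
  -- exact identity
  have key : MvPolynomial.eval (zz N ξ μ p ω) P =
      ∑ j ∈ Finset.range (m + 1), (p ^ (2 * μ + 2)) ^ j * (q j).eval (ω * p⁻¹ ^ 2) := by
    conv_lhs => rw [← MvPolynomial.sum_homogeneousComponent P, map_sum]
    refine Finset.sum_congr rfl fun j _ => ?_
    rw [hq]; simp only [linP_eval]
    rw [← hom_eval (MvPolynomial.homogeneousComponent_isHomogeneous j P)]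
    congr 2
    funext i
    unfold zz
    field_simp
    ring
  have hid : MvPolynomial.eval (zz N ξ μ p ω) P - g.eval 0 * p ^ ((2 * μ + 2) * m - 2 * μ) * ω ^ μ
      = p ^ ((2 * μ + 2) * m - 2 * μ) * (p⁻¹ ^ 2 * T (p⁻¹, ω)) := by
    rw [key, Finset.sum_range_succ, hT]
    simp only
    have e1 : (q m).eval (ω * p⁻¹ ^ 2) = (ω * p⁻¹ ^ 2) ^ μ * (g.eval 0 +
        (ω * p⁻¹ ^ 2) * (g.divX).eval (ω * p⁻¹ ^ 2)) := by
      rw [hg]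
      conv_lhs => rw [← Polynomial.divX_mul_X_add g]
      simp [Polynomial.coeff_zero_eq_eval_zero]
      left; ring
    have e2 : (p ^ (2 * μ + 2)) ^ m = p ^ ((2 * μ + 2) * m - 2 * μ) * p ^ (2 * μ) := by
      rw [← pow_mul, ← pow_add]; congr 1
      have : 2 * μ ≤ (2 * μ + 2) * m := by nlinarith
      omega
    have e3 : ∀ j ∈ Finset.range m, (p ^ (2 * μ + 2)) ^ j = p ^ ((2 * μ + 2) * m - 2 * μ) *
        (p⁻¹ ^ 2 * p⁻¹ ^ ((2 * μ + 2) * (m - 1 - j))) := by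
      intro j hj
      have hj' := Finset.mem_range.1 hj
      have : (2 * μ + 2) * m - 2 * μ = (2 * μ + 2) * j + (2 + (2 * μ + 2) * (m - 1 - j)) := by
        obtain ⟨c, hc⟩ : ∃ c, m = j + 1 + c := ⟨m - (j + 1), by omega⟩
        have : m - 1 - j = c := by omega
        rw [this, hc]
        have : (2 * μ + 2) * (j + 1 + c) = (2 * μ + 2) * j + (2 + (2 * μ + 2) * c) + 2 * μ := by ring
        omega
      rw [this, ← pow_mul, ← pow_add, pow_add p ((2 * μ + 2) * j), inv_pow, mul_assoc,
        mul_inv_cancel₀ (pow_ne_zero _ hp0), mul_one]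
    have e4 : ∑ j ∈ Finset.range m, (p ^ (2 * μ + 2)) ^ j * (q j).eval (ω * p⁻¹ ^ 2) =
        p ^ ((2 * μ + 2) * m - 2 * μ) * p⁻¹ ^ 2 * ∑ j ∈ Finset.range m,
          p⁻¹ ^ ((2 * μ + 2) * (m - 1 - j)) * (q j).eval (ω * p⁻¹ ^ 2) := by
      rw [Finset.mul_sum]
      exact Finset.sum_congr rfl fun j hj => by rw [e3 j hj]; ring
    have e5 : p ^ (2 * μ) * (ω * p⁻¹ ^ 2) ^ μ = ω ^ μ := by
      rw [mul_pow, ← pow_mul, inv_pow]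
      field_simp
    rw [e1, e2, e4]
    linear_combination (p ^ ((2 * μ + 2) * m - 2 * μ) * (g.eval 0 +
        (ω * p⁻¹ ^ 2) * (g.divX).eval (ω * p⁻¹ ^ 2))) * e5
  rw [hid, norm_mul, norm_mul, norm_pow, norm_pow, norm_inv]
  have hTb : ‖T (p⁻¹, ω)‖ ≤ |C| := by
    refine (hC _ ⟨?_, ?_⟩).trans (le_abs_self C)
    · simpa using inv_le_one_of_one_le₀ hp1
    · simp [hω]
  have h2 : ‖p‖⁻¹ ^ 2 * ‖T (p⁻¹, ω)‖ ≤ 1 / 2 * ‖g.eval 0‖ := by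
    have i1 : ‖p‖⁻¹ ^ 2 ≤ ‖p‖⁻¹ := by
      rw [sq]; exact mul_le_of_le_one_left (by positivity) (inv_le_one_of_one_le₀ hp1)
    have i2 : |C| ≤ 1 / 2 * ‖g.eval 0‖ * ‖p‖ := by
      have : 2 * |C| / ‖g.eval 0‖ ≤ ‖p‖ := by linarith
      rw [div_le_iff₀ ha] at this
      linarith
    calc _ ≤ ‖p‖⁻¹ * (1 / 2 * ‖g.eval 0‖ * ‖p‖) := by gcongr; exact hTb.trans i2
      _ = _ := by field_simp
  calc _ ≤ ‖p‖ ^ ((2 * μ + 2) * m - 2 * μ) * (1 / 2 * ‖g.eval 0‖) := by gcongr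
    _ = _ := by ring

end

open scoped BigOperators
noncomputable section

open Set Filter Topology MeasureTheory Metric TopologicalSpace

variable {d : ℕ}

/-- exponential with complex covector -/
def cex (z : Fin d → ℂ) (x : EE d) : ℂ := Complex.exp (-∑ i, (x i : ℂ) * z i)

lemma cex_hasFDerivAt (z : Fin d → ℂ) (x : EE d) :
    HasFDerivAt (cex z) (Lam d fun i => cex z x * (-z i)) x := by
  have h1 : HasFDerivAt (fun x : EE d => -∑ i, (x i : ℂ) * z i) (-(Lam d z)) x := by
    have := (-(Lam d z)).hasFDerivAt (x := x)
    refine this.congr_of_eventuallyEq (Eventually.of_forall fun y => ?_)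
    simp [Lam_apply]
  have h2 := h1.cexp
  refine h2.congr_fderiv ?_
  ext y
  simp only [Lam_apply, _root_.smul_apply, _root_.neg_apply, smul_eq_mul, cex, Finset.mul_sum,
    ← Finset.sum_neg_distrib]
  refine Finset.sum_congr rfl fun i _ => by ring

lemma norm_cex_le {z : Fin d → ℂ} {ρ : ℝ} (hz : ∀ i, |(z i).re| ≤ ρ) {x : EE d} {R : ℝ}
    (hx : ‖x‖ ≤ R) : ‖cex z x‖ ≤ Real.exp (d * R * ρ) := by
  unfold cex
  rw [Complex.norm_exp]
  apply Real.exp_le_exp.2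
  refine (le_abs_self _).trans ?_
  rw [Complex.neg_re, abs_neg, Complex.re_sum]
  refine (Finset.abs_sum_le_sum_abs _ _).trans ?_
  calc _ ≤ ∑ _i : Fin d, R * ρ := by
        refine Finset.sum_le_sum fun i _ => ?_
        rw [Complex.re_ofReal_mul, abs_mul]
        have h0 : |x i| ≤ ‖x‖ := by simpa using PiLp.norm_apply_le x i
        exact mul_le_mul (h0.trans hx) (hz i) (abs_nonneg _) ((norm_nonneg x).trans hx)
    _ = _ := by simp; ring

lemma norm_listprod_le {z : Fin d → ℂ} {ζ : ℝ} (hz : ∀ i, ‖z i‖ ≤ ζ) (w : List (Fin d)) :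
    ‖(w.map fun i => -z i).prod‖ ≤ ζ ^ w.length := by
  induction w with
  | nil => simp
  | cons i w ih =>
    simp only [List.map_cons, List.prod_cons, norm_mul, norm_neg, List.length_cons, pow_succ']
    exact mul_le_mul (hz i) ih (norm_nonneg _) ((norm_nonneg _).trans (hz i))

section
variable {Λ : Type*} [MeasurableSpace Λ] {ν : Measure Λ} {z : Λ → Fin d → ℂ} {K : Λ → ℂ}
  {ρ ζ : Λ → ℝ}

/-- hypotheses for Fourier-Laplace integrals -/
structure FL (ν : Measure Λ) (z : Λ → Fin d → ℂ) (K : Λ → ℂ) (ρ ζ : Λ → ℝ) : Prop where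
  mz : ∀ i, AEStronglyMeasurable (fun a => z a i) ν
  mK : AEStronglyMeasurable K ν
  re : ∀ a i, |(z a i).re| ≤ ρ a
  pos : ∀ a, 0 ≤ ζ a
  nrm : ∀ a i, ‖z a i‖ ≤ ζ a
  int : ∀ (R : ℝ) (n : ℕ), Integrable (fun a => Real.exp (R * ρ a) * ζ a ^ n * ‖K a‖) ν

/-- Fourier-Laplace integral with derivative word -/
def GG (ν : Measure Λ) (z : Λ → Fin d → ℂ) (K : Λ → ℂ) (w : List (Fin d)) (x : EE d) : ℂ :=
  ∫ a, cex (z a) x * ((w.map fun i => -z a i).prod * K a) ∂ν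

lemma FL.meas (h : FL ν z K ρ ζ) (w : List (Fin d)) (x : EE d) :
    AEStronglyMeasurable (fun a => cex (z a) x * ((w.map fun i => -z a i).prod * K a)) ν := by
  refine AEStronglyMeasurable.mul ?_ (AEStronglyMeasurable.mul ?_ h.mK)
  · unfold cex
    refine Complex.continuous_exp.comp_aestronglyMeasurable
      (AEStronglyMeasurable.neg ?_)
    refine Finset.aestronglyMeasurable_fun_sum _ fun i _ => (h.mz i).const_mul _
  · induction w with
    | nil => simpa using aestronglyMeasurable_const
    | cons i w ih =>
      simp only [List.map_cons, List.prod_cons]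
      exact (h.mz i).neg.mul ih

lemma FL.bound (h : FL ν z K ρ ζ) (w : List (Fin d)) {x : EE d} {R : ℝ} (hx : ‖x‖ ≤ R) (a : Λ) :
    ‖cex (z a) x * ((w.map fun i => -z a i).prod * K a)‖ ≤
      Real.exp ((d * R) * ρ a) * ζ a ^ w.length * ‖K a‖ := by
  rw [norm_mul, norm_mul, mul_assoc]
  have h1 := norm_cex_le (h.re a) hx
  have h2 := norm_listprod_le (h.nrm a) w
  gcongr

lemma FL.integrable (h : FL ν z K ρ ζ) (w : List (Fin d)) (x : EE d) :
    Integrable (fun a => cex (z a) x * ((w.map fun i => -z a i).prod * K a)) ν :=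
  (h.int (d * ‖x‖) w.length).mono' (h.meas w x) (Eventually.of_forall fun a => h.bound w le_rfl a)

lemma FL.hasFDerivAt (h : FL ν z K ρ ζ) (w : List (Fin d)) (x : EE d) :
    HasFDerivAt (GG ν z K w) (Lam d fun i => GG ν z K (i :: w) x) x := by
  have key := hasFDerivAt_integral_of_dominated_of_fderiv_le (𝕜 := ℝ) (μ := ν)
    (F := fun (x : EE d) a => cex (z a) x * ((w.map fun i => -z a i).prod * K a))
    (F' := fun x a => Lam d fun i => cex (z a) x * (((i :: w).map fun i => -z a i).prod * K a))
    (x₀ := x) (s := ball x 1)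
    (bound := fun a => ‖Lam d‖ * (Real.exp ((d * (‖x‖ + 1)) * ρ a) * ζ a ^ (w.length + 1) * ‖K a‖))
    (ball_mem_nhds x one_pos) (Eventually.of_forall fun y => h.meas w y) (h.integrable w x) ?_ ?_
    ((h.int _ _).const_mul _) ?_
  · refine key.congr_fderiv ?_
    ext y
    have hi : Integrable (fun a => Lam d fun i =>
        cex (z a) x * (((i :: w).map fun i => -z a i).prod * K a)) ν := by
      refine (Lam d).integrable_comp ?_
      exact Integrable.of_eval fun i => h.integrable (i :: w) x
    rw [ContinuousLinearMap.integral_apply hi]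
    simp only [Lam_apply]
    rw [integral_finsetSum _ fun i _ => (h.integrable (i :: w) x).const_mul _]
    refine Finset.sum_congr rfl fun i _ => ?_
    rw [integral_const_mul]
    rfl
  · refine (Lam d).continuous.comp_aestronglyMeasurable ?_
    exact (Integrable.of_eval fun i => h.integrable (i :: w) x).aestronglyMeasurable
  · refine Eventually.of_forall fun a y hy => ?_
    refine ((Lam d).le_opNorm _).trans ?_
    gcongr
    have hy' : ‖y‖ ≤ ‖x‖ + 1 := by
      have h1 := mem_ball_iff_norm.1 hy
      have := norm_sub_norm_le y x
      linarith
    rw [pi_norm_le_iff_of_nonneg]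
    · intro i
      exact h.bound (i :: w) hy' a
    · have := h.pos a
      positivity
  · refine Eventually.of_forall fun a y hy => ?_
    have := (cex_hasFDerivAt (z a) y).mul_const ((w.map fun i => -z a i).prod * K a)
    refine this.congr_fderiv ?_
    ext u
    simp only [Lam_apply, _root_.smul_apply, smul_eq_mul, Finset.mul_sum, List.map_cons,
      List.prod_cons]
    refine Finset.sum_congr rfl fun i _ => by ring

lemma FL.contDiff (h : FL ν z K ρ ζ) : ContDiff ℝ (⊤ : ℕ∞) (GG ν z K []) := by
  rw [← contDiffOn_univ]
  exact contDiffOn_of_words isOpen_univ (GG ν z K) (fun w x _ => h.hasFDerivAt w x) []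

lemma FL.Qop (h : FL ν z K ρ ζ) (P : MvPolynomial (Fin d) ℂ) (x : EE d) :
    Qop P (GG ν z K []) x = ∫ a, cex (z a) x * (MvPolynomial.eval (z a) P * K a) ∂ν := by
  unfold _root_.Qop
  have h1 : ∀ α ∈ P.support, P.coeff α * ((-1) ^ (word (fun i => α i)).length *
      wd (word fun i => α i) (GG ν z K []) x) =
      ∫ a, cex (z a) x * (P.coeff α * (∏ i, z a i ^ α i) * K a) ∂ν := by
    intro α _
    rw [wd_of_words isOpen_univ (GG ν z K) (fun w x _ => h.hasFDerivAt w x) _ x (mem_univ _)]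
    unfold GG
    rw [← integral_const_mul, ← integral_const_mul]
    congr 1
    funext a
    rw [← prod_word (fun i => α i) (z a)]
    have : ∀ w : List (Fin d), (-1 : ℂ) ^ w.length * (w.map fun i => -z a i).prod =
        (w.map (z a)).prod := by
      intro w
      induction w with
      | nil => simp
      | cons i w ih =>
        simp only [List.map_cons, List.prod_cons, List.length_cons, ← ih]
        ring
    rw [← this]
    ring
  rw [Finset.sum_congr rfl h1, ← integral_finsetSum]
  · congr 1
    funext a
    rw [MvPolynomial.eval_eq', Finset.sum_mul, Finset.mul_sum]
  · intro α _
    have := ((h.integrable (word fun i => α i) x).const_mul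
      (P.coeff α * (-1) ^ (word (fun i => α i)).length))
    refine this.congr (Eventually.of_forall fun a => ?_)
    simp only
    rw [← prod_word (fun i => α i) (z a)]
    have : ∀ w : List (Fin d), (-1 : ℂ) ^ w.length * (w.map fun i => -z a i).prod =
        (w.map (z a)).prod := by
      intro w
      induction w with
      | nil => simp
      | cons i w ih =>
        simp only [List.map_cons, List.prod_cons, List.length_cons, ← ih]
        ring
    rw [← this]
    ring
end

end

open scoped BigOperators
noncomputable section

open Set Filter Topology MeasureTheory Metric TopologicalSpace

variable {d : ℕ}

/-- principal `(2μ+2)`-th root -/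
def rt (μ : ℕ) (s : ℂ) : ℂ := Complex.exp (Complex.log s / (2 * μ + 2 : ℕ))

lemma rt_pow (μ : ℕ) {s : ℂ} (hs : s ≠ 0) : rt μ s ^ (2 * μ + 2) = s := by
  unfold rt
  rw [← Complex.exp_nat_mul, mul_div_cancel₀ _ (Nat.cast_ne_zero.2 (by omega)), Complex.exp_log hs]

lemma norm_rt_pow (μ : ℕ) {s : ℂ} (hs : s ≠ 0) : ‖rt μ s‖ ^ (2 * μ + 2) = ‖s‖ := by
  rw [← norm_pow, rt_pow μ hs]

lemma rt_diff (μ : ℕ) {s : ℂ} (hs : 0 < s.re) : DifferentiableAt ℂ (rt μ) s := by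
  unfold rt
  have h : s ∈ Complex.slitPlane := Or.inl hs
  have := Complex.differentiableAt_log h
  fun_prop

/-- the cosine constant -/
def cc (μ : ℕ) : ℝ := Real.cos ((2 * μ + 1) / (2 * μ + 2) * (Real.pi / 2))

lemma cc_pos (μ : ℕ) : 0 < cc μ := by
  have hpi := Real.pi_pos
  have h1 : (0:ℝ) < (2 * μ + 1) / (2 * μ + 2) := by positivity
  have h2 : ((2 * μ + 1) / (2 * μ + 2) : ℝ) < 1 := by rw [div_lt_one (by positivity)]; linarith
  refine Real.cos_pos_of_mem_Ioo ⟨by nlinarith, by nlinarith⟩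

lemma re_rt (μ : ℕ) {s : ℂ} (hs : 0 < s.re) :
    cc μ * ‖rt μ s‖ ^ (2 * μ + 1) ≤ (rt μ s ^ (2 * μ + 1)).re := by
  have hpi := Real.pi_pos
  rw [← norm_pow]
  unfold rt cc
  rw [← Complex.exp_nat_mul]
  rw [Complex.norm_exp, Complex.exp_re, mul_comm]
  gcongr
  rw [← Real.cos_abs ((((2 * μ + 1 : ℕ) : ℂ) * (Complex.log s / (2 * μ + 2 : ℕ))).im)]
  have him : (((2 * μ + 1 : ℕ) : ℂ) * (Complex.log s / (2 * μ + 2 : ℕ))).im =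
      (2 * μ + 1) / (2 * μ + 2) * s.arg := by
    have : ((2 * μ + 1 : ℕ) : ℂ) * (Complex.log s / (2 * μ + 2 : ℕ)) =
      (((2 * μ + 1) / (2 * μ + 2) : ℝ) : ℂ) * Complex.log s := by push_cast; ring
    rw [this, Complex.im_ofReal_mul, Complex.log_im]
  rw [him, abs_mul, abs_of_pos (by positivity : (0:ℝ) < (2 * μ + 1) / (2 * μ + 2))]
  have h3 : |s.arg| ≤ Real.pi / 2 := Complex.abs_arg_le_pi_div_two_iff.2 hs.le
  have h2 : ((2 * μ + 1) / (2 * μ + 2) : ℝ) < 1 := by rw [div_lt_one (by positivity)]; linarith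
  refine Real.cos_le_cos_of_nonneg_of_le_pi (by positivity) ?_ (by gcongr)
  have h1 : (0:ℝ) < (2 * μ + 1) / (2 * μ + 2) := by positivity
  nlinarith

lemma exp_poly_bound (R : ℝ) {c : ℝ} (hc : 0 < c) (m N : ℕ) :
    ∃ C : ℝ, 0 ≤ C ∧ ∀ q : ℝ, 1 ≤ q → Real.exp (R * q ^ m - c * q ^ (m + 1)) * q ^ N ≤ C := by
  refine ⟨Real.exp R * (N.factorial / c ^ N) + Real.exp (|R| * (|R| / c) ^ m) * (|R| / c) ^ N,
    by positivity, fun q hq => ?_⟩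
  have hq0 : 0 < q := by linarith
  have hqm : 1 ≤ q ^ m := one_le_pow₀ hq
  have e : R * q ^ m - c * q ^ (m + 1) = q ^ m * (R - c * q) := by ring
  rw [e]
  rcases le_total R (c * q) with h | h
  · have h1 : q ^ m * (R - c * q) ≤ R - c * q := by nlinarith
    have h2 : (c * q) ^ N / N.factorial ≤ Real.exp (c * q) :=
      Real.pow_div_factorial_le_exp _ (by positivity) N
    have h3 : Real.exp (R - c * q) * q ^ N ≤ Real.exp R * (N.factorial / c ^ N) := by
      rw [Real.exp_sub, div_mul_eq_mul_div, div_le_iff₀ (Real.exp_pos _)]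
      rw [div_le_iff₀ (by positivity), mul_pow] at h2
      have : q ^ N ≤ N.factorial / c ^ N * Real.exp (c * q) := by
        rw [div_mul_eq_mul_div, le_div_iff₀ (by positivity)]; linarith
      calc _ ≤ Real.exp R * (N.factorial / c ^ N * Real.exp (c * q)) := by gcongr
        _ = _ := by ring
    calc _ ≤ Real.exp (R - c * q) * q ^ N := by gcongr
      _ ≤ _ := h3.trans (le_add_of_nonneg_right (by positivity))
  · have hq2 : q ≤ |R| / c := by
      rw [le_div_iff₀ hc]; linarith [le_abs_self R]
    have h1 : q ^ m * (R - c * q) ≤ |R| * (|R| / c) ^ m := by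
      have : R - c * q ≤ |R| := by
        have := le_abs_self R
        have : 0 < c * q := by positivity
        linarith
      calc _ ≤ q ^ m * |R| := by gcongr
        _ ≤ (|R| / c) ^ m * |R| := by gcongr
        _ = _ := by ring
    calc _ ≤ Real.exp (|R| * (|R| / c) ^ m) * (|R| / c) ^ N := by gcongr
      _ ≤ _ := le_add_of_nonneg_left (by positivity)

lemma vert_integrable {f : ℂ → ℂ} {a b : ℝ} {C : ℝ} (hab : a ≤ b)
    (hd : DifferentiableOn ℂ f {s | a ≤ s.re})
    (hb : ∀ s : ℂ, a ≤ s.re → ‖f s‖ ≤ C * (1 + s.im ^ 2)⁻¹) :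
    Integrable (fun η : ℝ => f (b + η * Complex.I)) := by
  refine (integrable_inv_one_add_sq.const_mul C).mono' ?_ (Eventually.of_forall fun η => ?_)
  · refine Continuous.aestronglyMeasurable ?_
    refine hd.continuousOn.comp_continuous (by fun_prop) fun η => ?_
    simpa using hab
  · simpa using hb (b + η * Complex.I) (by simpa using hab)

lemma contour_shift {f : ℂ → ℂ} {a b : ℝ} {C : ℝ} (hab : a ≤ b)
    (hd : DifferentiableOn ℂ f {s | a ≤ s.re})
    (hb : ∀ s : ℂ, a ≤ s.re → ‖f s‖ ≤ C * (1 + s.im ^ 2)⁻¹) :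
    ∫ η : ℝ, f (a + η * Complex.I) = ∫ η : ℝ, f (b + η * Complex.I) := by
  have hC : 0 ≤ C := by
    have := (norm_nonneg _).trans (hb a (by simp))
    simpa using this
  have hrect : ∀ T : ℝ, (∫ x : ℝ in a..b, f (x + (-T : ℝ) * Complex.I)) -
      (∫ x : ℝ in a..b, f (x + (T : ℝ) * Complex.I)) +
      Complex.I * (∫ y : ℝ in (-T)..T, f (b + y * Complex.I)) -
      Complex.I * (∫ y : ℝ in (-T)..T, f (a + y * Complex.I)) = 0 := by
    intro T
    have := Complex.integral_boundary_rect_eq_zero_of_differentiableOn f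
      (a + (-T : ℝ) * Complex.I) (b + (T : ℝ) * Complex.I) (hd.mono ?_)
    · simpa using this
    · intro s hs
      rw [Complex.mem_reProdIm] at hs
      have := hs.1
      simp at this
      rw [uIcc_of_le hab] at this
      exact this.1
  have hlim : ∀ σ : ℝ → ℝ, (∀ T, σ T ^ 2 = T ^ 2) →
      Tendsto (fun T : ℝ => ∫ x : ℝ in a..b, f (x + (σ T : ℝ) * Complex.I)) atTop (𝓝 0) := by
    intro σ hσ
    have h1 : ∀ T : ℝ, ‖∫ x : ℝ in a..b, f (x + (σ T : ℝ) * Complex.I)‖ ≤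
        C * (1 + T ^ 2)⁻¹ * |b - a| := by
      intro T
      refine intervalIntegral.norm_integral_le_of_norm_le_const fun x hx => ?_
      rw [uIoc_of_le hab] at hx
      have := hb (x + (σ T : ℝ) * Complex.I) (by simpa using hx.1.le)
      simpa [hσ] using this
    refine squeeze_zero_norm h1 ?_
    have h2 : Tendsto (fun T : ℝ => (1 + T ^ 2)⁻¹) atTop (𝓝 0) :=
      tendsto_inv_atTop_zero.comp (tendsto_atTop_add_const_left _ _ (tendsto_pow_atTop (by norm_num)))
    simpa using (h2.const_mul C).mul_const |b - a|
  have hv : ∀ c : ℝ, a ≤ c → Tendsto (fun T : ℝ => ∫ y : ℝ in (-T)..T, f (c + y * Complex.I)) atTop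
      (𝓝 (∫ η : ℝ, f (c + η * Complex.I))) := fun c hc =>
    intervalIntegral_tendsto_integral (vert_integrable hc hd hb) tendsto_neg_atTop_atBot tendsto_id
  have htot := (((hlim (fun T => -T) (by simp)).sub (hlim (fun T => T) (by simp))).add
    ((hv b hab).const_mul Complex.I)).sub ((hv a le_rfl).const_mul Complex.I)
  have h0 := tendsto_nhds_unique (htot.congr hrect) tendsto_const_nhds
  have : Complex.I * (∫ η : ℝ, f (b + η * Complex.I)) -
    Complex.I * (∫ η : ℝ, f (a + η * Complex.I)) = 0 := by simpa using h0
  rw [← mul_sub] at this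
  rcases mul_eq_zero.1 this with h | h
  · exact absurd h Complex.I_ne_zero
  · exact (sub_eq_zero.1 h).symm

lemma contour_vanish {f : ℂ → ℂ} {a y : ℝ} {C : ℝ} (hy : 0 < y) (ha : 0 ≤ a)
    (hd : DifferentiableOn ℂ f {s | a ≤ s.re})
    (hb : ∀ s : ℂ, a ≤ s.re → ‖f s‖ ≤ Real.exp (-(y * s.re)) * (C * (1 + s.im ^ 2)⁻¹)) :
    ∫ η : ℝ, f (a + η * Complex.I) = 0 := by
  have hC : 0 ≤ C := by
    have := (norm_nonneg _).trans (hb a (by simp))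
    have := (mul_nonneg_iff_of_pos_left (Real.exp_pos _)).1 this
    simpa using this
  have hb' : ∀ s : ℂ, a ≤ s.re → ‖f s‖ ≤ C * (1 + s.im ^ 2)⁻¹ := by
    intro s hs
    refine (hb s hs).trans (mul_le_of_le_one_left (by positivity) ?_)
    rw [Real.exp_le_one_iff]
    have : 0 ≤ s.re := ha.trans hs
    nlinarith [mul_nonneg hy.le this]
  have h1 : ∀ b : ℝ, a ≤ b → ‖∫ η : ℝ, f (a + η * Complex.I)‖ ≤ Real.exp (-(y * b)) * (C * Real.pi) := by
    intro b hab
    rw [contour_shift hab hd hb']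
    have h2 : ‖∫ η : ℝ, f (b + η * Complex.I)‖ ≤
        ∫ η : ℝ, Real.exp (-(y * b)) * (C * (1 + η ^ 2)⁻¹) := by
      refine norm_integral_le_of_norm_le ((integrable_inv_one_add_sq.const_mul C).const_mul _)
        (Eventually.of_forall fun η => ?_)
      simpa using hb (b + η * Complex.I) (by simpa using hab)
    rwa [integral_const_mul, integral_const_mul, integral_univ_inv_one_add_sq] at h2
  have h3 : Tendsto (fun b : ℝ => Real.exp (-(y * b)) * (C * Real.pi)) atTop (𝓝 0) := by
    have : Tendsto (fun b : ℝ => Real.exp (-(y * b))) atTop (𝓝 0) :=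
      Real.tendsto_exp_neg_atTop_nhds_zero.comp (tendsto_id.const_mul_atTop hy)
    simpa using this.mul_const (C * Real.pi)
  have h4 : ‖∫ η : ℝ, f (a + η * Complex.I)‖ ≤ 0 := by
    refine ge_of_tendsto h3 ?_
    filter_upwards [eventually_ge_atTop a] with b hb
    exact h1 b hb
  exact norm_le_zero_iff.1 h4

end

open scoped BigOperators
noncomputable section

open Set Filter Topology MeasureTheory Metric TopologicalSpace

variable {d : ℕ}

/-- data for the construction of null solutions -/
structure Dat (P : MvPolynomial (Fin d) ℂ) (N ξ : EE d) (μ e : ℕ) (a : ℂ) (M : ℝ) : Prop where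
  μ1 : 1 ≤ μ
  a0 : a ≠ 0
  M1 : 1 ≤ M
  asy : ∀ p ω : ℂ, M ≤ ‖p‖ → ‖ω‖ = 1 →
      ‖MvPolynomial.eval (zz N ξ μ p ω) P - a * p ^ e * ω ^ μ‖ ≤ 1 / 2 * (‖a‖ * ‖p‖ ^ e)
  nN : ‖N‖ = 1
  nξ : ‖ξ‖ = 1
  orth : inner ℝ N ξ = 0

variable {P : MvPolynomial (Fin d) ℂ} {N ξ : EE d} {μ e : ℕ} {a : ℂ} {M : ℝ}

/-- the kernel -/
def KK (P : MvPolynomial (Fin d) ℂ) (N ξ : EE d) (μ : ℕ) (s ω : ℂ) : ℂ :=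
  Complex.exp (-(rt μ s) ^ (2 * μ + 1)) * (ω ^ μ / MvPolynomial.eval (zz N ξ μ (rt μ s) ω) P)

lemma Dat.M_le (h : Dat P N ξ μ e a M) {s : ℂ} (hs : M ^ (2 * μ + 2) ≤ s.re) : M ≤ ‖rt μ s‖ := by
  have hM := h.M1
  have hpos : 0 < s.re := lt_of_lt_of_le (by positivity) hs
  have hs0 : s ≠ 0 := fun h => by simp [h] at hpos
  have : M ^ (2 * μ + 2) ≤ ‖rt μ s‖ ^ (2 * μ + 2) := by
    rw [norm_rt_pow μ hs0]
    exact hs.trans ((le_abs_self _).trans (Complex.abs_re_le_norm s))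
  exact le_of_pow_le_pow_left₀ (by omega) (norm_nonneg _) this

lemma Dat.re_pos (h : Dat P N ξ μ e a M) {s : ℂ} (hs : M ^ (2 * μ + 2) ≤ s.re) : 0 < s.re := by
  have hM := h.M1
  exact lt_of_lt_of_le (by positivity) hs

lemma Dat.F_ge (h : Dat P N ξ μ e a M) {p ω : ℂ} (hp : M ≤ ‖p‖) (hω : ‖ω‖ = 1) :
    ‖a‖ / 2 ≤ ‖MvPolynomial.eval (zz N ξ μ p ω) P‖ := by
  have h1 := h.asy p ω hp hω
  have h2 : ‖a * p ^ e * ω ^ μ‖ = ‖a‖ * ‖p‖ ^ e := by simp [hω]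
  have h3 := norm_sub_norm_le (a * p ^ e * ω ^ μ) (MvPolynomial.eval (zz N ξ μ p ω) P)
  rw [norm_sub_rev, h2] at h3
  have h4 : 1 ≤ ‖p‖ ^ e := one_le_pow₀ (h.M1.trans hp)
  have := norm_nonneg a
  nlinarith

lemma Dat.F_ne (h : Dat P N ξ μ e a M) {p ω : ℂ} (hp : M ≤ ‖p‖) (hω : ‖ω‖ = 1) :
    MvPolynomial.eval (zz N ξ μ p ω) P ≠ 0 := by
  intro h0
  have := h.F_ge hp hω
  rw [h0, norm_zero] at this
  have : 0 < ‖a‖ := norm_pos_iff.2 h.a0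
  linarith

lemma Dat.KK_le (h : Dat P N ξ μ e a M) {s ω : ℂ} (hs : M ^ (2 * μ + 2) ≤ s.re) (hω : ‖ω‖ = 1) :
    ‖KK P N ξ μ s ω‖ ≤ 2 / ‖a‖ * Real.exp (-(cc μ * ‖rt μ s‖ ^ (2 * μ + 1))) := by
  unfold KK
  have ha : 0 < ‖a‖ := norm_pos_iff.2 h.a0
  rw [norm_mul, norm_div, norm_pow, hω, one_pow, mul_comm, Complex.norm_exp]
  have h1 := h.F_ge (h.M_le hs) hω
  refine mul_le_mul ?_ (Real.exp_le_exp.2 ?_) (Real.exp_nonneg _) (by positivity)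
  · rw [div_le_div_iff₀ (by linarith) ha]; linarith
  · rw [Complex.neg_re]
    exact neg_le_neg (re_rt μ (h.re_pos hs))

lemma Dat.decay (h : Dat P N ξ μ e a M) (R : ℝ) (n : ℕ) : ∃ C : ℝ, 0 ≤ C ∧ ∀ s ω : ℂ,
    M ^ (2 * μ + 2) ≤ s.re → ‖ω‖ = 1 →
    Real.exp (R * ‖rt μ s‖ ^ (2 * μ)) * ‖rt μ s‖ ^ n * ‖KK P N ξ μ s ω‖ ≤ C * (1 + s.im ^ 2)⁻¹ := by
  obtain ⟨C, hC, hb⟩ := exp_poly_bound R (cc_pos μ) (2 * μ) (n + 2 * (2 * μ + 2))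
  have ha : 0 < ‖a‖ := norm_pos_iff.2 h.a0
  refine ⟨2 * (2 / ‖a‖ * C), by positivity, fun s ω hs hω => ?_⟩
  have h1 := h.KK_le hs hω
  have hs0 : s ≠ 0 := fun h' => by
    have := h.re_pos hs
    simp [h'] at this
  have hn := norm_rt_pow μ hs0
  have hM := h.M_le hs
  set q := ‖rt μ s‖ with hq
  have hq1 : 1 ≤ q := h.M1.trans hM
  have h2 := hb q hq1
  rw [← div_eq_mul_inv, le_div_iff₀ (by positivity)]
  have h3 : 1 + s.im ^ 2 ≤ 2 * q ^ (2 * (2 * μ + 2)) := by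
    have e1 : q ^ (2 * (2 * μ + 2)) = ‖s‖ ^ 2 := by rw [← hn, ← pow_mul]; congr 1; ring
    have e2 : 1 ≤ q ^ (2 * (2 * μ + 2)) := one_le_pow₀ hq1
    have e3 : s.im ^ 2 ≤ ‖s‖ ^ 2 := by
      rw [← sq_abs s.im]
      gcongr
      exact Complex.abs_im_le_norm s
    linarith
  calc _ ≤ Real.exp (R * q ^ (2 * μ)) * q ^ n *
        (2 / ‖a‖ * Real.exp (-(cc μ * q ^ (2 * μ + 1)))) * (2 * q ^ (2 * (2 * μ + 2))) := by gcongr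
    _ = 2 * (2 / ‖a‖ * (Real.exp (R * q ^ (2 * μ) - cc μ * q ^ (2 * μ + 1)) *
        q ^ (n + 2 * (2 * μ + 2)))) := by
      rw [sub_eq_add_neg, Real.exp_add, pow_add]; ring
    _ ≤ _ := by gcongr

lemma cex_zz (x : EE d) (p ω : ℂ) : cex (zz N ξ μ p ω) x =
    Complex.exp (-(p ^ (2 * μ + 2) * (inner ℝ x N : ℝ) + p ^ (2 * μ) * ω * (inner ℝ x ξ : ℝ))) := by
  unfold cex zz
  congr 2
  simp only [PiLp.inner_apply, Complex.ofReal_sum, Finset.mul_sum, ← Finset.sum_add_distrib]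
  refine Finset.sum_congr rfl fun i _ => ?_
  simp
  ring

/-- the measure -/
def nu : Measure (ℝ × ℝ) := (volume : Measure ℝ).prod (volume.restrict (Ioc 0 (2 * Real.pi)))

/-- point of the vertical line -/
def sv (σ η : ℝ) : ℂ := σ + η * Complex.I
/-- point of the circle -/
def om (φ : ℝ) : ℂ := Complex.exp (φ * Complex.I)

@[simp] lemma sv_re (σ η : ℝ) : (sv σ η).re = σ := by simp [sv]
@[simp] lemma sv_im (σ η : ℝ) : (sv σ η).im = η := by simp [sv]
@[simp] lemma norm_om (φ : ℝ) : ‖om φ‖ = 1 := by simp [om, Complex.norm_exp_ofReal_mul_I]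

lemma om_cont : Continuous om := by unfold om; fun_prop
lemma sv_cont (σ : ℝ) : Continuous (sv σ) := by unfold sv; fun_prop

/-- covectors on the contour -/
def zc (N ξ : EE d) (μ : ℕ) (M : ℝ) (t : ℝ × ℝ) : Fin d → ℂ :=
  zz N ξ μ (rt μ (sv (M ^ (2 * μ + 2)) t.1)) (om t.2)
/-- kernel on the contour -/
def Kc (P : MvPolynomial (Fin d) ℂ) (N ξ : EE d) (μ : ℕ) (M : ℝ) (t : ℝ × ℝ) : ℂ :=
  KK P N ξ μ (sv (M ^ (2 * μ + 2)) t.1) (om t.2)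

lemma Dat.rt_cont (h : Dat P N ξ μ e a M) :
    Continuous fun η : ℝ => rt μ (sv (M ^ (2 * μ + 2)) η) := by
  rw [continuous_iff_continuousAt]
  intro η
  have : ContinuousAt (rt μ) (sv (M ^ (2 * μ + 2)) η) :=
    (rt_diff μ (h.re_pos (by simp))).continuousAt
  exact ContinuousAt.comp (f := sv (M ^ (2 * μ + 2))) this (sv_cont _).continuousAt

lemma Dat.zc_cont (h : Dat P N ξ μ e a M) : Continuous (zc N ξ μ M) := by
  have h1 := h.rt_cont.comp (continuous_fst (X := ℝ) (Y := ℝ))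
  have h2 := om_cont.comp (continuous_snd (X := ℝ) (Y := ℝ))
  refine continuous_pi fun i => ?_
  unfold zc zz
  exact ((h1.pow _).mul continuous_const).add (((h1.pow _).mul h2).mul continuous_const)

lemma Dat.Kc_cont (h : Dat P N ξ μ e a M) : Continuous (Kc P N ξ μ M) := by
  have h1 := h.rt_cont.comp (continuous_fst (X := ℝ) (Y := ℝ))
  have h2 := om_cont.comp (continuous_snd (X := ℝ) (Y := ℝ))
  unfold Kc KK
  refine Continuous.mul (Complex.continuous_exp.comp (h1.pow _).neg) ((h2.pow _).div ?_ ?_)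
  · exact (MvPolynomial.continuous_eval P).comp h.zc_cont
  · intro t
    exact h.F_ne (h.M_le (by simp)) (by simp)

lemma integrable_nu (C : ℝ) : Integrable (fun t : ℝ × ℝ => C * (1 + t.1 ^ 2)⁻¹) nu :=
  (integrable_inv_one_add_sq.const_mul C).comp_fst _

lemma Dat.FL (h : Dat P N ξ μ e a M) : FL nu (zc N ξ μ M) (Kc P N ξ μ M)
    (fun t => M ^ (2 * μ + 2) + ‖rt μ (sv (M ^ (2 * μ + 2)) t.1)‖ ^ (2 * μ))
    (fun t => 2 * ‖rt μ (sv (M ^ (2 * μ + 2)) t.1)‖ ^ (2 * μ + 2)) where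
  mz i := ((continuous_apply i).comp h.zc_cont).aestronglyMeasurable
  mK := h.Kc_cont.aestronglyMeasurable
  pos t := by positivity
  re t i := by
    have hM := h.M1
    unfold zc zz
    have hs0 : sv (M ^ (2 * μ + 2)) t.1 ≠ 0 := fun h' => by
      have := h.re_pos (s := sv (M ^ (2 * μ + 2)) t.1) (by simp)
      rw [h'] at this; simp at this
    rw [rt_pow μ hs0, Complex.add_re, Complex.re_mul_ofReal, sv_re]
    refine (abs_add_le _ _).trans (add_le_add ?_ ?_)
    · rw [abs_mul, abs_of_pos (by positivity)]
      refine mul_le_of_le_one_right (by positivity) ?_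
      rw [← h.nN]; simpa using PiLp.norm_apply_le N i
    · refine (Complex.abs_re_le_norm _).trans ?_
      rw [norm_mul, norm_mul, norm_pow, norm_om, mul_one]
      refine mul_le_of_le_one_right (by positivity) ?_
      rw [← h.nξ]; simpa using PiLp.norm_apply_le ξ i
  nrm t i := by
    have hM := h.M_le (s := sv (M ^ (2 * μ + 2)) t.1) (by simp)
    have hq := h.M1.trans hM
    unfold zc zz
    set q := ‖rt μ (sv (M ^ (2 * μ + 2)) t.1)‖ with hqd
    have h1 : |N i| ≤ 1 := by rw [← h.nN]; simpa using PiLp.norm_apply_le N i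
    have h2 : |ξ i| ≤ 1 := by rw [← h.nξ]; simpa using PiLp.norm_apply_le ξ i
    refine (norm_add_le _ _).trans ?_
    simp only [norm_mul, norm_pow, norm_om, mul_one, ← hqd, Complex.norm_real, Real.norm_eq_abs]
    have h3 : q ^ (2 * μ) ≤ q ^ (2 * μ + 2) := pow_le_pow_right₀ hq (by omega)
    have h4 : 0 ≤ q ^ (2 * μ) := by positivity
    nlinarith [mul_le_of_le_one_right h4 h2, mul_le_of_le_one_right (h4.trans h3) h1]
  int R n := by
    obtain ⟨C, hC, hb⟩ := h.decay R ((2 * μ + 2) * n)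
    refine (integrable_nu (Real.exp (R * M ^ (2 * μ + 2)) * 2 ^ n * C)).mono' ?_
      (Eventually.of_forall fun t => ?_)
    · have h1 := h.rt_cont.comp (continuous_fst (X := ℝ) (Y := ℝ))
      refine Continuous.aestronglyMeasurable ?_
      refine ((Real.continuous_exp.comp ?_).mul (Continuous.pow ?_ _)).mul h.Kc_cont.norm
      · exact continuous_const.mul (continuous_const.add (h1.norm.pow _))
      · exact continuous_const.mul (h1.norm.pow _)
    · have := hb (sv (M ^ (2 * μ + 2)) t.1) (om t.2) (by simp) (by simp)
      rw [Real.norm_of_nonneg (by positivity), mul_add, Real.exp_add, mul_pow, ← pow_mul]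
      rw [sv_im] at this
      have h0 : 0 ≤ Real.exp (R * M ^ (2 * μ + 2)) * 2 ^ n := by positivity
      have := mul_le_mul_of_nonneg_left this h0
      unfold Kc
      linarith

end

open scoped BigOperators
noncomputable section

open Set Filter Topology MeasureTheory Metric TopologicalSpace

variable {d : ℕ}
variable {P : MvPolynomial (Fin d) ℂ} {N ξ : EE d} {μ e : ℕ} {a : ℂ} {M : ℝ}

/-- the null solution -/
def Un (P : MvPolynomial (Fin d) ℂ) (N ξ : EE d) (μ : ℕ) (M : ℝ) : EE d → ℂ :=
  GG nu (zc N ξ μ M) (Kc P N ξ μ M) []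

lemma Un_eq (x : EE d) : Un P N ξ μ M x = ∫ t, cex (zc N ξ μ M t) x * Kc P N ξ μ M t ∂nu := by
  simp [Un, GG]

lemma circ_zero (B : ℂ) {μ : ℕ} (hμ : 1 ≤ μ) :
    ∫ φ in Ioc 0 (2 * Real.pi), Complex.exp (B * om φ) * om φ ^ μ = 0 := by
  have h1 : ∮ z in C(0, 1), Complex.exp (B * z) * z ^ (μ - 1) = 0 := by
    apply DiffContOnCl.circleIntegral_eq_zero zero_le_one
    exact Differentiable.diffContOnCl (by fun_prop)
  rw [circleIntegral, intervalIntegral.integral_of_le (by positivity)] at h1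
  have h2 : ∀ φ : ℝ, deriv (circleMap 0 1) φ • (Complex.exp (B * circleMap 0 1 φ) *
      circleMap 0 1 φ ^ (μ - 1)) = Complex.I * (Complex.exp (B * om φ) * om φ ^ μ) := by
    intro φ
    have : circleMap 0 1 φ = om φ := by simp [circleMap, om]
    rw [deriv_circleMap, this, smul_eq_mul]
    obtain ⟨k, rfl⟩ : ∃ k, μ = k + 1 := ⟨μ - 1, by omega⟩
    simp only [Nat.add_sub_cancel]
    ring
  simp_rw [h2] at h1
  rw [integral_const_mul] at h1
  exact (mul_eq_zero.1 h1).resolve_left Complex.I_ne_zero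

lemma Dat.Q_zero (h : Dat P N ξ μ e a M) (x : EE d) : Qop P (Un P N ξ μ M) x = 0 := by
  unfold Un
  rw [h.FL.Qop P x]
  by_cases hi : Integrable (fun t => cex (zc N ξ μ M t) x *
    (MvPolynomial.eval (zc N ξ μ M t) P * Kc P N ξ μ M t)) nu
  · unfold nu at hi ⊢
    rw [integral_prod _ hi]
    refine integral_eq_zero_of_ae (Eventually.of_forall fun η => ?_)
    simp only [Pi.zero_apply]
    set p := rt μ (sv (M ^ (2 * μ + 2)) η) with hp
    have h1 : ∀ φ : ℝ, cex (zc N ξ μ M (η, φ)) x *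
        (MvPolynomial.eval (zc N ξ μ M (η, φ)) P * Kc P N ξ μ M (η, φ)) =
        (Complex.exp (-(p ^ (2 * μ + 2) * (inner ℝ x N : ℝ))) * Complex.exp (-p ^ (2 * μ + 1))) *
        (Complex.exp (-(p ^ (2 * μ) * (inner ℝ x ξ : ℝ)) * om φ) * om φ ^ μ) := by
      intro φ
      have hF : MvPolynomial.eval (zz N ξ μ p (om φ)) P ≠ 0 := h.F_ne (h.M_le (by simp)) (by simp)
      unfold zc Kc KK
      simp only [← hp]
      rw [cex_zz, neg_add, Complex.exp_add,
        show -(p ^ (2 * μ) * (inner ℝ x ξ : ℝ)) * om φ = -(p ^ (2 * μ) * om φ * (inner ℝ x ξ : ℝ)) by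
          ring]
      field_simp
    simp_rw [h1]
    rw [integral_const_mul, circ_zero _ h.μ1, mul_zero]
  · exact integral_undef hi

lemma Dat.vanish (h : Dat P N ξ μ e a M) {x : EE d} (hx : 0 < (inner ℝ x N : ℝ)) :
    Un P N ξ μ M x = 0 := by
  rw [Un_eq]
  have hi := h.FL.integrable [] x
  simp only [List.map_nil, List.prod_nil, one_mul] at hi
  unfold nu at hi ⊢
  rw [integral_prod_symm _ hi]
  refine integral_eq_zero_of_ae (Eventually.of_forall fun φ => ?_)
  simp only [Pi.zero_apply]
  have hM := h.M1
  obtain ⟨C, hC, hb⟩ := h.decay ‖x‖ 0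
  have key := contour_vanish (f := fun s => cex (zz N ξ μ (rt μ s) (om φ)) x * KK P N ξ μ s (om φ))
    (a := M ^ (2 * μ + 2)) (C := C) hx (by positivity) ?_ ?_
  · exact key
  · intro s hs
    refine DifferentiableAt.differentiableWithinAt ?_
    have h1 := rt_diff μ (h.re_pos hs)
    have h2 : DifferentiableAt ℂ (fun s => MvPolynomial.eval (zz N ξ μ (rt μ s) (om φ)) P) s := by
      simp only [MvPolynomial.eval_eq', zz]
      fun_prop
    have h3 := h.F_ne (h.M_le hs) (norm_om φ)
    unfold KK
    simp only [cex_zz]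
    refine DifferentiableAt.mul (by fun_prop) (DifferentiableAt.mul (by fun_prop)
      (DifferentiableAt.div (by fun_prop) h2 h3))
  · intro s hs
    have hs0 : s ≠ 0 := fun h' => by
      have := h.re_pos hs
      simp [h'] at this
    have h4 := hb s (om φ) hs (norm_om φ)
    rw [pow_zero, mul_one] at h4
    rw [norm_mul]
    have h5 : ‖cex (zz N ξ μ (rt μ s) (om φ)) x‖ ≤ Real.exp (-((inner ℝ x N : ℝ) * s.re)) *
        Real.exp (‖x‖ * ‖rt μ s‖ ^ (2 * μ)) := by
      rw [cex_zz, rt_pow μ hs0, Complex.norm_exp, ← Real.exp_add]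
      apply Real.exp_le_exp.2
      rw [Complex.neg_re, Complex.add_re, Complex.re_mul_ofReal, neg_add]
      have h6 : -(rt μ s ^ (2 * μ) * om φ * (inner ℝ x ξ : ℝ)).re ≤ ‖x‖ * ‖rt μ s‖ ^ (2 * μ) := by
        refine (neg_le_abs _).trans ((Complex.abs_re_le_norm _).trans ?_)
        rw [norm_mul, norm_mul, norm_pow, norm_om, mul_one, mul_comm, Complex.norm_real]
        have := norm_inner_le_norm (𝕜 := ℝ) x ξ
        rw [h.nξ, mul_one] at this
        gcongr
      linarith
    calc _ ≤ Real.exp (-((inner ℝ x N : ℝ) * s.re)) *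
        Real.exp (‖x‖ * ‖rt μ s‖ ^ (2 * μ)) * ‖KK P N ξ μ s (om φ)‖ := by gcongr
      _ = Real.exp (-((inner ℝ x N : ℝ) * s.re)) *
        (Real.exp (‖x‖ * ‖rt μ s‖ ^ (2 * μ)) * ‖KK P N ξ μ s (om φ)‖) := by ring
      _ ≤ _ := by gcongr

/-- The angular integral of the kernel -/
def Gang (P : MvPolynomial (Fin d) ℂ) (N ξ : EE d) (μ : ℕ) (M : ℝ) (η : ℝ) : ℂ :=
  ∫ φ in Ioc 0 (2 * Real.pi), Kc P N ξ μ M (η, φ)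

lemma Dat.Gang_ne (h : Dat P N ξ μ e a M) (η : ℝ) : Gang P N ξ μ M η ≠ 0 := by
  set p := rt μ (sv (M ^ (2 * μ + 2)) η) with hp
  have hpM : M ≤ ‖p‖ := h.M_le (by simp)
  have hp0 : p ≠ 0 := by
    intro h0
    have := h.M1.trans hpM
    rw [h0] at this; norm_num at this
  set A : ℂ := Complex.exp (-p ^ (2 * μ + 1)) / (a * p ^ e) with hA
  have hA0 : A ≠ 0 := div_ne_zero (Complex.exp_ne_zero _) (mul_ne_zero h.a0 (pow_ne_zero _ hp0))
  set g : ℝ → ℂ := fun φ => a * p ^ e * om φ ^ μ / MvPolynomial.eval (zz N ξ μ p (om φ)) P with hg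
  have hgc : Continuous g := by
    have h2 := om_cont
    refine Continuous.div (by fun_prop) ?_ fun φ => h.F_ne hpM (by simp)
    refine (MvPolynomial.continuous_eval P).comp (continuous_pi fun i => ?_)
    unfold zz
    fun_prop
  have h1 : Gang P N ξ μ M η = A * ∫ φ in Ioc 0 (2 * Real.pi), g φ := by
    unfold Gang
    rw [← integral_const_mul]
    congr 1
    funext φ
    have ha := h.a0
    have hF : MvPolynomial.eval (zz N ξ μ p (om φ)) P ≠ 0 := h.F_ne hpM (by simp)
    simp only [hA, hg, Kc, KK, ← hp]
    field_simp
  rw [h1]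
  refine mul_ne_zero hA0 ?_
  have hpos : ∀ φ, 0 < (g φ).re := by
    intro φ
    have hF : MvPolynomial.eval (zz N ξ μ p (om φ)) P ≠ 0 := h.F_ne hpM (by simp)
    set F := MvPolynomial.eval (zz N ξ μ p (om φ)) P with hFd
    have hB : ‖a * p ^ e * om φ ^ μ‖ = ‖a‖ * ‖p‖ ^ e := by simp
    have h2 := h.asy p (om φ) hpM (by simp)
    rw [← hFd, ← hB] at h2
    have hB0 : a * p ^ e * om φ ^ μ ≠ 0 := mul_ne_zero (mul_ne_zero h.a0 (pow_ne_zero _ hp0))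
      (pow_ne_zero _ (by intro h0; have := norm_om φ; rw [h0] at this; simp at this))
    set B := a * p ^ e * om φ ^ μ with hBd
    have hgB : g φ = (F / B)⁻¹ := by rw [inv_div]
    rw [hgB, Complex.inv_re]
    have h3 : ‖F / B - 1‖ ≤ 1 / 2 := by
      rw [div_sub_one hB0, norm_div, div_le_iff₀ (norm_pos_iff.2 hB0)]
      exact h2
    have h4 : 0 < (F / B).re := by
      have := (abs_le.1 ((Complex.abs_re_le_norm _).trans h3)).1
      simp at this
      linarith
    exact div_pos h4 (Complex.normSq_pos.2 (div_ne_zero hF hB0))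
  intro h0
  have h5 : (∫ φ in Ioc 0 (2 * Real.pi), (g φ).re) = 0 := by
    have hItg : Integrable g (volume.restrict (Ioc 0 (2 * Real.pi))) :=
      (hgc.integrableOn_Icc).mono_set Ioc_subset_Icc_self
    have := integral_re hItg
    rw [h0] at this
    simpa using this
  have h6 : 0 < ∫ φ in (0:ℝ)..(2 * Real.pi), (g φ).re := by
    refine intervalIntegral.intervalIntegral_pos_of_pos ?_ hpos (by positivity)
    exact (Complex.continuous_re.comp hgc).intervalIntegrable _ _
  rw [intervalIntegral.integral_of_le (by positivity), h5] at h6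
  exact lt_irrefl _ h6

lemma Dat.ne_zero (h : Dat P N ξ μ e a M) : ∃ x, Un P N ξ μ M x ≠ 0 := by
  by_contra hcon
  push Not at hcon
  have hcont : Continuous (Gang P N ξ μ M) := by
    have := intervalIntegral.continuous_parametric_intervalIntegral_of_continuous' (μ := volume)
      (f := fun η φ => Kc P N ξ μ M (η, φ)) (by simpa [Function.uncurry_def] using h.Kc_cont)
      0 (2 * Real.pi)
    refine this.congr fun η => ?_
    rw [intervalIntegral.integral_of_le (by positivity)]
    rfl
  have hint0 : Integrable (Kc P N ξ μ M) nu := by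
    have := h.FL.integrable [] 0
    simpa [cex] using this
  have hItg : Integrable (Gang P N ξ μ M) := hint0.integral_prod_left
  have hF : FourierTransform.fourier (Gang P N ξ μ M) = fun _ : ℝ => (0 : ℂ) := by
    funext y
    rw [Real.fourier_eq']
    have hU := hcon ((2 * Real.pi * y) • N)
    rw [Un_eq] at hU
    have hi := h.FL.integrable [] ((2 * Real.pi * y) • N)
    simp only [List.map_nil, List.prod_nil, one_mul] at hi
    unfold nu at hi hU
    rw [integral_prod _ hi] at hU
    have h1 : ∀ η : ℝ, (∫ φ in Ioc 0 (2 * Real.pi), cex (zc N ξ μ M (η, φ)) ((2 * Real.pi * y) • N) *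
        Kc P N ξ μ M (η, φ)) = Complex.exp (-((M ^ (2 * μ + 2) * (2 * Real.pi * y) : ℝ) : ℂ)) *
        (Complex.exp ((-2 * Real.pi * (inner ℝ η y) : ℝ) * Complex.I) • Gang P N ξ μ M η) := by
      intro η
      unfold Gang
      rw [smul_eq_mul, ← mul_assoc, ← integral_const_mul]
      congr 1
      funext φ
      congr 1
      unfold zc
      have hs0 : sv (M ^ (2 * μ + 2)) η ≠ 0 := fun h' => by
        have := h.re_pos (s := sv (M ^ (2 * μ + 2)) η) (by simp)
        rw [h'] at this; simp at this
      rw [cex_zz, rt_pow μ hs0, inner_smul_left, inner_smul_left, h.orth, real_inner_self_eq_norm_sq,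
        h.nN, ← Complex.exp_add]
      congr 1
      simp [sv]
      ring
    simp_rw [h1] at hU
    rw [integral_const_mul] at hU
    exact (mul_eq_zero.1 hU).resolve_left (Complex.exp_ne_zero _)
  have hinv := hcont.fourierInv_fourier_eq hItg (by rw [hF]; exact integrable_zero _ _ _)
  have h0 : Gang P N ξ μ M 0 = 0 := by
    rw [← hinv, hF, Real.fourierInv_eq']
    simp
  exact h.Gang_ne 0 h0

end

open scoped BigOperators
noncomputable section

open Set Filter Topology MeasureTheory Metric TopologicalSpace

variable {d : ℕ}
variable {P : MvPolynomial (Fin d) ℂ}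

lemma exists_orth (hd : 3 ≤ d) {N : EE d} (hN : ‖N‖ = 1) : ∃ ξ : EE d, ‖ξ‖ = 1 ∧ inner ℝ N ξ = 0 := by
  have h1 : (Submodule.span ℝ {N})ᗮ ≠ ⊥ := by
    intro h
    rw [Submodule.orthogonal_eq_bot_iff] at h
    have h2 : Module.finrank ℝ (Submodule.span ℝ {N}) = 1 :=
      finrank_span_singleton (by intro h0; rw [h0] at hN; simp at hN)
    rw [h, finrank_top, finrank_euclideanSpace_fin] at h2
    omega
  obtain ⟨ζ, hζ, hζ0⟩ := Submodule.exists_mem_ne_zero_of_ne_bot h1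
  refine ⟨‖ζ‖⁻¹ • ζ, ?_, ?_⟩
  · rw [norm_smul, norm_inv, norm_norm, inv_mul_cancel₀ (norm_ne_zero_iff.2 hζ0)]
  · rw [inner_smul_right, Submodule.mem_orthogonal_singleton_iff_inner_right.1 hζ, mul_zero]

lemma leafset_preconn (v : EE d) (c : ℝ) : IsPreconnected {x : EE d | inner ℝ x v = c} := by
  apply Convex.isPreconnected
  intro x hx y hy a b ha hb hab
  simp only [mem_setOf_eq, inner_add_left, inner_smul_left] at hx hy ⊢
  rw [hx, hy]
  simp [← add_mul, hab]

lemma leaf_full {v : EE d} (hyp : Hyp P v) {u : EE d → ℂ}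
    (hu : ContDiff ℝ (⊤ : ℕ∞) u) (hQ : ∀ x, Qop P u x = 0) {a y : EE d}
    (hay : (inner ℝ y v : ℝ) = inner ℝ a v) (hua : u =ᶠ[𝓝 a] fun _ => 0) : u =ᶠ[𝓝 y] fun _ => 0 :=
  leaf_uc hyp hu (leafset_preconn v (inner ℝ a v)) (fun _ h => h)
    (fun x _ => Eventually.of_forall hQ) rfl hua y hay

theorem null_solution {v : EE d} (hyp : Hyp P v) (hd : 3 ≤ d) {N : EE d} (hN : N = v ∨ N = -v) :
    ∃ U : EE d → ℂ, ContDiff ℝ (⊤ : ℕ∞) U ∧ (∀ x, Qop P U x = 0) ∧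
      (∀ x : EE d, 0 < (inner ℝ x N : ℝ) → U x = 0) ∧ (0 : EE d) ∈ tsupport U := by
  have hNn : ‖N‖ = 1 := by rcases hN with rfl | rfl <;> simp [hyp.nv]
  have hNv : ∃ s : ℝ, N = s • v := by
    rcases hN with rfl | rfl
    · exact ⟨1, by simp⟩
    · exact ⟨-1, by simp⟩
  have hvN : ∃ s : ℝ, v = s • N := by
    rcases hN with rfl | rfl
    · exact ⟨1, by simp⟩
    · exact ⟨-1, by simp⟩
  obtain ⟨ξ, hξ1, hξN⟩ := exists_orth hd hNn
  have hnot : ¬ ∃ s : ℝ, N + ξ = s • v := by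
    rintro ⟨s, hs⟩
    obtain ⟨s', hs'⟩ := hvN
    have h1 : inner ℝ ξ (N + ξ) = (1 : ℝ) := by
      rw [inner_add_right, real_inner_comm, hξN, real_inner_self_eq_norm_sq, hξ1]; norm_num
    rw [hs, hs', inner_smul_right, inner_smul_right, real_inner_comm, hξN] at h1
    norm_num at h1
  obtain ⟨μ, e, a, M, h1, h2, h3, h4⟩ := sym_asymp hyp hNv hnot
  have D : Dat P N ξ μ e a M := ⟨h1, h2, h3, h4, hNn, hξ1, hξN⟩
  set U := Un P N ξ μ M with hU
  have hUc : ContDiff ℝ (⊤ : ℕ∞) U := D.FL.contDiff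
  have hQ : ∀ x, Qop P U x = 0 := D.Q_zero
  obtain ⟨x0, hx0⟩ := D.ne_zero
  have leaf : ∀ a y : EE d, (inner ℝ y N : ℝ) = inner ℝ a N → U =ᶠ[𝓝 a] (fun _ => 0) →
      U =ᶠ[𝓝 y] fun _ => 0 := by
    intro a y hay hua
    obtain ⟨s', hs'⟩ := hvN
    refine leaf_full hyp hUc hQ ?_ hua
    rw [hs', inner_smul_right, inner_smul_right, hay]
  set S : Set ℝ := {t | t • N ∈ tsupport U} with hS
  have hNN : ∀ t : ℝ, (inner ℝ (t • N) N : ℝ) = t := fun t => by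
    rw [inner_smul_left, real_inner_self_eq_norm_sq, hNn]; simp
  have hnotS : ∀ t, t ∉ S → U =ᶠ[𝓝 (t • N)] fun _ => 0 := fun t ht =>
    notMem_tsupport_iff_eventuallyEq.1 ht
  have hScl : IsClosed S := (isClosed_tsupport U).preimage (by fun_prop)
  have hSne : S.Nonempty := by
    refine ⟨inner ℝ x0 N, ?_⟩
    by_contra hcon
    exact hx0 (leaf _ x0 (hNN _).symm (hnotS _ hcon)).eq_of_nhds
  have hSb : BddAbove S := by
    refine ⟨0, fun t ht => ?_⟩
    by_contra hcon
    push Not at hcon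
    refine (notMem_tsupport_iff_eventuallyEq.2 ?_) ht
    have hopen : IsOpen {x : EE d | 0 < (inner ℝ x N : ℝ)} :=
      isOpen_lt continuous_const (by fun_prop)
    filter_upwards [hopen.mem_nhds (show t • N ∈ {x : EE d | 0 < (inner ℝ x N : ℝ)} by
      rw [mem_setOf_eq, hNN]; exact hcon)] with y hy
    exact D.vanish hy
  have hmem := hScl.csSup_mem hSne hSb
  set t1 := sSup S with ht1
  refine ⟨fun x => U (x - (-(t1 • N))), hUc.comp (by fun_prop), fun x => ?_, fun x hx => ?_, ?_⟩
  · simp only [Qop, wd_comp_sub]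
    exact hQ _
  · have hgt : t1 < inner ℝ (x + t1 • N) N := by
      rw [inner_add_left, hNN]; linarith
    have hns : (inner ℝ (x + t1 • N) N : ℝ) ∉ S := fun hmem' =>
      absurd (le_csSup hSb hmem') (not_le.2 hgt)
    have := (leaf _ (x + t1 • N) (hNN _).symm (hnotS _ hns)).eq_of_nhds
    simpa using this
  · by_contra hcon
    have hc := notMem_tsupport_iff_eventuallyEq.1 hcon
    refine (notMem_tsupport_iff_eventuallyEq.2 ?_) hmem
    have ht : Tendsto (fun y : EE d => y - t1 • N) (𝓝 (t1 • N)) (𝓝 0) := by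
      have : Continuous (fun y : EE d => y - t1 • N) := by fun_prop
      simpa using this.tendsto (t1 • N)
    filter_upwards [ht.eventually hc] with y hy
    simpa using hy

end

open scoped BigOperators
noncomputable section

open Set Filter Topology MeasureTheory Metric TopologicalSpace

variable {d : ℕ}
variable {P : MvPolynomial (Fin d) ℂ}

/-- coordinate along `z` -/
def tau (N z y0 y : EE d) : ℝ := (inner ℝ (y - y0) N : ℝ) / (inner ℝ z N : ℝ)

lemma tau_contDiff (N z y0 : EE d) : ContDiff ℝ (⊤ : ℕ∞) (tau N z y0) := by
  unfold tau
  exact ((contDiff_id.sub contDiff_const).inner ℝ contDiff_const).div_const _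

lemma tau_line {N z y0 y : EE d} (hz : 0 < (inner ℝ z N : ℝ)) (h : (inner ℝ y N : ℝ) = inner ℝ y0 N)
    (t : ℝ) : tau N z y0 (y + t • z) = t := by
  unfold tau
  rw [inner_sub_left, inner_add_left, inner_smul_left, h]
  simp
  field_simp

lemma tau_proj {N z y0 y : EE d} (hz : 0 < (inner ℝ z N : ℝ)) :
    (inner ℝ (y - tau N z y0 y • z) N : ℝ) = inner ℝ y0 N := by
  unfold tau
  rw [inner_sub_left, inner_smul_left, inner_sub_left]
  simp
  field_simp
  ring

lemma minprin_aux {v : EE d} (hyp : Hyp P v) (hd : 3 ≤ d) {N : EE d} (hN : N = v ∨ N = -v)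
    {X : Set (EE d)} (hX : IsOpen X) (hs : PSurj P X) {F O : Set (EE d)} (hF : IsCompact F)
    (hFX : F ⊆ X) (hO : IsOpen O) {c : ℝ} (hFc : ∀ y ∈ F, inner ℝ y N = c)
    (hOF : ∀ y, inner ℝ y N = c → y ∈ O → y ∈ F) {z : EE d} (hz : 0 < (inner ℝ z N : ℝ))
    (hb : ∀ y ∈ F, y ∉ O → ∀ s ∈ Icc (0:ℝ) 1, y + s • z ∈ X) {p : EE d} (hp : p ∈ F)
    (hpz : p + z ∉ X) : False := by
  -- minimal parameter
  set g : ℝ × EE d → EE d := fun q => q.2 + q.1 • z with hg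
  have hgc : Continuous g := by fun_prop
  set A : Set (ℝ × EE d) := (Icc (0:ℝ) 1 ×ˢ F) ∩ g ⁻¹' Xᶜ with hA
  have hAc : IsCompact A := (isCompact_Icc.prod hF).inter_right (hX.isClosed_compl.preimage hgc)
  have hAne : A.Nonempty := ⟨(1, p), ⟨⟨by simp, hp⟩, by simpa [hg] using hpz⟩⟩
  obtain ⟨⟨s0, y0⟩, ⟨⟨hs01, hy0F⟩, hy0X⟩, hmin⟩ := hAc.exists_isMinOn hAne continuous_fst.continuousOn
  have hmin' : ∀ s, 0 ≤ s → s < s0 → ∀ y ∈ F, y + s • z ∈ X := by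
    intro s h0 h1 y hy
    by_contra hcon
    have : s0 ≤ s := hmin (show (s, y) ∈ A from ⟨⟨⟨h0, h1.le.trans hs01.2⟩, hy⟩, hcon⟩)
    linarith
  simp only at hs01 hy0F
  have hy0X' : y0 + s0 • z ∉ X := hy0X
  have hs0 : 0 < s0 := by
    rcases hs01.1.eq_or_lt with h | h
    · exfalso; apply hy0X'; rw [← h]; simpa using hFX hy0F
    · exact h
  set Y : Set (EE d) := F ∩ (fun y => y + s0 • z) ⁻¹' Xᶜ with hY
  have hYc : IsCompact Y := hF.inter_right (hX.isClosed_compl.preimage (by fun_prop))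
  have hYO : Y ⊆ O := by
    intro y hy
    by_contra hcon
    exact hy.2 (hb y hy.1 hcon s0 hs01)
  obtain ⟨χ, hχs, hχc, hχO, V, hV, hYV, hVO, hχ1⟩ := exists_cutoff hYc hO hYO
  obtain ⟨δ, hδ, hδX⟩ := hF.exists_thickening_subset_open hX hFX
  set κ : ℝ := δ / (‖z‖ + 1) with hκ
  have hκ0 : 0 < κ := by positivity
  have hneg : ∀ y ∈ F, ∀ t, -κ ≤ t → t ≤ 0 → y + t • z ∈ X := by
    intro y hy t h1 h2
    apply hδX
    rw [mem_thickening_iff]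
    refine ⟨y, hy, ?_⟩
    rw [dist_eq_norm, add_sub_cancel_left, norm_smul, Real.norm_of_nonpos h2]
    calc -t * ‖z‖ ≤ κ * ‖z‖ := by gcongr; linarith
      _ < κ * (‖z‖ + 1) := by gcongr; linarith
      _ = δ := by rw [hκ]; field_simp
  set τ := tau N z y0 with hτ
  have hτs : ContDiff ℝ (⊤ : ℕ∞) τ := tau_contDiff N z y0
  have hτl : ∀ y ∈ F, ∀ t : ℝ, τ (y + t • z) = t := fun y hy t =>
    tau_line hz (by rw [hFc y hy, hFc y0 hy0F]) t
  set ψ : ℝ → ℝ := fun t => Real.smoothTransition (2 / κ * t + 2) with hψ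
  have hψs : ContDiff ℝ (⊤ : ℕ∞) ψ := Real.smoothTransition.contDiff.comp (by fun_prop)
  have hψ0 : ∀ t, t ≤ -κ → ψ t = 0 := by
    intro t ht
    apply Real.smoothTransition.zero_of_nonpos
    have : 2 / κ * t ≤ 2 / κ * (-κ) := by gcongr
    have e : 2 / κ * (-κ) = -2 := by field_simp
    linarith
  have hψ1 : ∀ t, -(κ / 2) ≤ t → ψ t = 1 := by
    intro t ht
    apply Real.smoothTransition.one_of_one_le
    have : 2 / κ * (-(κ / 2)) ≤ 2 / κ * t := by gcongr
    have e : 2 / κ * (-(κ / 2)) = -1 := by field_simp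
    linarith
  set cut : EE d → ℂ := fun y => χ (y - τ y • z) * (ψ (τ y) : ℂ) with hcut
  have hcs : ContDiff ℝ (⊤ : ℕ∞) cut := by
    refine ContDiff.mul (hχs.comp (contDiff_id.sub (hτs.smul contDiff_const))) ?_
    exact Complex.ofRealCLM.contDiff.comp (hψs.comp hτs)
  obtain ⟨U, hUs, hUQ, hU0, hUt⟩ := null_solution hyp hd hN
  set Us : ℝ → EE d → ℂ := fun s y => U (y - (y0 + s • z)) with hUsd
  have hUss : ∀ s, ContDiff ℝ (⊤ : ℕ∞) (Us s) := fun s => hUs.comp (by fun_prop)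
  have hUsQ : ∀ s x, Qop P (Us s) x = 0 := by
    intro s x
    simp only [Qop, hUsd, wd_comp_sub]
    exact hUQ _
  -- the fixed compact set
  set G : EE d × ℝ → EE d := fun q => q.1 + q.2 • z with hG
  have hGc : Continuous G := by fun_prop
  set K : Set (EE d) := G '' ((F \ V) ×ˢ Icc (-κ) s0) ∪ G '' (F ×ˢ Icc (-κ) (-(κ / 2))) with hK
  have hKc : IsCompact K := (((hF.diff hV).prod isCompact_Icc).image hGc).union
    ((hF.prod isCompact_Icc).image hGc)
  have hKX : K ⊆ X := by
    rintro _ (⟨⟨y, t⟩, ⟨hy, ht⟩, rfl⟩ | ⟨⟨y, t⟩, ⟨hy, ht⟩, rfl⟩)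
    · simp only [hG] at hy ht ⊢
      rcases le_total t 0 with h | h
      · exact hneg y hy.1 t ht.1 h
      rcases ht.2.eq_or_lt with h' | h'
      · by_contra hcon
        rw [h'] at hcon
        exact hy.2 (hYV ⟨hy.1, hcon⟩)
      · exact hmin' t h h' y hy.1
    · simp only [hG] at hy ht ⊢
      exact hneg y hy t ht.1 (by linarith [ht.2])
  obtain ⟨L, hLc, hLX, hL⟩ := P_convex P hX hs hKc hKX
  have hmain : ∀ s, 0 ≤ s → s < s0 → y0 + s • z ∈ L := by
    intro s h0 h1
    set φ : EE d → ℂ := fun y => cut y * Us s y with hφ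
    set Cs : Set (EE d) := G '' (F ×ˢ Icc (-κ) s) with hCs
    have hCc : IsCompact Cs := (hF.prod isCompact_Icc).image hGc
    have hCX : Cs ⊆ X := by
      rintro _ ⟨⟨y, t⟩, ⟨hy, ht⟩, rfl⟩
      simp only [hG] at hy ht ⊢
      rcases le_total t 0 with h | h
      · exact hneg y hy t ht.1 h
      · exact hmin' t h (lt_of_le_of_lt ht.2 h1) y hy
    have hsupp : Function.support φ ⊆ Cs := by
      intro y hy
      have hy' : cut y * Us s y ≠ 0 := hy
      have hc := left_ne_zero_of_mul hy'
      have hu := right_ne_zero_of_mul hy'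
      have hc1 : χ (y - τ y • z) ≠ 0 := left_ne_zero_of_mul hc
      have hc2 : ψ (τ y) ≠ 0 := by
        have := right_ne_zero_of_mul hc
        exact_mod_cast this
      refine ⟨(y - τ y • z, τ y), ⟨?_, ?_, ?_⟩, by simp [hG]⟩
      · refine hOF _ ?_ (hχO (subset_tsupport _ hc1))
        rw [tau_proj hz, hFc y0 hy0F]
      · by_contra hcon
        push Not at hcon
        exact hc2 (hψ0 _ hcon.le)
      · by_contra hcon
        push Not at hcon
        apply hu
        apply hU0
        simp only [hτ, tau] at hcon
        rw [lt_div_iff₀ hz] at hcon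
        rw [← sub_sub, inner_sub_left, inner_smul_left]
        simpa using hcon
    have htsupp : tsupport φ ⊆ Cs := closure_minimal hsupp hCc.isClosed
    have hTF : TF φ := ⟨hcs.mul (hUss s), HasCompactSupport.of_support_subset_isCompact hCc hsupp⟩
    -- where the cutoff is one
    have hone : ∀ y : EE d, y - τ y • z ∈ V → -(κ / 2) < τ y → φ =ᶠ[𝓝 y] Us s := by
      intro y hy1 hy2
      have c1 : Continuous fun y : EE d => y - τ y • z := continuous_id.sub
        (hτs.continuous.smul continuous_const)
      filter_upwards [c1.continuousAt.eventually (hV.mem_nhds hy1),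
        hτs.continuous.continuousAt.eventually (lt_mem_nhds hy2)] with w hw1 hw2
      simp only [hφ, hcut]
      rw [hχ1 _ hw1, hψ1 _ hw2.le]
      simp
    have hQ : ∀ x, x ∉ K → Qop P φ x = 0 := by
      intro x hx
      by_cases hxC : x ∈ Cs
      · obtain ⟨⟨y, t⟩, ⟨hy, ht⟩, rfl⟩ := hxC
        simp only at hy ht
        have hyV : y ∈ V := by
          by_contra hcon
          exact hx (Or.inl ⟨(y, t), ⟨⟨hy, hcon⟩, ht.1, ht.2.trans h1.le⟩, rfl⟩)
        have htk : -(κ / 2) < t := by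
          by_contra hcon
          push Not at hcon
          exact hx (Or.inr ⟨(y, t), ⟨hy, ht.1, hcon⟩, rfl⟩)
        have e1 : τ (G (y, t)) = t := hτl y hy t
        have h2 := hone (G (y, t)) (by rw [e1]; simpa [hG] using hyV) (by rw [e1]; exact htk)
        rw [(Qop_eventuallyEq P h2).eq_of_nhds]
        exact hUsQ s _
      · by_contra hcon
        exact hxC (htsupp (tsupport_Qop_subset P φ (subset_tsupport _ hcon)))
    have hvan := hL φ hTF (htsupp.trans hCX) hQ
    by_contra hcon
    have hev : φ =ᶠ[𝓝 (y0 + s • z)] fun _ => 0 := by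
      filter_upwards [hLc.isClosed.isOpen_compl.mem_nhds hcon] with y hy
      exact hvan y hy
    have e1 : τ (y0 + s • z) = s := hτl y0 hy0F s
    have h2 := hone (y0 + s • z) (by rw [e1]; simpa using hYV ⟨hy0F, hy0X'⟩)
      (by rw [e1]; linarith)
    have h3 : Us s =ᶠ[𝓝 (y0 + s • z)] fun _ => 0 := h2.symm.trans hev
    refine (notMem_tsupport_iff_eventuallyEq.2 ?_) hUt
    have ht : Tendsto (fun y : EE d => y + (y0 + s • z)) (𝓝 0) (𝓝 (y0 + s • z)) := by
      have : Continuous (fun y : EE d => y + (y0 + s • z)) := by fun_prop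
      simpa using this.tendsto 0
    filter_upwards [ht.eventually h3] with y hy
    simpa [hUsd] using hy
  have hcl : y0 + s0 • z ∈ L := by
    have hc : Continuous fun s : ℝ => y0 + s • z := by fun_prop
    have ht : Tendsto (fun s : ℝ => y0 + s • z) (𝓝[<] s0) (𝓝 (y0 + s0 • z)) :=
      (hc.tendsto s0).mono_left nhdsWithin_le_nhds
    refine hLc.isClosed.mem_of_tendsto ht ?_
    filter_upwards [Ioo_mem_nhdsLT hs0] with s hs
    exact hmain s hs.1.le hs.2
  exact hy0X' (hLX hcl)

theorem minprin {v : EE d} (hyp : Hyp P v) (hd : 3 ≤ d)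
    {X : Set (EE d)} (hX : IsOpen X) (hs : PSurj P X) {F O : Set (EE d)} (hF : IsCompact F)
    (hFX : F ⊆ X) (hO : IsOpen O) {c : ℝ} (hFc : ∀ y ∈ F, inner ℝ y v = c)
    (hOF : ∀ y, inner ℝ y v = c → y ∈ O → y ∈ F) {a : ℝ}
    (hb : ∀ y ∈ F, y ∉ O → ∀ x, x ∉ X → a ≤ dist y x) {p x0 : EE d} (hp : p ∈ F)
    (hx0 : x0 ∉ X) (hpx : dist p x0 < a) : False := by
  obtain ⟨δ, hδ, hδX⟩ := hF.exists_thickening_subset_open hX hFX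
  set z : EE d := x0 - p with hz
  have hza : ‖z‖ < a := by rw [hz, ← dist_eq_norm, dist_comm]; exact hpx
  have hvv : (inner ℝ v v : ℝ) = 1 := by rw [real_inner_self_eq_norm_sq, hyp.nv]; norm_num
  obtain ⟨κ, hκ0, hκδ, hκa, hκz⟩ : ∃ κ : ℝ, 0 ≤ κ ∧ κ < δ ∧ ‖z‖ + κ < a ∧
      (inner ℝ (z + κ • v) v : ℝ) ≠ 0 := by
    by_cases h : (inner ℝ z v : ℝ) = 0
    · have h1 : 0 < min (δ / 2) ((a - ‖z‖) / 2) := lt_min (by linarith) (by linarith)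
      refine ⟨min (δ / 2) ((a - ‖z‖) / 2), h1.le, ?_, ?_, ?_⟩
      · have := min_le_left (δ / 2) ((a - ‖z‖) / 2); linarith
      · have := min_le_right (δ / 2) ((a - ‖z‖) / 2); linarith
      · rw [inner_add_left, inner_smul_left, h, hvv]
        simpa using h1.ne'
    · exact ⟨0, le_rfl, hδ, by linarith, by simpa using h⟩
  set sh : EE d → EE d := fun y => y + κ • v with hsh
  have key : ∀ N : EE d, (N = v ∨ N = -v) → 0 < (inner ℝ (z + κ • v) N : ℝ) → False := by
    intro N hN hzN
    have hNs : ∃ ε : ℝ, ε ≠ 0 ∧ N = ε • v := by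
      rcases hN with rfl | rfl
      · exact ⟨1, by norm_num, by simp⟩
      · exact ⟨-1, by norm_num, by simp⟩
    obtain ⟨ε, hε, hNε⟩ := hNs
    refine minprin_aux hyp hd hN hX hs (F := (fun y => y - κ • v) '' F) (O := sh ⁻¹' O)
      (c := ε * (c - κ)) (z := z + κ • v) (p := p - κ • v) (hF.image (by fun_prop)) ?_
      (hO.preimage (by fun_prop)) ?_ ?_ hzN ?_ ⟨p, hp, rfl⟩ ?_
    · rintro _ ⟨y, hy, rfl⟩
      apply hδX
      rw [mem_thickening_iff]
      refine ⟨y, hy, ?_⟩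
      simp only [dist_eq_norm, sub_sub_cancel_left, norm_neg, norm_smul, hyp.nv, mul_one]
      rwa [Real.norm_of_nonneg hκ0]
    · rintro _ ⟨y, hy, rfl⟩
      rw [hNε, inner_smul_right, inner_sub_left, hFc y hy, inner_smul_left, hvv]
      simp
    · intro y hy hyO
      refine ⟨y + κ • v, hOF _ ?_ hyO, by simp⟩
      rw [hNε, inner_smul_right] at hy
      have := mul_left_cancel₀ hε hy
      rw [inner_add_left, inner_smul_left, hvv, this]
      simp
    · rintro _ ⟨y, hy, rfl⟩ hyO s hs
      have hyO' : y ∉ O := by simpa [hsh] using hyO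
      by_contra hcon
      have h1 := hb y hy hyO' _ hcon
      have h2 : y - κ • v + s • (z + κ • v) = y + (s • z - ((1 - s) * κ) • v) := by module
      rw [h2, dist_eq_norm, sub_add_cancel_left, norm_neg] at h1
      have h3 : ‖s • z - ((1 - s) * κ) • v‖ ≤ ‖z‖ + κ := by
        refine (norm_sub_le _ _).trans ?_
        rw [norm_smul, norm_smul, hyp.nv, mul_one, Real.norm_of_nonneg hs.1,
          Real.norm_of_nonneg (mul_nonneg (by linarith [hs.2]) hκ0)]
        have := norm_nonneg z
        nlinarith [hs.1, hs.2, mul_le_of_le_one_left this hs.2]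
      linarith
    · have : p - κ • v + (z + κ • v) = x0 := by rw [hz]; module
      rw [this]; exact hx0
  rcases lt_or_gt_of_ne hκz with h | h
  · exact key (-v) (Or.inr rfl) (by rw [inner_neg_right]; linarith)
  · exact key v (Or.inl rfl) h

end

open scoped BigOperators
noncomputable section

open Set Filter Topology MeasureTheory Metric TopologicalSpace

variable {d : ℕ}
variable {P : MvPolynomial (Fin d) ℂ}

lemma annulus_preconn (hd : 3 ≤ d) {v : EE d} (hv : ‖v‖ = 1) (x : EE d) (c r r' : ℝ) (hr : 0 ≤ r)
    (hr' : 0 ≤ r') :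
    IsPreconnected {y : EE d | (inner ℝ y v : ℝ) = c ∧ r < dist y x ∧ dist y x < r'} := by
  set E := (Submodule.span ℝ {v})ᗮ with hE
  have hfin : Module.finrank ℝ E + 1 = d := by
    have h := Submodule.finrank_add_finrank_orthogonal (Submodule.span ℝ {v})
    have h2 : Module.finrank ℝ (Submodule.span ℝ {v}) = 1 :=
      finrank_span_singleton (by intro h0; rw [h0] at hv; simp at hv)
    rw [h2, finrank_euclideanSpace_fin] at h
    exact (add_comm _ _).trans h
  have hrank : 1 < Module.rank ℝ E := by
    rw [← Module.finrank_eq_rank]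
    have : 1 < Module.finrank ℝ E := by omega
    exact_mod_cast this
  have hS := isPreconnected_sphere hrank (0 : E) 1
  set t : ℝ := c - inner ℝ x v with ht
  set J : Set ℝ := {s | 0 ≤ s ∧ r ^ 2 < t ^ 2 + s ^ 2 ∧ t ^ 2 + s ^ 2 < r' ^ 2} with hJ
  have hJc : IsPreconnected J := by
    apply OrdConnected.isPreconnected
    refine ⟨fun a ha b hb s hs => ?_⟩
    refine ⟨ha.1.trans hs.1, ?_, ?_⟩
    · have := ha.2.1
      have h1 := ha.1
      have h2 := hs.1
      nlinarith
    · have := hb.2.2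
      have h1 := ha.1
      have h2 := hs.1
      have h3 := hs.2
      nlinarith
  have hin : ∀ ω : E, (inner ℝ (ω : EE d) v : ℝ) = 0 := fun ω => by
    rw [real_inner_comm]; exact Submodule.mem_orthogonal_singleton_iff_inner_right.1 ω.2
  have hnorm : ∀ (s : ℝ) (z : EE d), (inner ℝ z v : ℝ) = 0 → ‖t • v + z‖ ^ 2 = t ^ 2 + ‖z‖ ^ 2 := by
    intro s z hz
    rw [norm_add_sq_real, inner_smul_left, real_inner_comm, hz, norm_smul, hv]
    simp
  have himg := (hS.prod hJc).image (fun q : E × ℝ => x + t • v + q.2 • (q.1 : EE d)) (by fun_prop)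
  convert himg using 1
  ext y
  simp only [mem_setOf_eq, mem_image, mem_prod, mem_sphere_iff_norm, sub_zero, Prod.exists]
  have hvv : (inner ℝ v v : ℝ) = 1 := by rw [real_inner_self_eq_norm_sq, hv]; norm_num
  constructor
  · rintro ⟨h1, h2, h3⟩
    set z : EE d := y - x - t • v with hz
    have hzv : (inner ℝ z v : ℝ) = 0 := by
      rw [hz, inner_sub_left, inner_sub_left, inner_smul_left, hvv, h1]; simp [ht]
    have hd2 : dist y x ^ 2 = t ^ 2 + ‖z‖ ^ 2 := by
      rw [← hnorm 0 z hzv, dist_eq_norm]; congr 2; rw [hz]; abel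
    have hzE : z ∈ E := by
      rw [hE, Submodule.mem_orthogonal_singleton_iff_inner_right, real_inner_comm, hzv]
    have hJz : ‖z‖ ∈ J := by
      refine ⟨norm_nonneg _, ?_, ?_⟩
      · rw [← hd2]; nlinarith
      · rw [← hd2]; nlinarith [dist_nonneg (x := y) (y := x)]
    by_cases hz0 : z = 0
    · obtain ⟨ξ, hξ, hξv⟩ := exists_orth hd hv
      refine ⟨⟨ξ, ?_⟩, 0, ⟨by simpa using hξ, by simpa [hz0] using hJz⟩, ?_⟩
      · rw [hE, Submodule.mem_orthogonal_singleton_iff_inner_right, hξv]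
      · simp only [zero_smul, add_zero]
        rw [← sub_eq_zero, ← neg_eq_zero, ← hz0, hz]; abel
    · refine ⟨‖z‖⁻¹ • ⟨z, hzE⟩, ‖z‖, ⟨?_, hJz⟩, ?_⟩
      · rw [norm_smul, norm_inv, norm_norm]
        exact inv_mul_cancel₀ (norm_ne_zero_iff.2 hz0)
      · simp only [Submodule.coe_smul]
        rw [smul_smul, mul_inv_cancel₀ (norm_ne_zero_iff.2 hz0), one_smul, hz]; abel
  · rintro ⟨ω, s, ⟨hω, hs⟩, rfl⟩
    have hzv : (inner ℝ (s • (ω : EE d)) v : ℝ) = 0 := by rw [inner_smul_left, hin]; simp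
    have hd2 : dist (x + t • v + s • (ω : EE d)) x ^ 2 = t ^ 2 + s ^ 2 := by
      rw [dist_eq_norm]
      have : x + t • v + s • (ω : EE d) - x = t • v + s • (ω : EE d) := by abel
      rw [this, hnorm 0 _ hzv, norm_smul]
      have h3 : ‖(ω : EE d)‖ = 1 := hω
      rw [h3]; simp
    refine ⟨?_, ?_, ?_⟩
    · rw [inner_add_left, hzv, inner_add_left, inner_smul_left, hvv]; simp [ht]
    · apply lt_of_pow_lt_pow_left₀ 2 dist_nonneg; rw [hd2]; exact hs.2.1
    · apply lt_of_pow_lt_pow_left₀ 2 hr'; rw [hd2]; exact hs.2.2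

theorem propC_core {v : EE d} (hyp : Hyp P v) (hd : 3 ≤ d) {X : Set (EE d)} (hX : IsOpen X)
    (hs : PSurj P X) {C1 F : Set (EE d)} {R a c : ℝ} 
    (hC1 : C1 = {y | ‖y‖ ≤ R ∧ ∀ x, x ∉ X → a ≤ dist y x})
    (hF : IsCompact F) (hFX : F ⊆ X) (hFc : ∀ y ∈ F, (inner ℝ y v : ℝ) = c)
    (hop : ∀ y ∈ F, y ∉ C1 → ∃ e > 0, ∀ z ∈ ball y e, (inner ℝ z v : ℝ) = c → z ∈ F)
    {p : EE d} (hp : p ∈ F) (hpC : p ∉ C1) : False := by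
  have hR : ∀ y ∈ F, ‖y‖ ≤ R := by
    obtain ⟨q, hq, hmax⟩ := hF.exists_isMaxOn ⟨p, hp⟩ continuous_norm.continuousOn
    intro y hy
    refine (hmax hy).trans ?_
    by_contra hcon
    push Not at hcon
    have hqC : q ∉ C1 := by
      rw [hC1]; intro h; exact absurd h.1 (not_le.2 hcon)
    obtain ⟨e, he, hball⟩ := hop q hq hqC
    obtain ⟨ξ, hξ, hξv⟩ := exists_orth hd hyp.nv
    have key : ∀ ζ : EE d, ‖ζ‖ = 1 → (inner ℝ v ζ : ℝ) = 0 → 0 ≤ (inner ℝ q ζ : ℝ) → False := by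
      intro ζ hζ hζv hqζ
      have hm : q + (e / 2) • ζ ∈ F := by
        apply hball
        · rw [mem_ball_iff_norm, add_sub_cancel_left, norm_smul, hζ, Real.norm_of_nonneg (by positivity)]
          linarith
        · rw [inner_add_left, inner_smul_left, real_inner_comm v ζ, hζv, hFc q hq]; simp
      have h1 : ‖q + (e / 2) • ζ‖ ≤ ‖q‖ := hmax hm
      have h2 := norm_add_sq_real q ((e / 2) • ζ)
      rw [inner_smul_right, norm_smul, hζ, Real.norm_of_nonneg (by positivity)] at h2
      have h3 : 0 ≤ e / 2 * (inner ℝ q ζ : ℝ) := by positivity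
      nlinarith [norm_nonneg (q + (e / 2) • ζ), norm_nonneg q]
    rcases le_total 0 (inner ℝ q ξ : ℝ) with h | h
    · exact key ξ hξ hξv h
    · exact key (-ξ) (by simpa using hξ) (by simp [hξv]) (by simpa using h)
  choose! e he hball using hop
  set O : Set (EE d) := ⋃ y ∈ F \ C1, ball y (e y) with hO
  have hOo : IsOpen O := isOpen_biUnion fun _ _ => isOpen_ball
  have hpx : ∃ x0, x0 ∉ X ∧ dist p x0 < a := by
    by_contra hcon
    push Not at hcon
    apply hpC
    rw [hC1]
    exact ⟨hR p hp, hcon⟩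
  obtain ⟨x0, hx0, hpx⟩ := hpx
  refine minprin hyp hd hX hs hF hFX hOo hFc ?_ (a := a) ?_ hp hx0 hpx
  · intro y hy hyO
    simp only [hO, mem_iUnion] at hyO
    obtain ⟨q, hq, hyq⟩ := hyO
    exact hball q hq.1 hq.2 y hyq hy
  · intro y hy hyO
    have : y ∈ C1 := by
      by_contra hcon
      apply hyO
      simp only [hO, mem_iUnion]
      exact ⟨y, ⟨hy, hcon⟩, mem_ball_self (he y hy hcon)⟩
    rw [hC1] at this
    exact this.2

theorem propC {v : EE d} (hyp : Hyp P v) (hd : 3 ≤ d) {X : Set (EE d)} (hX : IsOpen X)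
    (hs : PSurj P X) {C1 : Set (EE d)} {R a r : ℝ} {x : EE d} (hr : 0 ≤ r)
    (hC1 : C1 = {y | ‖y‖ ≤ R ∧ ∀ x, x ∉ X → a ≤ dist y x})
    (hC2X : closedBall x r ⊆ X) (hdis : Disjoint (closedBall x r) C1) 
    {w : EE d → ℂ} (hw : TF w) (hwX : tsupport w ⊆ X)
    (hQ : ∀ y, y ∉ C1 ∪ closedBall x r → Qop P w y = 0) :
    ∀ y, y ∉ C1 ∪ closedBall x r → w y = 0 := by
  have hC1c : IsClosed C1 := by
    have : C1 = {y | ‖y‖ ≤ R} ∩ ⋂ x ∈ Xᶜ, {y | a ≤ dist y x} := by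
      rw [hC1]; ext y; simp
    rw [this]
    refine (isClosed_le continuous_norm continuous_const).inter (isClosed_biInter fun x _ => ?_)
    exact isClosed_le continuous_const (by fun_prop)
  have hCc : IsClosed (C1 ∪ closedBall x r) := hC1c.union isClosed_closedBall
  have hQe : ∀ y, y ∉ C1 ∪ closedBall x r → Qop P w =ᶠ[𝓝 y] fun _ => 0 := fun y hy => by
    filter_upwards [hCc.isOpen_compl.mem_nhds hy] with z hz using hQ z hz
  intro p hp
  by_contra hwp
  have hpT : p ∈ tsupport w := subset_tsupport w hwp
  rw [mem_union, not_or] at hp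
  set c : ℝ := inner ℝ p v with hc
  set H : Set (EE d) := {y | (inner ℝ y v : ℝ) = c} with hH
  have hHc : IsClosed H := isClosed_eq (by fun_prop) continuous_const
  -- dichotomy
  have hdich : ∀ A : Set (EE d), IsPreconnected A → A ⊆ H → (∀ y ∈ A, y ∉ C1 ∪ closedBall x r) →
      ∀ y ∈ A, y ∈ tsupport w → A ⊆ tsupport w := by
    intro A hA hAH hAC y hy hyT z hz
    by_contra hcon
    have := leaf_uc hyp hw.smooth hA (fun x hx => hAH hx) (fun x hx => hQe x (hAC x hx)) hz
      (notMem_tsupport_iff_eventuallyEq.1 hcon) y hy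
    exact notMem_tsupport_iff_eventuallyEq.2 this hyT
  have hloc : ∀ y ∈ tsupport w, y ∈ H → y ∉ C1 → y ∉ closedBall x r →
      ∃ e > 0, ∀ z ∈ ball y e, (inner ℝ z v : ℝ) = c → z ∈ tsupport w ∧ z ∉ closedBall x r := by
    intro y hyT hyH hy1 hy2
    obtain ⟨e, he, hb⟩ := Metric.isOpen_iff.1 hCc.isOpen_compl y (by simpa using ⟨hy1, not_le.1 hy2⟩)
    refine ⟨e, he, fun z hz hzc => ?_⟩
    have hpre : IsPreconnected (ball y e ∩ H) := by
      apply Convex.isPreconnected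
      refine (convex_ball y e).inter ?_
      intro x hx y hy a b ha hb hab
      simp only [hH, mem_setOf_eq, inner_add_left, inner_smul_left] at hx hy ⊢
      rw [hx, hy]
      simp [← add_mul, hab]
    refine ⟨hdich _ hpre inter_subset_right (fun q hq => hb hq.1) y ⟨mem_ball_self he, hyH⟩ hyT
      ⟨hz, hzc⟩, fun h => hb hz (Or.inr h)⟩
  obtain ⟨e0, he0, hthick⟩ := (isCompact_closedBall x r).exists_thickening_subset_open
    hC1c.isOpen_compl (subset_compl_iff_disjoint_right.2 hdis)
  have hr' : ∀ y, dist y x < r + e0 → y ∉ C1 := by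
    intro y hy
    apply hthick
    rw [thickening_closedBall he0 hr]
    rw [mem_ball]; linarith
  set A : Set (EE d) := {y : EE d | (inner ℝ y v : ℝ) = c ∧ r < dist y x ∧ dist y x < r + e0} with hA
  have hApre : IsPreconnected A := annulus_preconn hd hyp.nv x c r (r + e0) hr (by positivity)
  have hAC : ∀ y ∈ A, y ∉ C1 ∪ closedBall x r := by
    rintro y hy (h | h)
    · exact hr' y hy.2.2 h
    · exact absurd (mem_closedBall.1 h) (not_le.2 hy.2.1)
  by_cases hAT : A ⊆ tsupport w
  · refine propC_core hyp hd hX hs hC1 (F := H ∩ (tsupport w ∪ closedBall x r)) (c := c)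
      ((hw.cpt.isCompact.union (isCompact_closedBall x r)).inter_left hHc)
      (fun y hy => hy.2.elim (fun h => hwX h) (fun h => hC2X h)) (fun y hy => hy.1) ?_
      (p := p) ⟨rfl, Or.inl hpT⟩ hp.1
    intro y hy hy1
    by_cases hy2 : y ∈ closedBall x r
    · refine ⟨e0, he0, fun z hz hzc => ⟨hzc, ?_⟩⟩
      by_cases hz2 : z ∈ closedBall x r
      · exact Or.inr hz2
      · left
        apply hAT
        refine ⟨hzc, not_le.1 hz2, ?_⟩
        have := dist_triangle z y x
        have h1 := mem_closedBall.1 hy2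
        have h2 := mem_ball.1 hz
        linarith
    · obtain ⟨e, he, h⟩ := hloc y (hy.2.resolve_right hy2) hy.1 hy1 hy2
      exact ⟨e, he, fun z hz hzc => ⟨hzc, Or.inl (h z hz hzc).1⟩⟩
  · have hAd : ∀ y ∈ A, y ∉ tsupport w := fun y hy hyT =>
      hAT (hdich A hApre (fun z hz => hz.1) hAC y hy hyT)
    have hfar : ∀ z ∈ tsupport w, (inner ℝ z v : ℝ) = c → z ∉ closedBall x r → r + e0 ≤ dist z x := by
      intro z hz hzc hz2
      by_contra hcon
      exact hAd z ⟨hzc, not_le.1 hz2, not_le.1 hcon⟩ hz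
    refine propC_core hyp hd hX hs hC1 (F := (H ∩ {y | r + e0 ≤ dist y x}) ∩ tsupport w) (c := c)
      (hw.cpt.isCompact.inter_left (hHc.inter (isClosed_le continuous_const (by fun_prop))))
      (fun y hy => hwX hy.2) (fun y hy => hy.1.1) ?_
      (p := p) ⟨⟨rfl, hfar p hpT rfl hp.2⟩, hpT⟩ hp.1
    intro y hy hy1
    have hy2 : y ∉ closedBall x r := fun h => by
      have h1 := mem_closedBall.1 h
      have h2 : r + e0 ≤ dist y x := hy.1.2
      linarith
    obtain ⟨e, he, h⟩ := hloc y hy.2 hy.1.1 hy1 hy2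
    exact ⟨e, he, fun z hz hzc => ⟨⟨hzc, hfar z (h z hz hzc).1 hzc (h z hz hzc).2⟩, (h z hz hzc).1⟩⟩

end

open scoped BigOperators
noncomputable section

open Set Filter Topology MeasureTheory Metric TopologicalSpace

variable {d : ℕ}
variable {P : MvPolynomial (Fin d) ℂ}

lemma TF.wd {ρ : EE d → ℂ} (hρ : TF ρ) (w : List (Fin d)) : TF (wd w ρ) :=
  ⟨wd_contDiff w hρ.smooth, hasCompactSupport_wd w hρ.cpt⟩

lemma unif_taylor {g : EE d → ℂ} (hg : TF g) {ε : ℝ} (hε : 0 < ε) :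
    ∃ δ > 0, ∀ y e : EE d, ‖e‖ < δ → ‖g (y + e) - g y - fderiv ℝ g y e‖ ≤ ε * ‖e‖ := by
  have hc : Continuous (fderiv ℝ g) := hg.smooth.continuous_fderiv (by simp)
  have hu := (hg.cpt.fderiv (𝕜 := ℝ)).uniformContinuous_of_continuous hc
  obtain ⟨δ, hδ, h⟩ := Metric.uniformContinuous_iff.1 hu ε hε
  refine ⟨δ, hδ, fun y e he => ?_⟩
  have := (convex_ball y δ).norm_image_sub_le_of_norm_fderiv_le' (𝕜 := ℝ) (f := g) (C := ε)
    (φ := fderiv ℝ g y) (x := y) (y := y + e)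
    (fun x _ => (hg.smooth.differentiable (by simp)) x)
    (fun x hx => by rw [← dist_eq_norm]; exact (h hx).le) (mem_ball_self hδ)
    (by rw [mem_ball_iff_norm]; simpa using he)
  simpa using this

/-- jets of translated reflected functions -/
def Jr (j : ℕ) (L : Compacts (EE d)) (ρ : EE d → ℂ) (y : EE d) : C(L, VV d j) :=
  jet j L (fun z => ρ (y - z))

lemma refl_contDiff {ρ : EE d → ℂ} (hρ : TF ρ) (y : EE d) :
    ContDiff ℝ (⊤ : ℕ∞) (fun z => ρ (y - z)) := hρ.smooth.comp (contDiff_const.sub contDiff_id)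

lemma Jr_apply (j : ℕ) (L : Compacts (EE d)) {ρ : EE d → ℂ} (hρ : TF ρ) (y : EE d) (z : L)
    (w : Wd d j) : Jr j L ρ y z w = (-1) ^ w.1.length * wd w.1 ρ (y - z) := by
  rw [Jr, jet_apply isOpen_univ (subset_univ _) (refl_contDiff hρ y).contDiffOn,
    wd_comp_const_sub _ _ _ hρ.smooth]

lemma norm_neg_one_pow (k : ℕ) : ‖((-1 : ℂ) ^ k)‖ = 1 := by simp

lemma Jr_continuous (j : ℕ) (L : Compacts (EE d)) {ρ : EE d → ℂ} (hρ : TF ρ) :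
    Continuous (Jr j L ρ) := by
  rw [Metric.continuous_iff]
  intro y ε hε
  have h1 : ∀ w : Wd d j, ∃ δ > 0, ∀ a b : EE d, dist a b < δ → dist (wd w.1 ρ a) (wd w.1 ρ b) < ε / 2 :=
    fun w => Metric.uniformContinuous_iff.1 ((hρ.wd w.1).cpt.uniformContinuous_of_continuous
      (hρ.wd w.1).smooth.continuous) (ε / 2) (by positivity)
  choose δ hδ h using h1
  have h2 : ∀ᶠ r in 𝓝[>] (0 : ℝ), ∀ w, r < δ w := by
    rw [eventually_all]
    exact fun w => mem_nhdsWithin_of_mem_nhds (Iio_mem_nhds (hδ w))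
  obtain ⟨r, hr, hr0⟩ := (h2.and self_mem_nhdsWithin).exists
  refine ⟨r, hr0, fun a ha => ?_⟩
  rw [dist_eq_norm]
  refine lt_of_le_of_lt ?_ (half_lt_self hε)
  rw [ContinuousMap.norm_le _ (by positivity)]
  intro z
  rw [pi_norm_le_iff_of_nonneg (by positivity)]
  intro w
  rw [ContinuousMap.sub_apply, Pi.sub_apply, Jr_apply j L hρ, Jr_apply j L hρ, ← mul_sub, norm_mul,
    norm_neg_one_pow, one_mul, ← dist_eq_norm]
  apply (h w _ _ _).le
  rw [dist_sub_right]
  exact ha.trans (hr w)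

/-- convolution of a functional with a test function -/
def cv {j : ℕ} {L : Compacts (EE d)} (S : C(L, VV d j) →L[ℂ] ℂ) (ρ : EE d → ℂ) (y : EE d) : ℂ :=
  S (Jr j L ρ y)

lemma cv_hasFDerivAt {j : ℕ} {L : Compacts (EE d)} (S : C(L, VV d j) →L[ℂ] ℂ) {ρ : EE d → ℂ}
    (hρ : TF ρ) (y : EE d) : HasFDerivAt (cv S ρ) (Lam d fun i => cv S (pderivE i ρ) y) y := by
  rw [hasFDerivAt_iff_isLittleO_nhds_zero, Asymptotics.isLittleO_iff]
  intro ε hε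
  set ε' := ε / (‖S‖ + 1) with hε'
  have hε'0 : 0 < ε' := by positivity
  choose δ hδ h using fun w : Wd d j => unif_taylor (hρ.wd w.1) hε'0
  have h2 : ∀ᶠ e in 𝓝 (0 : EE d), ∀ w, ‖e‖ < δ w := by
    rw [eventually_all]
    intro w
    filter_upwards [ball_mem_nhds (0 : EE d) (hδ w)] with e he
    simpa using he
  filter_upwards [h2] with e he
  have e1 : cv S ρ (y + e) - cv S ρ y - Lam d (fun i => cv S (pderivE i ρ) y) e =
      S (Jr j L ρ (y + e) - Jr j L ρ y - ∑ i, (e i : ℂ) • Jr j L (pderivE i ρ) y) := by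
    rw [map_sub, map_sub, map_sum, Lam_apply]
    simp only [map_smul, smul_eq_mul]
    rfl
  rw [e1]
  have e2 : ‖Jr j L ρ (y + e) - Jr j L ρ y - ∑ i, (e i : ℂ) • Jr j L (pderivE i ρ) y‖ ≤ ε' * ‖e‖ := by
    rw [ContinuousMap.norm_le _ (by positivity)]
    intro z
    rw [pi_norm_le_iff_of_nonneg (by positivity)]
    intro w
    have e3 : (Jr j L ρ (y + e) - Jr j L ρ y - ∑ i, (e i : ℂ) • Jr j L (pderivE i ρ) y) z w =
        (-1) ^ w.1.length * (wd w.1 ρ (y - z + e) - wd w.1 ρ (y - z) -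
          fderiv ℝ (wd w.1 ρ) (y - z) e) := by
      rw [fderiv_eq_Lam, Lam_apply, ContinuousMap.sub_apply, ContinuousMap.sub_apply, Pi.sub_apply,
        Pi.sub_apply, Jr_apply j L hρ, Jr_apply j L hρ, ContinuousMap.sum_apply, Finset.sum_apply,
        mul_sub, mul_sub, Finset.mul_sum, show y + e - (z : EE d) = y - z + e by abel]
      congr 1
      refine Finset.sum_congr rfl fun i _ => ?_
      have e4 := Jr_apply j L (hρ.wd [i]) y z w
      simp only [wd_cons, wd_nil] at e4
      rw [ContinuousMap.smul_apply, Pi.smul_apply, e4, smul_eq_mul]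
      rw [wd_snoc isOpen_univ w.1 i hρ.smooth.contDiffOn _ trivial]
      ring
    rw [e3, norm_mul, norm_neg_one_pow, one_mul]
    exact h w _ _ (he w)
  refine (S.le_opNorm _).trans ?_
  calc ‖S‖ * _ ≤ (‖S‖ + 1) * (ε' * ‖e‖) := by gcongr; linarith
    _ = ε * ‖e‖ := by rw [hε']; field_simp

lemma cv_words {j : ℕ} {L : Compacts (EE d)} (S : C(L, VV d j) →L[ℂ] ℂ) {ρ : EE d → ℂ}
    (hρ : TF ρ) (w : List (Fin d)) : ∀ x ∈ (univ : Set (EE d)),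
    HasFDerivAt (cv S (wd w ρ)) (Lam d fun i => cv S (wd (i :: w) ρ) x) x := fun x _ =>
  cv_hasFDerivAt S (hρ.wd w) x

lemma cv_contDiff {j : ℕ} {L : Compacts (EE d)} (S : C(L, VV d j) →L[ℂ] ℂ) {ρ : EE d → ℂ}
    (hρ : TF ρ) : ContDiff ℝ (⊤ : ℕ∞) (cv S ρ) := 
  contDiffOn_univ.1 (contDiffOn_of_words isOpen_univ (fun w => cv S (wd w ρ)) (cv_words S hρ) [])

lemma wd_cv {j : ℕ} {L : Compacts (EE d)} (S : C(L, VV d j) →L[ℂ] ℂ) {ρ : EE d → ℂ}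
    (hρ : TF ρ) (w : List (Fin d)) (y : EE d) : wd w (cv S ρ) y = cv S (wd w ρ) y :=
  wd_of_words isOpen_univ (fun w => cv S (wd w ρ)) (cv_words S hρ) w y trivial

lemma Qop_cv (P : MvPolynomial (Fin d) ℂ) {j : ℕ} {L : Compacts (EE d)} (S : C(L, VV d j) →L[ℂ] ℂ)
    {ρ : EE d → ℂ} (hρ : TF ρ) (y : EE d) :
    Qop P (cv S ρ) y = S (jet j L (PDop P fun z => ρ (y - z))) := by
  have e : jet j L (PDop P fun z => ρ (y - z)) = ∑ α ∈ P.support,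
      (P.coeff α * (-1) ^ (word (fun i => α i)).length) • Jr j L (wd (word fun i => α i) ρ) y := by
    ext z w
    rw [jet_apply isOpen_univ (subset_univ _) (PDop_contDiff P (refl_contDiff hρ y)).contDiffOn, PDop_eq,
      wd_sum _ isOpen_univ w.1 (f := fun α x => P.coeff α * wd (word fun i => α i) (fun z => ρ (y - z)) x)
        (fun α _ => contDiffOn_const.mul (wd_contDiff _ (refl_contDiff hρ y)).contDiffOn) _ trivial,
      ContinuousMap.sum_apply, Finset.sum_apply]
    refine Finset.sum_congr rfl fun α _ => ?_
    rw [wd_const_mul isOpen_univ w.1 _ (wd_contDiff _ (refl_contDiff hρ y)).contDiffOn _ trivial,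
      wd_comm isOpen_univ _ _ (refl_contDiff hρ y).contDiffOn _ trivial]
    rw [ContinuousMap.smul_apply, Pi.smul_apply, Jr_apply j L (hρ.wd _), smul_eq_mul,
      ← wd_append, wd_comp_const_sub _ _ _ hρ.smooth, List.length_append, wd_append,
      wd_comm isOpen_univ _ _ hρ.smooth.contDiffOn _ trivial]
    ring
  rw [e, map_sum, Qop]
  refine Finset.sum_congr rfl fun α _ => ?_
  rw [wd_cv S hρ, map_smul, smul_eq_mul, cv]
  ring

lemma cv_eq_zero {j : ℕ} {L : Compacts (EE d)} (S : C(L, VV d j) →L[ℂ] ℂ) {ρ : EE d → ℂ}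
    (hρ : TF ρ) {y : EE d} (h : ∀ z ∈ L, y - z ∉ tsupport ρ) : cv S ρ y = 0 := by
  have : Jr j L ρ y = 0 := by
    ext z w
    rw [Jr_apply j L hρ, wd_eq_zero_of_notMem_tsupport _ (h z z.2)]
    simp
  rw [cv, this, map_zero]

lemma integrable_TF_smul {E : Type*} [NormedAddCommGroup E] [NormedSpace ℂ E] {h : EE d → ℂ} (hh : TF h)
    {J : EE d → E} (hJ : Continuous J) : Integrable (fun y => h y • J y) := by
  refine (hh.smooth.continuous.smul hJ).integrable_of_hasCompactSupport ?_
  refine hh.cpt.mono fun y hy => ?_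
  intro h0
  apply hy
  have h1 : h y = 0 := h0
  change h y • J y = 0
  rw [h1, zero_smul]

lemma cv_approx {j : ℕ} {L : Compacts (EE d)} (S : C(L, VV d j) →L[ℂ] ℂ) {h : EE d → ℂ} (hh : TF h)
    (hz : ∃ η0 > 0, ∀ ρ : EE d → ℂ, TF ρ → tsupport ρ ⊆ closedBall 0 η0 →
      ∀ y, h y * cv S ρ y = 0) : S (jet j L h) = 0 := by
  obtain ⟨η0, hη0, hz⟩ := hz
  have key : ∀ ε > 0, ‖S (jet j L h)‖ ≤ ‖S‖ * ε := by
    intro ε hε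
    choose δ hδ hu using fun w : Wd d j => Metric.uniformContinuous_iff.1
      ((hh.wd w.1).cpt.uniformContinuous_of_continuous (hh.wd w.1).smooth.continuous) ε hε
    have h2 : ∀ᶠ r in 𝓝[>] (0 : ℝ), (∀ w, r < δ w) ∧ r < η0 := by
      refine Eventually.and ?_ (mem_nhdsWithin_of_mem_nhds (Iio_mem_nhds hη0))
      rw [eventually_all]
      exact fun w => mem_nhdsWithin_of_mem_nhds (Iio_mem_nhds (hδ w))
    obtain ⟨r, ⟨hr, hrη⟩, hr0⟩ := (h2.and self_mem_nhdsWithin).exists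
    have hr0 : 0 < r := hr0
    let φ : ContDiffBump (0 : EE d) := ⟨r / 2, r, by positivity, by linarith⟩
    set q : EE d → ℝ := φ.normed volume with hq
    set ρ : EE d → ℂ := fun y => (q y : ℂ) with hρd
    have hqc : ContDiff ℝ (⊤ : ℕ∞) q := φ.contDiff_normed
    have hqs : HasCompactSupport q := φ.hasCompactSupport_normed
    have hts : tsupport ρ ⊆ closedBall 0 r := by
      refine (closure_mono ?_).trans (φ.tsupport_normed_eq (μ := volume)).subset
      intro y hy
      simpa [hρd] using hy
    have hρ : TF ρ := ⟨Complex.ofRealCLM.contDiff.comp hqc,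
      hqs.comp_left (g := fun t : ℝ => (t : ℂ)) (by simp)⟩
    have hJc := Jr_continuous j L hρ
    have hItg : Integrable (fun y => h y • Jr j L ρ y) :=
      integrable_TF_smul hh hJc
    set I := ∫ y, h y • Jr j L ρ y with hI
    have hSI : S I = 0 := by
      rw [hI, ← S.integral_comp_comm hItg]
      have : ∀ y, S (h y • Jr j L ρ y) = 0 := fun y => by
        rw [map_smul, smul_eq_mul]
        exact hz ρ hρ (hts.trans (closedBall_subset_closedBall hrη.le)) y
      simp [this]
    have hdiff : ‖jet j L h - I‖ ≤ ε := by
      rw [ContinuousMap.norm_le _ hε.le]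
      intro z
      rw [pi_norm_le_iff_of_nonneg hε.le]
      intro w
      have hIz : I z w = ∫ y, h y * ((-1) ^ w.1.length * wd w.1 ρ (y - z)) := by
        let ev : C(L, VV d j) →L[ℂ] ℂ :=
          (ContinuousLinearMap.proj w).comp (ContinuousMap.evalCLM ℂ z)
        have h3 : I z w = ev I := rfl
        rw [h3, hI, ← ev.integral_comp_comm hItg]
        refine integral_congr_ae (Eventually.of_forall fun y => ?_)
        change (h y • Jr j L ρ y) z w = _
        rw [ContinuousMap.smul_apply, Pi.smul_apply, Jr_apply j L hρ, smul_eq_mul]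
      have hIz2 : I z w = ∫ y, wd w.1 h y * ρ (y - z) := by
        rw [hIz]
        have h4 := ibp_wd w.1 hh.smooth hh.cpt (g := fun y => ρ (y - z))
          (hρ.smooth.comp (contDiff_id.sub contDiff_const))
        rw [wd_comp_sub] at h4
        have h5 : ∀ y, h y * ((-1) ^ w.1.length * wd w.1 ρ (y - z)) =
            (-1) ^ w.1.length * (h y * wd w.1 ρ (y - z)) := fun y => by ring
        simp only [h5]
        rw [integral_const_mul, h4, ← mul_assoc, ← mul_pow]
        simp
      have hρz : Integrable (fun y => ρ (y - z)) :=
        (hρ.smooth.continuous.integrable_of_hasCompactSupport hρ.cpt).comp_sub_right _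
      have hqz : Integrable (fun y => q (y - z)) :=
        (hqc.continuous.integrable_of_hasCompactSupport hqs).comp_sub_right _
      have hq1 : ∫ y, q (y - z) = 1 := by
        rw [integral_sub_right_eq_self q]; exact φ.integral_normed
      have h1 : ∫ y, ρ (y - z) = 1 := by
        rw [hρd, integral_complex_ofReal, hq1]; simp
      have hwi : Integrable (fun y => wd w.1 h y * ρ (y - z)) :=
        ((hh.wd w.1).smooth.continuous.mul (hρ.smooth.continuous.comp
          (continuous_id.sub continuous_const))).integrable_of_hasCompactSupport (hh.wd w.1).cpt.mul_right
      rw [ContinuousMap.sub_apply, Pi.sub_apply, jet_apply isOpen_univ (subset_univ _) hh.smooth.contDiffOn,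
        hIz2]
      have h6 : wd w.1 h z = ∫ y, wd w.1 h z * ρ (y - z) := by
        rw [integral_const_mul, h1, mul_one]
      rw [h6, ← integral_sub (hρz.const_mul _) hwi]
      calc _ ≤ ∫ y, ε * q (y - z) := by
            refine norm_integral_le_of_norm_le (hqz.const_mul _) (Eventually.of_forall fun y => ?_)
            rw [← sub_mul, norm_mul]
            have hqn : 0 ≤ q (y - z) := φ.nonneg_normed _
            have hn : ‖ρ (y - z)‖ = q (y - z) := by
              rw [hρd]; simp [abs_of_nonneg hqn]
            rw [hn]
            by_cases hy : y - z ∈ tsupport ρ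
            · gcongr
              rw [← dist_eq_norm]
              apply (hu w _).le
              have := hts hy
              rw [mem_closedBall_zero_iff] at this
              rw [dist_comm, dist_eq_norm]
              exact this.trans_lt (hr w)
            · have h7 := image_eq_zero_of_notMem_tsupport hy
              rw [← hn, h7]; simp
        _ = ε := by rw [integral_const_mul, hq1, mul_one]
    calc ‖S (jet j L h)‖ = ‖S (jet j L h - I)‖ := by rw [map_sub, hSI, sub_zero]
      _ ≤ ‖S‖ * ‖jet j L h - I‖ := S.le_opNorm _
      _ ≤ ‖S‖ * ε := by gcongr
  by_contra hne
  have hpos := norm_pos_iff.2 hne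
  have := key (‖S (jet j L h)‖ / (2 * (‖S‖ + 1))) (by positivity)
  have h8 : ‖S‖ * (‖S (jet j L h)‖ / (2 * (‖S‖ + 1))) ≤ ‖S (jet j L h)‖ / 2 := by
    rw [mul_div_assoc', div_le_div_iff₀ (by positivity) (by norm_num)]
    nlinarith [norm_nonneg S]
  linarith

end

open scoped BigOperators
noncomputable section

open Set Filter Topology MeasureTheory Metric TopologicalSpace

variable {d : ℕ}
variable {P : MvPolynomial (Fin d) ℂ}

lemma hb_sep {E : Type*} [NormedAddCommGroup E] [NormedSpace ℂ E] (D : Submodule ℂ E) {x : E}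
    (hx : x ∉ closure (D : Set E)) : ∃ T : E →L[ℂ] ℂ, T x ≠ 0 ∧ ∀ y ∈ D, T y = 0 := by
  set M := D.topologicalClosure with hM
  haveI : IsClosed (M : Set E) := D.isClosed_topologicalClosure
  have hxM : M.mkQ x ≠ 0 := by
    rw [Ne, Submodule.mkQ_apply, Submodule.Quotient.mk_eq_zero, hM]
    exact hx
  obtain ⟨g, hg⟩ := SeparatingDual.exists_ne_zero (R := ℂ) hxM
  refine ⟨g.comp M.mkQL, hg, fun y hy => ?_⟩
  have : M.mkQ y = 0 := by
    rw [Submodule.mkQ_apply, Submodule.Quotient.mk_eq_zero]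
    exact D.le_topologicalClosure hy
  change g (M.mkQ y) = 0
  rw [this, map_zero]

lemma exh_open {X : Set (EE d)} (hX : IsOpen X) (n : ℕ) : IsOpen (exhSet X n) := by
  have : exhSet X n = X ∩ ({x | ‖x‖ < (n : ℝ)} ∩
      {x | ENNReal.ofReal (1 / (n : ℝ)) < EMetric.infEdist x Xᶜ}) := rfl
  rw [this]
  exact hX.inter ((isOpen_lt continuous_norm continuous_const).inter
    (isOpen_lt continuous_const EMetric.continuous_infEdist))

lemma exh_margin {X : Set (EE d)} {n : ℕ} (hn : 1 ≤ n) {K : Set (EE d)} (hK : IsCompact K)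
    (hKX : K ⊆ exhSet X n) : ∃ η > 0, ∀ y ∈ K, ‖y‖ ≤ n - η ∧ ∀ x, x ∉ X → 1 / (n : ℝ) + η ≤ dist y x := by
  rcases K.eq_empty_or_nonempty with rfl | hne
  · exact ⟨1, one_pos, fun y hy => absurd hy (notMem_empty y)⟩
  obtain ⟨p, hp, hpm⟩ := hK.exists_isMaxOn hne continuous_norm.continuousOn
  obtain ⟨q, hq, hqm⟩ := hK.exists_isMinOn hne
    (EMetric.continuous_infEdist (s := Xᶜ)).continuousOn
  obtain ⟨r, hr0, hr1, hr2⟩ := ENNReal.lt_iff_exists_real_btwn.1 (hKX hq).2.2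
  have hr3 : 1 / (n : ℝ) < r := (ENNReal.ofReal_lt_ofReal_iff_of_nonneg (by positivity)).1 hr1
  have hp2 : ‖p‖ < n := (hKX hp).2.1
  refine ⟨min (n - ‖p‖) (r - 1 / n), lt_min (by linarith) (by linarith), fun y hy => ⟨?_, ?_⟩⟩
  · have h1 : ‖y‖ ≤ ‖p‖ := hpm hy
    have := min_le_left (n - ‖p‖) (r - 1 / n)
    linarith
  · intro x hx
    have h1 : EMetric.infEdist q Xᶜ ≤ EMetric.infEdist y Xᶜ := hqm hy
    have h2 : EMetric.infEdist y Xᶜ ≤ edist y x := EMetric.infEdist_le_edist_of_mem hx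
    have h3 := (hr2.le.trans h1).trans h2
    rw [edist_dist, ENNReal.ofReal_le_ofReal_iff dist_nonneg] at h3
    have := min_le_right (n - ‖p‖) (r - 1 / n)
    linarith

lemma ball_margin {x : EE d} {ε : ℝ} (hε : 0 < ε) {K : Set (EE d)} (hK : IsCompact K)
    (hKX : K ⊆ ball x ε) : ∃ η > 0, η ≤ ε ∧ ∀ y ∈ K, dist y x ≤ ε - η := by
  rcases K.eq_empty_or_nonempty with rfl | hne
  · exact ⟨ε, hε, le_rfl, fun y hy => absurd hy (notMem_empty y)⟩
  obtain ⟨p, hp, hpm⟩ := hK.exists_isMaxOn (f := fun y => dist y x) hne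
    (by fun_prop)
  have h1 := mem_ball.1 (hKX hp)
  refine ⟨ε - dist p x, by linarith, by linarith [dist_nonneg (x := p) (y := x)], fun y hy => ?_⟩
  have : dist y x ≤ dist p x := hpm hy
  linarith

theorem dense_core {v : EE d} (hyp : Hyp P v) (hd : 3 ≤ d) {X : Set (EE d)} (hX : IsOpen X)
    (hs : PSurj P X) {n : ℕ} (hn : 1 ≤ n) {x : EE d} {ε : ℝ} (hε : 0 < ε)
    (hball : closedBall x ε ⊆ X \ closure (exhSet X n)) {f : EE d → ℂ}
    (hf : Sm f (exhSet X n ∪ ball x ε)) (hPf : ∀ y ∈ exhSet X n ∪ ball x ε, PDop P f y = 0)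
    (l : ℕ) (K : Compacts (EE d)) (hK : (K : Set (EE d)) ⊆ exhSet X n ∪ ball x ε)
    (T : C(K, VV d l) →L[ℂ] ℂ)
    (hT : ∀ g, Sm g X → (∀ x ∈ X, PDop P g x = 0) → T (jet l K g) = 0) : T (jet l K f) = 0 := by
  set U := exhSet X n ∪ ball x ε with hU
  have hXn := exh_open hX n
  have hUo : IsOpen U := hXn.union isOpen_ball
  have hUX : U ⊆ X := union_subset (fun y hy => hy.1) fun y hy => (hball (ball_subset_closedBall hy)).1
  have hdisj : ∀ y, y ∈ exhSet X n → y ∉ closedBall x ε := fun y h1 h2 =>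
    (hball h2).2 (subset_closure h1)
  obtain ⟨j, L, S, hLX, hS⟩ := dual_factor P hX hs l K (hK.trans hUX) T hT
  -- margins
  have hK1 : IsCompact ((K : Set (EE d)) \ ball x ε) := K.isCompact.diff isOpen_ball
  have hK2 : IsCompact ((K : Set (EE d)) \ exhSet X n) := K.isCompact.diff hXn
  obtain ⟨η1, hη1, hm1⟩ := exh_margin (X := X) hn hK1 fun y hy => (hK hy.1).resolve_right hy.2
  obtain ⟨η2, hη2, hη2ε, hm2⟩ := ball_margin hε hK2 fun y hy => (hK hy.1).resolve_left hy.2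
  set η := min η1 η2 / 2 with hη
  have hη0 : 0 < η := by positivity
  have hηa : 2 * η ≤ η1 := by rw [hη]; linarith [min_le_left η1 η2]
  have hηb : 2 * η ≤ η2 := by rw [hη]; linarith [min_le_right η1 η2]
  set C1 : Set (EE d) := {y | ‖y‖ ≤ n - η ∧ ∀ x, x ∉ X → 1 / (n : ℝ) + η ≤ dist y x} with hC1
  set C2 : Set (EE d) := closedBall x (ε - η) with hC2
  have hn0 : 0 < 1 / (n : ℝ) := by
    have : (0 : ℝ) < n := by exact_mod_cast hn
    positivity
  have hC1n : C1 ⊆ exhSet X n := by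
    intro y hy
    refine ⟨?_, by linarith [hy.1], ?_⟩
    · by_contra h
      have := hy.2 y h
      rw [dist_self] at this
      linarith
    · have h1 : ENNReal.ofReal (1 / (n : ℝ) + η) ≤ EMetric.infEdist y Xᶜ := by
        refine EMetric.le_infEdist.2 ?_
        intro z hz
        rw [edist_dist]
        exact ENNReal.ofReal_le_ofReal (hy.2 z hz)
      refine lt_of_lt_of_le ?_ h1
      rw [ENNReal.ofReal_lt_ofReal_iff_of_nonneg hn0.le]
      linarith
  have hC2b : C2 ⊆ ball x ε := closedBall_subset_ball (by linarith)
  have hC2X : C2 ⊆ X := fun y hy => hUX (Or.inr (hC2b hy))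
  have hdis : Disjoint C2 C1 := by
    rw [Set.disjoint_left]
    intro y h2 h1
    exact hdisj y (hC1n h1) (ball_subset_closedBall (hC2b h2))
  have hC1c : IsClosed C1 := by
    have : C1 = {y | ‖y‖ ≤ n - η} ∩ ⋂ x ∈ Xᶜ, {y | 1 / (n : ℝ) + η ≤ dist y x} := by
      rw [hC1]; ext y; simp
    rw [this]
    refine (isClosed_le continuous_norm continuous_const).inter (isClosed_biInter fun x _ => ?_)
    exact isClosed_le continuous_const (by fun_prop)
  have hC1k : IsCompact C1 := by
    refine (isCompact_closedBall (0 : EE d) (n - η)).of_isClosed_subset hC1c fun y hy => ?_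
    rw [mem_closedBall_zero_iff]; exact hy.1
  have hCk : IsCompact (C1 ∪ C2) := hC1k.union (isCompact_closedBall _ _)
  have hCU : C1 ∪ C2 ⊆ U := union_subset_union hC1n hC2b
  have hKη : ∀ z ∈ K, ∀ y, ‖y - z‖ ≤ η → y ∈ C1 ∪ C2 := by
    intro z hz y hyz
    by_cases hzb : z ∈ ball x ε
    · right
      have h1 := hm2 z ⟨hz, fun h => hdisj z h (ball_subset_closedBall hzb)⟩
      have h2 := dist_triangle y z x
      rw [dist_eq_norm y z] at h2
      rw [hC2, mem_closedBall]
      linarith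
    · left
      have h1 := hm1 z ⟨hz, hzb⟩
      refine ⟨?_, fun q hq => ?_⟩
      · have h2 := norm_add_le (y - z) z
        rw [sub_add_cancel] at h2
        linarith [h1.1]
      · have h2 := dist_triangle z y q
        rw [dist_comm z y, dist_eq_norm y z] at h2
        linarith [h1.2 q hq]
  -- cut-off
  obtain ⟨χ, hχ, hχc, hχU, V, hVo, hCV, hVU, hχV⟩ := exists_cutoff hCk hUo hCU
  have hF : ContDiff ℝ (⊤ : ℕ∞) (fun y => χ y * f y) := mul_cutoff_contDiff hUo hχ hχU hf
  have hKV : (K : Set (EE d)) ⊆ V := fun z hz => hCV (hKη z hz z (by simpa using hη0.le))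
  have hfV : ∀ y ∈ V, f y = χ y * f y := fun y hy => by rw [hχV y hy, one_mul]
  have hTf : T (jet l K f) = S (jet j L (PDop P fun y => χ y * f y)) := by
    rw [hS _ hF.contDiffOn, jet_congr hVo hKV hfV]
  set h := PDop P fun y => χ y * f y with hh
  have hhTF : TF h := ⟨PDop_contDiff P hF, by
    refine HasCompactSupport.of_support_subset_isCompact hχc.isCompact ?_
    refine (subset_tsupport _).trans ((tsupport_PDop_subset P _).trans ?_)
    exact closure_mono fun y hy h0 => hy (by
      change χ y * f y = 0
      rw [h0, zero_mul])⟩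
  have hhV : ∀ y ∈ V, h y = 0 := by
    intro y hy
    have : (fun y => χ y * f y) =ᶠ[𝓝 y] f := by
      filter_upwards [hVo.mem_nhds hy] with z hz using (hfV z hz).symm
    rw [hh, (PDop_eventuallyEq P this).eq_of_nhds]
    exact hPf y (hVU hy)
  rw [hTf]
  obtain ⟨η3, hη3, hL3⟩ := L.isCompact.exists_cthickening_subset_open hX hLX
  refine cv_approx S hhTF ⟨min η η3, lt_min hη0 hη3, fun ρ hρ hρs y => ?_⟩
  by_cases hyC : y ∈ C1 ∪ C2
  · rw [hhV y (hCV hyC), zero_mul]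
  rw [mul_eq_zero]
  right
  have hsup : Function.support (cv S ρ) ⊆ cthickening η3 (L : Set (EE d)) := by
    intro q hq
    by_contra hcon
    apply hq
    apply cv_eq_zero S hρ
    intro z hz hqz
    apply hcon
    have h1 := hρs hqz
    rw [mem_closedBall_zero_iff] at h1
    apply mem_cthickening_of_dist_le q z _ _ hz
    rw [dist_eq_norm]
    exact h1.trans (min_le_right _ _)
  have hcl : tsupport (cv S ρ) ⊆ cthickening η3 (L : Set (EE d)) :=
    closure_minimal hsup isClosed_cthickening
  have hw : TF (cv S ρ) := ⟨cv_contDiff S hρ,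
    HasCompactSupport.of_support_subset_isCompact L.isCompact.cthickening hsup⟩
  refine propC hyp hd hX hs (by linarith) hC1 hC2X hdis hw (hcl.trans hL3) ?_ y hyC
  intro q hq
  rw [Qop_cv P S hρ, hS _ (refl_contDiff hρ q).contDiffOn]
  change cv T ρ q = 0
  apply cv_eq_zero T hρ
  intro z hz hqz
  apply hq
  apply hKη z hz
  have h1 := hρs hqz
  rw [mem_closedBall_zero_iff] at h1
  exact h1.trans (min_le_left _ _)

lemma hyp_of_char (hP : P ≠ 0)
    (hchar : ∃ v : Fin d → ℝ, v ≠ 0 ∧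
      {ξ : Fin d → ℝ |
          MvPolynomial.eval (fun i => (ξ i : ℂ))
            (MvPolynomial.homogeneousComponent P.totalDegree P) = 0} =
        Set.range (fun t : ℝ => t • v)) : ∃ v : EE d, Hyp P v := by
  obtain ⟨v, hv, h⟩ := hchar
  set u : EE d := WithLp.toLp 2 v with hu
  have hu0 : u ≠ 0 := by
    intro h0
    apply hv
    funext i
    have := congrArg (fun z : EE d => z i) h0
    simpa [hu] using this
  have hun := norm_pos_iff.2 hu0
  refine ⟨‖u‖⁻¹ • u, ?_, ?_, ?_⟩
  · rw [norm_smul, norm_inv, norm_norm, inv_mul_cancel₀ hun.ne']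
  · intro ξ
    have h1 := Set.ext_iff.1 h (fun i => ξ i)
    simp only [mem_setOf_eq, mem_range] at h1
    rw [h1]
    constructor
    · rintro ⟨t, ht⟩
      refine ⟨t * ‖u‖, ?_⟩
      rw [smul_smul, mul_assoc, mul_inv_cancel₀ hun.ne', mul_one]
      ext i
      have := congrFun ht i
      simpa [hu] using this.symm
    · rintro ⟨s, hs⟩
      refine ⟨s * ‖u‖⁻¹, ?_⟩
      funext i
      rw [hs]
      simp [hu, mul_assoc]
  · by_contra hdeg
    have h0 : P.totalDegree = 0 := by omega
    have h1 : (0 : Fin d → ℝ) ∈ {ξ : Fin d → ℝ |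
          MvPolynomial.eval (fun i => (ξ i : ℂ))
            (MvPolynomial.homogeneousComponent P.totalDegree P) = 0} := by
      rw [h]; exact ⟨0, by simp⟩
    rw [mem_setOf_eq, h0, MvPolynomial.homogeneousComponent_zero, MvPolynomial.eval_C] at h1
    apply hP
    rw [MvPolynomial.totalDegree_eq_zero_iff_eq_C.1 h0, h1, map_zero]

theorem main_final
    {d : ℕ} (hd : 3 ≤ d) (P : MvPolynomial (Fin d) ℂ) (hP : P ≠ 0)
    (hchar : ∃ v : Fin d → ℝ, v ≠ 0 ∧
      {ξ : Fin d → ℝ |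
          MvPolynomial.eval (fun i => (ξ i : ℂ))
            (MvPolynomial.homogeneousComponent P.totalDegree P) = 0} =
        Set.range (fun t : ℝ => t • v))
    (X : Set (EuclideanSpace ℝ (Fin d))) (hX : IsOpen X)
    (hsurj : ∀ g : EuclideanSpace ℝ (Fin d) → ℂ, ContDiffOn ℝ (⊤ : ℕ∞) g X →
      ∃ f : EuclideanSpace ℝ (Fin d) → ℂ, ContDiffOn ℝ (⊤ : ℕ∞) f X ∧ ∀ x ∈ X, PDop P f x = g x)
    (n : ℕ) (hn : 1 ≤ n)
    (x : EuclideanSpace ℝ (Fin d))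
    (ε : ℝ) (hε : 0 < ε)
    (hball : Metric.closedBall x ε ⊆ X \ closure (exhSet X n)) :
    ∀ f : EuclideanSpace ℝ (Fin d) → ℂ,
      ContDiffOn ℝ (⊤ : ℕ∞) f (exhSet X n ∪ Metric.ball x ε) →
      (∀ y ∈ exhSet X n ∪ Metric.ball x ε, PDop P f y = 0) →
      ∀ l : ℕ, ∀ K : Set (EuclideanSpace ℝ (Fin d)), IsCompact K →
        K ⊆ exhSet X n ∪ Metric.ball x ε →
        ∀ δ : ℝ, 0 < δ →
          ∃ g : EuclideanSpace ℝ (Fin d) → ℂ, ContDiffOn ℝ (⊤ : ℕ∞) g X ∧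
            (∀ y ∈ X, PDop P g y = 0) ∧ cSemiNorm l K (fun y => g y - f y) < δ := by
  intro f hf hPf l K hKc hK δ hδ
  obtain ⟨v, hyp⟩ := hyp_of_char hP hchar
  have hUo : IsOpen (exhSet X n ∪ ball x ε) := (exh_open hX n).union isOpen_ball
  have hUX : exhSet X n ∪ ball x ε ⊆ X :=
    union_subset (fun y hy => hy.1) fun y hy => (hball (ball_subset_closedBall hy)).1
  set Kc : Compacts (EE d) := ⟨K, hKc⟩ with hKcd
  have hKX : (Kc : Set (EE d)) ⊆ X := hK.trans hUX
  let N : Submodule ℂ (SS X) :=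
    { carrier := {g | ∀ y ∈ X, PDop P (g : EE d → ℂ) y = 0}
      add_mem' := by
        intro a b ha hb y hy
        have := PDop_add P hX a.2 b.2 y hy
        refine this.trans ?_
        rw [ha y hy, hb y hy, add_zero]
      zero_mem' := by
        intro y hy
        exact congrFun (PDop_zero P) y
      smul_mem' := by
        intro c a ha y hy
        have := PDop_smul P hX c a.2 y hy
        refine this.trans ?_
        rw [ha y hy, mul_zero] }
  let D := N.map (jetL hX l Kc hKX)
  have hcl : jet l Kc f ∈ closure (D : Set C(Kc, VV d l)) := by
    by_contra hcon
    obtain ⟨T, hT1, hT2⟩ := hb_sep D hcon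
    apply hT1
    refine dense_core hyp hd hX hsurj hn hε hball hf hPf l Kc hK T fun g hg hPg => ?_
    exact hT2 _ ⟨⟨g, hg⟩, hPg, rfl⟩
  obtain ⟨b, hb, hdist⟩ := Metric.mem_closure_iff.1 hcl (δ / 2) (by positivity)
  obtain ⟨g, hgN, rfl⟩ := hb
  refine ⟨g, g.2, hgN, ?_⟩
  have hgU : Sm (g : EE d → ℂ) (exhSet X n ∪ ball x ε) := ContDiffOn.mono g.2 hUX
  have hle : ∀ w : List (Fin d), w.length ≤ l → ∀ y ∈ K,
      ‖wd w (fun y => (g : EE d → ℂ) y - f y) y‖ ≤ δ / 2 := by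
    intro w hw y hy
    rw [wd_sub hUo w hgU hf y (hK hy)]
    have h1 := jet_apply (l := l) (K := Kc) hUo hK hgU ⟨y, hy⟩ ⟨w, hw⟩
    have h2 := jet_apply (l := l) (K := Kc) hUo hK hf ⟨y, hy⟩ ⟨w, hw⟩
    simp only at h1 h2
    rw [← h1, ← h2]
    rw [dist_comm, dist_eq_norm] at hdist
    refine le_trans ?_ hdist.le
    refine le_trans ?_ (ContinuousMap.norm_coe_le_norm _ (⟨y, hy⟩ : Kc))
    exact norm_le_pi_norm (((jetL hX l Kc hKX) g - jet l Kc f) ⟨y, hy⟩) ⟨w, hw⟩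
  refine lt_of_le_of_lt ?_ (half_lt_self hδ)
  have h2 : 0 ≤ δ / 2 := by positivity
  refine Real.iSup_le (fun α => Real.iSup_le (fun hα => Real.iSup_le (fun y => Real.iSup_le
    (fun hy => ?_) h2) h2) h2) h2
  rw [mderivE_eq_wd]
  exact hle _ (by rw [length_word]; exact hα) y hy

end

noncomputable section

/-- Let `d ≥ 3` and let `P` be nonzero such that the real zero set of
its principal part is a one-dimensional subspace of `ℝ^d`, and let `X` be open and
`P`-convex for supports (i.e. `P(∂)` is surjective on `C^∞(X)`). Then the restriction map
`C_P^∞(X) → C_P^∞(X_n ∪ B(x,ε))` has dense range. -/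
theorem dense_restriction_one_dimensional_characteristics
    {d : ℕ} (hd : 3 ≤ d) (P : MvPolynomial (Fin d) ℂ) (hP : P ≠ 0)
    (hchar : ∃ v : Fin d → ℝ, v ≠ 0 ∧
      {ξ : Fin d → ℝ |
          MvPolynomial.eval (fun i => (ξ i : ℂ))
            (MvPolynomial.homogeneousComponent P.totalDegree P) = 0} =
        Set.range (fun t : ℝ => t • v))
    (X : Set (EuclideanSpace ℝ (Fin d))) (hX : IsOpen X)
    (hsurj : ∀ g : EuclideanSpace ℝ (Fin d) → ℂ, ContDiffOn ℝ (⊤ : ℕ∞) g X →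
      ∃ f : EuclideanSpace ℝ (Fin d) → ℂ, ContDiffOn ℝ (⊤ : ℕ∞) f X ∧ ∀ x ∈ X, PDop P f x = g x)
    (n : ℕ) (hn : 1 ≤ n)
    (x : EuclideanSpace ℝ (Fin d)) (hx : x ∈ X \ exhSet X n)
    (ε : ℝ) (hε : 0 < ε)
    (hball : Metric.closedBall x ε ⊆ X \ closure (exhSet X n)) :
    ∀ f : EuclideanSpace ℝ (Fin d) → ℂ,
      ContDiffOn ℝ (⊤ : ℕ∞) f (exhSet X n ∪ Metric.ball x ε) →
      (∀ y ∈ exhSet X n ∪ Metric.ball x ε, PDop P f y = 0) →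
      ∀ l : ℕ, ∀ K : Set (EuclideanSpace ℝ (Fin d)), IsCompact K →
        K ⊆ exhSet X n ∪ Metric.ball x ε →
        ∀ δ : ℝ, 0 < δ →
          ∃ g : EuclideanSpace ℝ (Fin d) → ℂ, ContDiffOn ℝ (⊤ : ℕ∞) g X ∧
            (∀ y ∈ X, PDop P g y = 0) ∧ cSemiNorm l K (fun y => g y - f y) < δ := by
  exact main_final hd P hP hchar X hX hsurj n hn x ε hε hball

end
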